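/- Let Σ be a subshift of quasi-finite type. Then the number of periodic points satisfies 0 < limsup_{n→∞} #{x ∈ Σ : σⁿx = x} · e^{−n·h_top(Σ)} < ∞. Moreover, for any weak-QFT subshift Σ one has limsup_{n→∞} (1/n) log #{x ∈ Σ : σⁿx = x} = h_top(Σ), and a weak-QFT has at most countably many maximum measures. -/

import Mathlib

open Filter Set MeasureTheory

namespace QFTPaper

variable {A : Type*} {B : Type*}

/-- The left shift on bi-infinite sequences over the alphabet `A`. -/
def shift (x : ℤ → A) : ℤ → A := fun n => x (n + 1)

/-- A subshift: a closed, shift-invariant subset of `A^ℤ`. -/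
def IsSubshift [TopologicalSpace A] (X : Set (ℤ → A)) : Prop :=
  IsClosed X ∧ shift '' X = X

/-- The finite word `w` occurs in `x` at position `k`. -/
def OccursAt (w : List A) (x : ℤ → A) (k : ℤ) : Prop :=
  ∀ i : Fin w.length, x (k + (i : ℕ)) = w.get i

/-- The language of `X`: words of length `n` occurring in elements of `X`
(at position `0`, which is no restriction by shift-invariance). -/
def Lang (X : Set (ℤ → A)) (n : ℕ) : Set (List A) :=
  { w | w.length = n ∧ ∃ x ∈ X, OccursAt w x 0 }

/-- Topological entropy of a subshift. -/
noncomputable def hTop (X : Set (ℤ → A)) : ℝ :=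
  limsup (fun n : ℕ => Real.log (Nat.card ↥(Lang X n)) / (n : ℝ)) atTop

/-- Follower set of the finite word `w = A₋ₙ…A₀` (listed from `A₋ₙ` to `A₀`):
the set of one-sided sequences `B₀B₁B₂…` with `B ∈ X` and `B₋ₙ…B₀ = A₋ₙ…A₀`,
realized by requiring `w` to occur in `B` at positions `0,…,n` and reading off
the tail of `B` starting at the position of the last letter of `w`.
For the empty word this gives `X₊` (by shift-invariance). -/
def fol (X : Set (ℤ → A)) (w : List A) : Set (ℕ → A) :=
  { y | ∃ B ∈ X, (∀ i : Fin w.length, B ((i : ℕ) : ℤ) = w.get i) ∧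
        ∀ k : ℕ, y k = B ((w.length : ℤ) - 1 + (k : ℤ)) }

/-- `w = A₋ₙ…A₀` is a left constraint:
`∅ ≠ fol(A₋ₙ…A₀) ⊊ fol(A₋ₙ₊₁…A₀)`. -/
def IsLeftConstraint (X : Set (ℤ → A)) (w : List A) : Prop :=
  w ≠ [] ∧ fol X w ≠ ∅ ∧ fol X w ⊂ fol X w.tail

/-- `𝒞(X, n)`: the set of left constraints of length `n`. -/
def LC (X : Set (ℤ → A)) (n : ℕ) : Set (List A) :=
  { w | w.length = n ∧ IsLeftConstraint X w }

/-- The left constraint entropy `h_𝒞(X) = limsup (1/n) log⁺ #𝒞(X,n)`. -/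
noncomputable def hC (X : Set (ℤ → A)) : ℝ :=
  limsup (fun n : ℕ => max 0 (Real.log (Nat.card ↥(LC X n))) / (n : ℝ)) atTop

/-- The time-reversed subshift `X̄`. -/
def rev (X : Set (ℤ → A)) : Set (ℤ → A) :=
  (fun x : ℤ → A => fun n : ℤ => x (-n)) '' X

/-- The symmetric constraint entropy `h_𝒮𝒞(X) = min (h_𝒞(X), h_𝒞(X̄))`. -/
noncomputable def hSC (X : Set (ℤ → A)) : ℝ := min (hC X) (hC (rev X))

/-- Subshift of quasi-finite type: `h_𝒮𝒞(X) < h_top(X)`. -/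
def IsQFT [TopologicalSpace A] (X : Set (ℤ → A)) : Prop :=
  IsSubshift X ∧ hSC X < hTop X

/-- The word `B₋ₘ…B₀` read off from a one-sided past `b` (where `b j = B₋ⱼ`). -/
def wordOf (b : ℕ → A) (m : ℕ) : List A :=
  (List.range (m + 1)).map fun j => b (m - j)

/-- An extendable left constraint: a left constraint `A₋ₙ…A₀` which admits a
one-sided past `B` extending it such that `B₋ₘ…B₀` is again a left constraint
for infinitely many `m`. -/
def IsExtendable (X : Set (ℤ → A)) (w : List A) : Prop :=
  IsLeftConstraint X w ∧
  ∃ b : ℕ → A, wordOf b (w.length - 1) = w ∧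
    ∀ N : ℕ, ∃ m, N ≤ m ∧ IsLeftConstraint X (wordOf b m)

/-- `𝒞*(X, n)`: the set of extendable left constraints of length `n`. -/
def ELC (X : Set (ℤ → A)) (n : ℕ) : Set (List A) :=
  { w | w.length = n ∧ IsExtendable X w }

/-- The extendable left constraint entropy `h*_𝒞(X)`. -/
noncomputable def hCstar (X : Set (ℤ → A)) : ℝ :=
  limsup (fun n : ℕ => Real.log (Nat.card ↥(ELC X n)) / (n : ℝ)) atTop

/-- `h*_𝒮𝒞(X) = min (h*_𝒞(X), h*_𝒞(X̄))`. -/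
noncomputable def hSCstar (X : Set (ℤ → A)) : ℝ := min (hCstar X) (hCstar (rev X))

/-- Subshift of weak quasi-finite type: `h*_𝒮𝒞(X) < h_top(X)`. -/
def IsWeakQFT [TopologicalSpace A] (X : Set (ℤ → A)) : Prop :=
  IsSubshift X ∧ hSCstar X < hTop X

/-- Subshift of finite type: defined by excluding a finite set of finite words. -/
def IsSFT (X : Set (ℤ → A)) : Prop :=
  ∃ F : Finset (List A), X = { x | ∀ w ∈ F, ∀ k : ℤ, ¬ OccursAt w x k }

/-- Sofic subshift: the image of an SFT under a continuous shift-commuting map. -/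
def IsSofic [TopologicalSpace A] (X : Set (ℤ → A)) : Prop :=
  ∃ (B : Type) (_ : Fintype B) (Y : Set (ℤ → B)) (π : (ℤ → B) → (ℤ → A)),
    IsSFT Y ∧
    (letI : TopologicalSpace B := ⊥
     Continuous π) ∧
    (∀ x : ℤ → B, π (shift x) = shift (π x)) ∧ π '' Y = X


/-- Topological conjugacy of subshifts: a homeomorphism commuting with the shifts. -/
def Conjugate [TopologicalSpace A] [TopologicalSpace B]
    (X : Set (ℤ → A)) (Y : Set (ℤ → B)) : Prop :=
  ∃ φ : X ≃ₜ Y, ∀ x x' : X, (x' : ℤ → A) = shift (x : ℤ → A) →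
    (φ x' : ℤ → B) = shift (φ x : ℤ → B)

/-- The cylinder of a word of length `n` placed at positions `0,…,n-1`. -/
def cylSet (n : ℕ) (w : Fin n → A) : Set (ℤ → A) :=
  { x | ∀ i : Fin n, x ((i : ℕ) : ℤ) = w i }

/-- Entropy of the partition of `A^ℤ` into cylinders of length `n`. -/
noncomputable def blockEntropy [Fintype A] [MeasurableSpace A]
    (μ : Measure (ℤ → A)) (n : ℕ) : ℝ :=
  ∑ w : Fin n → A, Real.negMulLog ((μ (cylSet n w)).toReal)

/-- Kolmogorov–Sinai entropy of a shift-invariant measure on `A^ℤ`,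
computed with the natural (generating) partition into cylinders. -/
noncomputable def KSEntropy [Fintype A] [MeasurableSpace A]
    (μ : Measure (ℤ → A)) : ℝ :=
  ⨅ n : ℕ, blockEntropy μ (n + 1) / (n + 1)

/-- A maximum measure: an ergodic shift-invariant Borel probability measure
carried by `X` whose Kolmogorov–Sinai entropy equals the topological entropy of `X`. -/
def IsMaxMeasure [Fintype A] [MeasurableSpace A]
    (X : Set (ℤ → A)) (μ : Measure (ℤ → A)) : Prop :=
  IsProbabilityMeasure μ ∧ μ Xᶜ = 0 ∧ Ergodic shift μ ∧ KSEntropy μ = hTop X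

/-- The number of points of `X` fixed by the `n`-th power of the shift. -/
noncomputable def perCount (X : Set (ℤ → A)) (n : ℕ) : ℕ :=
  Nat.card {x : ℤ → A | x ∈ X ∧ shift^[n] x = x}

end QFTPaper

namespace QFTPaper

section renewal

lemma renewal_le {g q : ℕ → ℝ} (hg : ∀ n, 0 ≤ g n) (hq : ∀ n, 0 ≤ q n) (hq1 : ∀ n, q n ≤ 1)
    (h0 : q 0 = 1) (hr : ∀ n, q (n+1) = ∑ l ∈ Finset.range (n+1), g l * q (n - l)) (L : ℕ) :
    ∑ l ∈ Finset.range L, g l ≤ 1 := by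
  by_contra hcon
  push Not at hcon
  set γ := ∑ l ∈ Finset.range L, g l with hγ
  -- partial sums
  set S : ℕ → ℝ := fun n => ∑ k ∈ Finset.range (n+1), q k with hS
  have hSle : ∀ n, S n ≤ n + 1 := by
    intro n
    calc S n ≤ ∑ k ∈ Finset.range (n+1), (1:ℝ) := Finset.sum_le_sum fun k _ => hq1 k
      _ = n + 1 := by simp
  have hSmono : Monotone S := by
    apply monotone_nat_of_le_succ
    intro n
    simp only [hS]
    rw [Finset.sum_range_succ _ (n+1)]
    linarith [hq (n+1)]
  have hrec : ∀ n, γ * S n ≤ S (n + L) := by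
    intro n
    have h1 : ∀ l ∈ Finset.range L, ∀ k ∈ Finset.range (n+1), True := by intros; trivial
    have h2 : γ * S n = ∑ l ∈ Finset.range L, ∑ k ∈ Finset.range (n+1), g l * q k := by
      rw [hγ, Finset.sum_mul_sum]
    have h3 : S (n + L) = q 0 + ∑ m ∈ Finset.range (n + L), ∑ l ∈ Finset.range (m+1), g l * q (m - l) := by
      simp only [hS]
      rw [Finset.sum_range_succ', add_comm]
      congr 1
      exact Finset.sum_congr rfl fun m _ => hr m
    rw [h2, h3]
    have h4 : ∑ l ∈ Finset.range L, ∑ k ∈ Finset.range (n+1), g l * q k ≤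
        ∑ m ∈ Finset.range (n + L), ∑ l ∈ Finset.range (m+1), g l * q (m - l) := by
      rw [← Finset.sum_product', Finset.sum_sigma']
      apply le_trans _ (Finset.sum_le_sum_of_subset_of_nonneg
        (s := (Finset.range L ×ˢ Finset.range (n+1)).image (fun p => (⟨p.1 + p.2, p.1⟩ : Σ _ : ℕ, ℕ))) _ _)
      · rw [Finset.sum_image]
        · apply le_of_eq
          apply Finset.sum_congr rfl
          rintro ⟨l, k⟩ _
          simp
        · rintro ⟨a, b⟩ _ ⟨c, d⟩ _ h
          simp at h
          simp
          omega
      · intro p hp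
        simp only [Finset.mem_image, Finset.mem_product, Finset.mem_range] at hp
        obtain ⟨⟨l, k⟩, ⟨h1, h2⟩, rfl⟩ := hp
        simp at h1 h2
        simp
        omega
      · intro p _ _
        exact mul_nonneg (hg _) (hq _)
    rw [h0]; linarith
  have hpow : ∀ k : ℕ, γ ^ k ≤ S (k * L) := by
    intro k
    induction k with
    | zero => simp [hS, h0]
    | succ k ih =>
      have := hrec (k * L)
      rw [show (k+1) * L = k * L + L by ring, pow_succ, mul_comm]
      refine le_trans ?_ this
      exact mul_le_mul_of_nonneg_left ih (by linarith)
  have hlim : Tendsto (fun k : ℕ => (((k:ℝ) ^ 1) / γ ^ k)) atTop (nhds 0) :=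
    tendsto_pow_const_div_const_pow_of_one_lt 1 hcon
  have hlim2 : Tendsto (fun k : ℕ => ((1:ℝ) / γ ^ k)) atTop (nhds 0) := by
    have := tendsto_pow_const_div_const_pow_of_one_lt 0 hcon
    simpa using this
  have hlim3 : Tendsto (fun k : ℕ => (L:ℝ) * (((k:ℝ) ^ 1) / γ ^ k) + 1 / γ ^ k) atTop (nhds 0) := by
    simpa using (hlim.const_mul (L:ℝ)).add hlim2
  have := (hlim3.eventually (gt_mem_nhds (show (0:ℝ) < 1 by norm_num))).exists
  obtain ⟨k, hk⟩ := this
  have hγk : 0 < γ ^ k := pow_pos (by linarith) k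
  have h5 := (hpow k).trans (hSle _)
  have : (L:ℝ) * (((k:ℝ) ^ 1) / γ ^ k) + 1 / γ ^ k = ((k * L : ℕ) + 1) / γ ^ k := by
    push_cast; field_simp
  rw [this, div_lt_one hγk] at hk
  linarith

lemma conv_tendsto_zero {T q : ℕ → ℝ} (hT : Summable T) (hT0 : ∀ n, 0 ≤ T n)
    (hq : ∀ n, 0 ≤ q n) (hq1 : ∀ n, q n ≤ 1) (hq0 : Tendsto q atTop (nhds 0)) :
    Tendsto (fun n => ∑ l ∈ Finset.range (n+1), T l * q (n - l)) atTop (nhds 0) := by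
  have h := tendsto_tsum_of_dominated_convergence (𝓕 := atTop) (α := ℕ) (β := ℕ) (G := ℝ)
    (f := fun n l => if l ∈ Finset.range (n+1) then T l * q (n - l) else 0)
    (g := fun _ => 0) (bound := T) hT ?_ ?_
  · simp only [tsum_zero] at h
    refine h.congr fun n => ?_
    rw [tsum_eq_sum (s := Finset.range (n+1))]
    · exact Finset.sum_congr rfl fun l hl => by simp only [hl, if_true]
    · intro l hl; simp only [hl, if_false]
  · intro l
    have h1 : Tendsto (fun n => T l * q (n - l)) atTop (nhds 0) := by
      have := (hq0.comp (tendsto_sub_atTop_nat l)).const_mul (T l)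
      simpa using this
    refine h1.congr' ?_
    filter_upwards [eventually_ge_atTop l] with n hn
    rw [if_pos]
    simp; omega
  · refine Eventually.of_forall fun n l => ?_
    split_ifs
    · rw [Real.norm_of_nonneg (mul_nonneg (hT0 _) (hq _))]
      exact mul_le_of_le_one_right (hT0 _) (hq1 _)
    · simpa using hT0 l

lemma renewal_strict {g q : ℕ → ℝ} (hg : ∀ n, 0 ≤ g n) (hq : ∀ n, 0 ≤ q n) (hq1 : ∀ n, q n ≤ 1)
    (h0 : q 0 = 1) (hr : ∀ n, q (n+1) = ∑ l ∈ Finset.range (n+1), g l * q (n - l))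
    (hq0 : Tendsto q atTop (nhds 0)) {C θ : ℝ} (hθ0 : 0 < θ) (hθ : θ < 1)
    (hgC : ∀ n, g n ≤ C * θ ^ n) :
    ∃ κ γ : ℝ, θ < κ ∧ κ < 1 ∧ γ < 1 ∧ ∀ L, ∑ l ∈ Finset.range L, g l * (κ⁻¹) ^ (l+1) ≤ γ := by
  have hgs : Summable g := Summable.of_nonneg_of_le hg hgC ((summable_geometric_of_lt_one hθ0.le hθ).mul_left C)
  set T : ℕ → ℝ := fun l => ∑' j, g (j + l) with hTdef
  have hgT : ∀ l, T l = g l + T (l+1) := by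
    intro l
    have h := ((summable_nat_add_iff l).2 hgs).tsum_eq_zero_add
    simp only [hTdef]
    rw [h]
    congr 1
    · simp
    · exact tsum_congr fun j => by congr 1; omega
  have hT0 : ∀ l, 0 ≤ T l := fun l => tsum_nonneg fun j => hg _
  have hTC : ∀ l, T l ≤ C * (1 - θ)⁻¹ * θ ^ l := by
    intro l
    have h1 : ∀ j, g (j + l) ≤ (C * θ ^ l) * θ ^ j := by
      intro j
      refine (hgC _).trans_eq ?_
      rw [pow_add]; ring
    have h2 := Summable.tsum_le_tsum h1 ((summable_nat_add_iff l).2 hgs)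
      ((summable_geometric_of_lt_one hθ0.le hθ).mul_left _)
    rw [tsum_mul_left, tsum_geometric_of_lt_one hθ0.le hθ] at h2
    refine h2.trans_eq (by ring)
  have hTs : Summable T := Summable.of_nonneg_of_le hT0 hTC
    ((summable_geometric_of_lt_one hθ0.le hθ).mul_left _)
  have hlt : T 0 < 1 := by
    by_contra hge
    push Not at hge
    set R : ℕ → ℝ := fun n => ∑ l ∈ Finset.range (n+1), T l * q (n - l) with hR
    have hRs : ∀ n, R n ≤ R (n+1) := by
      intro n
      have h1 : R (n+1) = T 0 * q (n+1) + ∑ l ∈ Finset.range (n+1), T (l+1) * q (n - l) := by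
        simp only [hR]
        rw [Finset.sum_range_succ' _ (n+1), add_comm]
        simp
      have h2 : R n = q (n+1) + ∑ l ∈ Finset.range (n+1), T (l+1) * q (n - l) := by
        rw [hr n, ← Finset.sum_add_distrib]
        simp only [hR]
        refine Finset.sum_congr rfl fun l _ => ?_
        rw [hgT l]; ring
      rw [h1, h2]
      have := mul_le_mul_of_nonneg_right hge (hq (n+1))
      linarith
    have hR1 : ∀ n, 1 ≤ R n := by
      intro n
      induction n with
      | zero => simpa [hR, h0] using hge
      | succ n ih => exact ih.trans (hRs n)
    have := conv_tendsto_zero hTs hT0 hq hq1 hq0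
    have := ge_of_tendsto' this hR1
    norm_num at this
  -- continuity
  set κ0 : ℝ := (1 + θ) / 2 with hκ0
  have hκ0p : 0 < κ0 := by positivity
  have hκ0θ : θ < κ0 := by rw [hκ0]; linarith
  have hκ01 : κ0 < 1 := by rw [hκ0]; linarith
  have hC0 : 0 ≤ C := by have := (hg 0).trans (hgC 0); simpa using this
  have hθκ : θ / κ0 < 1 := by rw [div_lt_one hκ0p]; exact hκ0θ
  have hbs : Summable fun l : ℕ => g l * (κ0⁻¹) ^ (l+1) := by
    refine Summable.of_nonneg_of_le (fun l => mul_nonneg (hg l) (by positivity)) (fun l => ?_)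
      ((summable_geometric_of_lt_one (by positivity) hθκ).mul_left (C * κ0⁻¹))
    refine (mul_le_mul_of_nonneg_right (hgC l) (by positivity)).trans_eq ?_
    rw [pow_succ, div_pow, inv_pow]
    field_simp
  have htend : Tendsto (fun t : ℝ => ∑' l, g l * t ^ (l+1)) (nhdsWithin 1 (Ioi 1)) (nhds (∑' l, g l * (1:ℝ) ^ (l+1))) := by
    refine tendsto_tsum_of_dominated_convergence hbs ?_ ?_
    · intro l
      have : Continuous fun t : ℝ => g l * t ^ (l+1) := by fun_prop
      exact (this.tendsto 1).mono_left nhdsWithin_le_nhds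
    · have h1 : (1:ℝ) < κ0⁻¹ := (one_lt_inv₀ hκ0p).2 hκ01
      have : Ioo (1:ℝ) (κ0⁻¹) ∈ nhdsWithin (1:ℝ) (Ioi 1) := Ioo_mem_nhdsGT h1
      filter_upwards [this] with t ht l
      have ht0 : 0 ≤ t := by linarith [ht.1]
      rw [Real.norm_of_nonneg (mul_nonneg (hg l) (by positivity))]
      exact mul_le_mul_of_nonneg_left (pow_le_pow_left₀ ht0 ht.2.le _) (hg l)
  have hval : (∑' l, g l * (1:ℝ) ^ (l+1)) = T 0 := by simp [hTdef]
  rw [hval] at htend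
  set γ := (1 + T 0) / 2 with hγ
  have hγ1 : T 0 < γ := by rw [hγ]; linarith
  have hev := htend.eventually (gt_mem_nhds hγ1)
  have h1 : (1:ℝ) < κ0⁻¹ := (one_lt_inv₀ hκ0p).2 hκ01
  have hmem : Ioo (1:ℝ) (κ0⁻¹) ∈ nhdsWithin (1:ℝ) (Ioi 1) := Ioo_mem_nhdsGT h1
  obtain ⟨t, ht, htm⟩ := (hev.and hmem).exists
  have ht0 : 0 < t := by linarith [htm.1]
  refine ⟨t⁻¹, γ, ?_, inv_lt_one_of_one_lt₀ htm.1, by rw [hγ]; linarith, ?_⟩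
  · calc θ < κ0 := hκ0θ
      _ < t⁻¹ := by rw [lt_inv_comm₀ hκ0p ht0]; exact htm.2
  · intro L
    rw [inv_inv]
    have hs : Summable fun l => g l * t ^ (l+1) := by
      refine Summable.of_nonneg_of_le (fun l => mul_nonneg (hg l) (by positivity)) (fun l => ?_) hbs
      exact mul_le_mul_of_nonneg_left (pow_le_pow_left₀ ht0.le htm.2.le _) (hg l)
    exact (hs.sum_le_tsum _ fun l _ => mul_nonneg (hg l) (by positivity)).trans ht.le

end renewal
end QFTPaper

namespace QFTPaper

section automaton
variable {V A : Type*} [Fintype A]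

open Classical in
/-- number of words of length `n` whose successive states (after the start) avoid `D`. -/
noncomputable def cnt (stp : V → A → V) (D : Set V) : ℕ → V → ℝ
  | 0, _ => 1
  | n+1, v => ∑ a, if stp v a ∈ D then 0 else cnt stp D n (stp v a)

open Classical in
/-- number of words of length `n` leading from `v` to `u` avoiding `D`. -/
noncomputable def pth (stp : V → A → V) (D : Set V) (u : V) : ℕ → V → ℝ
  | 0, v => if v = u then 1 else 0
  | n+1, v => ∑ a, if stp v a ∈ D then 0 else pth stp D u n (stp v a)

open Classical in
/-- number of words of length `n` leading from `v` to `u` for the first time, avoiding `D`. -/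
noncomputable def fr (stp : V → A → V) (D : Set V) (u : V) : ℕ → V → ℝ
  | 0, _ => 0
  | n+1, v => ∑ a, if stp v a ∈ D then 0 else
      if stp v a = u then (if n = 0 then 1 else 0) else fr stp D u n (stp v a)

variable (stp : V → A → V)

lemma cnt_nonneg (D : Set V) (n : ℕ) : ∀ v, 0 ≤ cnt stp D n v := by
  induction n with
  | zero => intro v; simp [cnt]
  | succ n ih =>
    intro v
    simp only [cnt]
    exact Finset.sum_nonneg fun a _ => by split_ifs; exacts [le_rfl, ih _]

lemma pth_nonneg (D : Set V) (u : V) (n : ℕ) : ∀ v, 0 ≤ pth stp D u n v := by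
  induction n with
  | zero => intro v; simp only [pth]; split_ifs <;> norm_num
  | succ n ih =>
    intro v
    simp only [pth]
    exact Finset.sum_nonneg fun a _ => by split_ifs; exacts [le_rfl, ih _]

lemma fr_nonneg (D : Set V) (u : V) (n : ℕ) : ∀ v, 0 ≤ fr stp D u n v := by
  induction n with
  | zero => intro v; simp [fr]
  | succ n ih =>
    intro v
    simp only [fr]
    exact Finset.sum_nonneg fun a _ => by split_ifs; exacts [le_rfl, by norm_num, le_rfl, ih _]

lemma pth_mono {D D' : Set V} (h : D ⊆ D') (u : V) (n : ℕ) : ∀ v, pth stp D' u n v ≤ pth stp D u n v := by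
  induction n with
  | zero => intro v; simp [pth]
  | succ n ih =>
    intro v
    simp only [pth]
    refine Finset.sum_le_sum fun a _ => ?_
    by_cases h1 : stp v a ∈ D
    · simp [h1, h h1]
    · simp only [h1, if_false]
      split_ifs
      · exact pth_nonneg stp D u n _
      · exact ih _

lemma cnt_decomp {D : Set V} {u : V} (hu : u ∉ D) (n : ℕ) : ∀ v,
    cnt stp D n v = cnt stp (insert u D) n v +
      ∑ l ∈ Finset.range n, fr stp D u (l+1) v * cnt stp D (n - (l+1)) u := by
  classical
  induction n with
  | zero => intro v; simp [cnt]
  | succ n ih =>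
    intro v
    simp only [cnt]
    have h1 : ∑ l ∈ Finset.range (n+1), fr stp D u (l+1) v * cnt stp D (n + 1 - (l+1)) u
      = ∑ a, ∑ l ∈ Finset.range (n+1), (if stp v a ∈ D then 0 else
      if stp v a = u then (if l = 0 then 1 else 0) else fr stp D u l (stp v a)) * cnt stp D (n + 1 - (l+1)) u := by
      rw [Finset.sum_comm]
      refine Finset.sum_congr rfl fun l _ => ?_
      rw [← Finset.sum_mul]
      simp only [fr]
    rw [h1, ← Finset.sum_add_distrib]
    refine Finset.sum_congr rfl fun a _ => ?_
    by_cases hD : stp v a ∈ D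
    · simp [hD]
    · by_cases hw : stp v a = u
      · simp only [hw, hu, if_false, mem_insert_iff, true_or, if_true, zero_add]
        rw [Finset.sum_eq_single 0]
        · simp
        · intro l _ hl; simp [hl]
        · simp
      · simp only [hD, hw, if_false, mem_insert_iff, or_self]
        rw [ih, Finset.sum_range_succ' _ n]
        simp [fr]

lemma pth_decomp {D : Set V} {u : V} (hu : u ∉ D) (n : ℕ) : ∀ v,
    pth stp D u (n+1) v =
      ∑ l ∈ Finset.range (n+1), fr stp D u (l+1) v * pth stp D u (n - l) u := by
  classical
  induction n with
  | zero =>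
    intro v
    rw [zero_add, Finset.sum_range_one]
    simp only [pth, fr, Nat.sub_zero, if_true, mul_one]
  | succ n ih =>
    intro v
    rw [pth]
    have h1 : ∑ l ∈ Finset.range (n+1+1), fr stp D u (l+1) v * pth stp D u (n + 1 - l) u
      = ∑ a, ∑ l ∈ Finset.range (n+1+1), (if stp v a ∈ D then 0 else
      if stp v a = u then (if l = 0 then 1 else 0) else fr stp D u l (stp v a)) * pth stp D u (n + 1 - l) u := by
      rw [Finset.sum_comm]
      refine Finset.sum_congr rfl fun l _ => ?_
      rw [← Finset.sum_mul]
      simp only [fr]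
    rw [h1]
    refine Finset.sum_congr rfl fun a _ => ?_
    by_cases hD : stp v a ∈ D
    · simp [hD]
    · by_cases hw : stp v a = u
      · simp only [hw, hu, if_false, if_true]
        rw [Finset.sum_eq_single 0]
        · simp
        · intro l _ hl; simp [hl]
        · simp
      · simp only [hD, hw, if_false]
        rw [ih, Finset.sum_range_succ' _ (n+1)]
        simp [fr]

lemma fr_le_cnt {D : Set V} {u : V} (n : ℕ) : ∀ v,
    fr stp D u (n+1) v ≤ Fintype.card A * cnt stp (insert u D) n v := by
  induction n with
  | zero =>
    intro v
    simp only [fr, cnt, mul_one]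
    calc _ ≤ ∑ _a : A, (1:ℝ) := Finset.sum_le_sum fun a _ => by split_ifs <;> norm_num
      _ = _ := by simp
  | succ n ih =>
    intro v
    rw [fr, cnt, Finset.mul_sum]
    refine Finset.sum_le_sum fun a _ => ?_
    by_cases hD : stp v a ∈ D
    · simp [hD]
    · by_cases hw : stp v a = u
      · simp [hw]
      · simp only [hD, hw, if_false, mem_insert_iff, or_self]
        exact ih _

/-- exponential growth strictly below `H` of the number of paths avoiding `D`. -/
def Slow (R : V → Prop) (H : ℝ) (D : Set V) : Prop :=
  ∃ α : ℝ, 0 < α ∧ α < H ∧ ∀ v, R v → ∃ C : ℝ, ∀ n, cnt stp D n v ≤ C * α ^ n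

lemma renewal_pth {D : Set V} {u : V} (hu : u ∉ D) {H : ℝ} (hH : 0 < H) (n : ℕ) :
    pth stp D u (n+1) u / H ^ (n+1) =
      ∑ l ∈ Finset.range (n+1), (fr stp D u (l+1) u / H ^ (l+1)) * (pth stp D u (n - l) u / H ^ (n-l)) := by
  rw [pth_decomp stp hu, Finset.sum_div]
  refine Finset.sum_congr rfl fun l hl => ?_
  have : n + 1 = (l + 1) + (n - l) := by simp at hl; omega
  conv_lhs => rw [this, pow_add]
  field_simp

lemma slow_step {R : V → Prop} {H : ℝ} (hH : 0 < H) {D : Set V} {u : V} (hu : u ∉ D) (hR : R u)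
    (hp : ∀ n, pth stp D u n u ≤ H ^ n)
    (hp0 : Tendsto (fun n => pth stp D u n u / H ^ n) atTop (nhds 0))
    (hs : Slow stp R H (insert u D)) : Slow stp R H D := by
  obtain ⟨α, hα0, hα, hC⟩ := hs
  obtain ⟨C, hCu⟩ := hC u hR
  have hC1 : 1 ≤ C := by simpa [cnt] using hCu 0
  have hθ0 : 0 < α / H := by positivity
  have hθ1 : α / H < 1 := by rw [div_lt_one hH]; exact hα
  obtain ⟨κ, γ, hκθ, hκ1, hγ1, hsum⟩ := renewal_strict (g := fun l => fr stp D u (l+1) u / H ^ (l+1))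
    (q := fun n => pth stp D u n u / H ^ n)
    (fun n => div_nonneg (fr_nonneg stp D u _ _) (by positivity))
    (fun n => div_nonneg (pth_nonneg stp D u _ _) (by positivity))
    (fun n => by rw [div_le_one (by positivity)]; exact hp n)
    (by simp [pth]) (fun n => renewal_pth stp hu hH n) hp0 hθ0 hθ1
    (C := Fintype.card A * C / H) (fun n => by
      have h1 := (fr_le_cnt stp (D := D) (u := u) n u).trans
        (mul_le_mul_of_nonneg_left (hCu n) (Nat.cast_nonneg _))
      calc _ ≤ Fintype.card A * (C * α ^ n) / H ^ (n+1) := by gcongr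
        _ = _ := by rw [div_pow, pow_succ]; field_simp)
  have hκ0 : 0 < κ := hθ0.trans hκθ
  set β := κ * H with hβ
  have hβ0 : 0 < β := by positivity
  have hαβ : α < β := by rw [div_lt_iff₀ hH] at hκθ; exact hκθ
  have hβH : β < H := by rw [hβ]; nlinarith
  have hγ0 : 0 ≤ γ := by simpa using hsum 0
  set K := C / (1 - γ) with hK
  have h1γ : 0 < 1 - γ := by linarith
  have hK0 : 0 < K := by positivity
  have hKu : ∀ n, cnt stp D n u ≤ K * β ^ n := by
    intro n
    induction n using Nat.strong_induction_on with
    | _ n ih =>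
      rw [cnt_decomp stp hu]
      have h1 : cnt stp (insert u D) n u ≤ C * β ^ n :=
        (hCu n).trans (mul_le_mul_of_nonneg_left (pow_le_pow_left₀ hα0.le hαβ.le n) (by linarith))
      have h2 : ∑ l ∈ Finset.range n, fr stp D u (l+1) u * cnt stp D (n - (l+1)) u ≤
          ∑ l ∈ Finset.range n, (K * β ^ n) * (fr stp D u (l+1) u / H ^ (l+1) * (κ⁻¹) ^ (l+1)) := by
        refine Finset.sum_le_sum fun l hl => ?_
        have hl' : l < n := by simpa using hl
        have h3 := mul_le_mul_of_nonneg_left (ih (n - (l+1)) (by omega)) (fr_nonneg stp D u (l+1) u)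
        refine h3.trans_eq ?_
        have : n = (l+1) + (n - (l+1)) := by omega
        have h4 : β ^ n = κ ^ (l+1) * H ^ (l+1) * β ^ (n - (l+1)) := by
          conv_lhs => rw [this, pow_add, hβ, mul_pow]
        rw [h4, inv_pow]
        field_simp
      rw [← Finset.mul_sum] at h2
      have h5 := mul_le_mul_of_nonneg_left (hsum n) (show 0 ≤ K * β ^ n by positivity)
      have h6 : C * β ^ n + K * β ^ n * γ = K * β ^ n := by
        rw [hK]; field_simp; ring
      linarith
  refine ⟨β, hβ0, hβH, fun v hv => ?_⟩
  obtain ⟨Cv, hCv⟩ := hC v hv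
  have hCv1 : 1 ≤ Cv := by simpa [cnt] using hCv 0
  have hr1 : α / β < 1 := by rw [div_lt_one hβ0]; exact hαβ
  refine ⟨Cv + Fintype.card A * Cv * K / β * (1 - α / β)⁻¹, fun n => ?_⟩
  rw [cnt_decomp stp hu, add_mul]
  refine add_le_add ((hCv n).trans (mul_le_mul_of_nonneg_left (pow_le_pow_left₀ hα0.le hαβ.le n) (by linarith))) ?_
  calc ∑ l ∈ Finset.range n, fr stp D u (l+1) v * cnt stp D (n - (l+1)) u
      ≤ ∑ l ∈ Finset.range n, (Fintype.card A * Cv * K / β * β ^ n) * (α / β) ^ l := by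
        refine Finset.sum_le_sum fun l hl => ?_
        have hl' : l < n := by simpa using hl
        have h1 := (fr_le_cnt stp (D := D) (u := u) l v).trans
          (mul_le_mul_of_nonneg_left (hCv l) (Nat.cast_nonneg _))
        have h2 := mul_le_mul h1 (hKu (n - (l+1))) (cnt_nonneg stp D _ _)
          (mul_nonneg (Nat.cast_nonneg _) (mul_nonneg (by linarith) (by positivity)))
        refine h2.trans_eq ?_
        have : n = (l+1) + (n - (l+1)) := by omega
        have h4 : β ^ n = β ^ (l+1) * β ^ (n - (l+1)) := by
          conv_lhs => rw [this, pow_add]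
        rw [h4, pow_succ, div_pow]
        field_simp
    _ = (Fintype.card A * Cv * K / β * β ^ n) * ∑ l ∈ Finset.range n, (α / β) ^ l := by rw [Finset.mul_sum]
    _ ≤ (Fintype.card A * Cv * K / β * β ^ n) * (1 - α / β)⁻¹ := by
        gcongr
        rw [← tsum_geometric_of_lt_one (by positivity) hr1]
        exact (summable_geometric_of_lt_one (by positivity) hr1).sum_le_tsum _ fun l _ => by positivity
    _ = _ := by ring

lemma slow_finset {R : V → Prop} {H : ℝ} (hH : 0 < H) (T : Finset V) : ∀ D : Set V,
    (∀ u ∈ T, u ∉ D ∧ R u ∧ (∀ n, pth stp D u n u ≤ H ^ n) ∧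
      Tendsto (fun n => pth stp D u n u / H ^ n) atTop (nhds 0)) →
    Slow stp R H (D ∪ T) → Slow stp R H D := by
  classical
  induction T using Finset.induction_on with
  | empty => intro D _ h; simpa using h
  | insert u T huT ih =>
    intro D hT hs
    obtain ⟨h1, h2, h3, h4⟩ := hT u (Finset.mem_insert_self _ _)
    refine slow_step stp hH h1 h2 h3 h4 (ih (insert u D) ?_ ?_)
    · intro w hw
      obtain ⟨g1, g2, g3, g4⟩ := hT w (Finset.mem_insert_of_mem hw)
      have hsub : D ⊆ insert u D := subset_insert _ _
      refine ⟨?_, g2, fun n => (pth_mono stp hsub w n w).trans (g3 n), ?_⟩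
      · rintro (h | h)
        · exact huT (h ▸ hw)
        · exact g1 h
      · refine squeeze_zero (fun n => div_nonneg (pth_nonneg stp _ _ _ _) (by positivity)) (fun n => ?_) g4
        gcongr
        exact pth_mono stp hsub w n w
    · convert hs using 1
      ext x; simp only [mem_union, mem_insert_iff, Finset.coe_insert]; tauto
end automaton
end QFTPaper

namespace QFTPaper

section words
variable {A : Type}

/-- prepend a letter -/
def scons (a : A) (y : ℕ → A) : ℕ → A
  | 0 => a
  | n+1 => y n

/-- prepend a word -/
def app (w : List A) (y : ℕ → A) : ℕ → A := w.foldr scons y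

/-- transition on states -/
def step (S : Set (ℕ → A)) (a : A) : Set (ℕ → A) := {y | scons a y ∈ S}

/-- transition by words -/
def run (S : Set (ℕ → A)) (w : List A) : Set (ℕ → A) := w.foldl step S

@[simp] lemma run_nil (S : Set (ℕ → A)) : run S [] = S := rfl
@[simp] lemma run_cons (S : Set (ℕ → A)) (a : A) (w : List A) : run S (a :: w) = run (step S a) w := rfl
lemma run_append (S : Set (ℕ → A)) (w v : List A) : run S (w ++ v) = run (run S w) v := by
  simp [run, List.foldl_append]

lemma mem_run (S : Set (ℕ → A)) (w : List A) : ∀ y, y ∈ run S w ↔ app w y ∈ S := by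
  induction w generalizing S with
  | nil => intro y; rfl
  | cons a w ih => intro y; rw [run_cons, ih]; rfl

lemma app_append (w v : List A) (y : ℕ → A) : app (w ++ v) y = app w (app v y) := by
  simp [app, List.foldr_append]

lemma run_empty (w : List A) : run (∅ : Set (ℕ → A)) w = ∅ := by
  ext y; simp [mem_run]

lemma run_mono {S T : Set (ℕ → A)} (h : S ⊆ T) (w : List A) : run S w ⊆ run T w := by
  intro y; simp only [mem_run]; exact fun hy => h hy

/-- window -/
def win (x : ℤ → A) : ℤ → ℕ → List A
  | _, 0 => []
  | k, n+1 => x k :: win x (k+1) n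

@[simp] lemma win_zero (x : ℤ → A) (k : ℤ) : win x k 0 = [] := rfl
lemma win_succ (x : ℤ → A) (k : ℤ) (n : ℕ) : win x k (n+1) = x k :: win x (k+1) n := rfl
@[simp] lemma win_length (x : ℤ → A) (n : ℕ) : ∀ k, (win x k n).length = n := by
  induction n with
  | zero => intro k; rfl
  | succ n ih => intro k; simp [win_succ, ih]

lemma win_add (x : ℤ → A) (m n : ℕ) : ∀ k, win x k (m+n) = win x k m ++ win x (k+m) n := by
  induction m with
  | zero => intro k; simp
  | succ m ih =>
    intro k
    rw [show m + 1 + n = (m + n) + 1 by omega, win_succ, win_succ, ih]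
    simp only [List.cons_append]
    congr 3
    push_cast; ring

lemma win_eq_iff (x y : ℤ → A) (n : ℕ) : ∀ k l, win x k n = win y l n ↔ ∀ i : ℕ, i < n → x (k+i) = y (l+i) := by
  induction n with
  | zero => intro k l; simp
  | succ n ih =>
    intro k l
    rw [win_succ, win_succ, List.cons.injEq, ih]
    constructor
    · rintro ⟨h1, h2⟩ i hi
      cases i with
      | zero => simpa using h1
      | succ i =>
        have := h2 i (by omega)
        push_cast
        rw [show k + ((i:ℤ) + 1) = k + 1 + i by ring, show l + ((i:ℤ) + 1) = l + 1 + i by ring]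
        exact this
    · intro h
      refine ⟨by simpa using h 0 (by omega), fun i hi => ?_⟩
      have := h (i+1) (by omega)
      push_cast at this
      rw [show k + ((i:ℤ) + 1) = k + 1 + i by ring, show l + ((i:ℤ) + 1) = l + 1 + i by ring] at this
      exact this

lemma win_congr {x y : ℤ → A} {k l : ℤ} {n : ℕ} (h : ∀ i : ℕ, i < n → x (k+i) = y (l+i)) :
    win x k n = win y l n := (win_eq_iff x y n k l).2 h

lemma win_getElem (x : ℤ → A) (n : ℕ) : ∀ (k : ℤ) (i : ℕ) (hi : i < (win x k n).length), (win x k n)[i] = x (k + i) := by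
  induction n with
  | zero => intro k i hi; simp at hi
  | succ n ih =>
    intro k i hi
    cases i with
    | zero => simp [win_succ]
    | succ i =>
      simp only [win_succ, List.getElem_cons_succ]
      rw [ih]; congr 1; push_cast; ring

lemma win_succ' (x : ℤ → A) (k : ℤ) (n : ℕ) : win x k (n+1) = win x k n ++ [x (k+n)] := by
  rw [win_add]; rfl

/-- shifted sequence -/
def sh (k : ℤ) (x : ℤ → A) : ℤ → A := fun n => x (n + k)

/-- one-sided tail -/
def tl (x : ℤ → A) (k : ℤ) : ℕ → A := fun i => x (k + i)

lemma tl_eq (x : ℤ → A) (n : ℕ) : ∀ k, tl x k = app (win x k n) (tl x (k+n)) := by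
  induction n with
  | zero => intro k; simp [app]
  | succ n ih =>
    intro k
    rw [win_succ]
    show _ = scons (x k) (app (win x (k+1) n) (tl x (k + ((n+1:ℕ):ℤ))))
    rw [show k + ((n+1:ℕ):ℤ) = k + 1 + n by push_cast; ring, ← ih]
    funext i
    cases i with
    | zero => simp [tl, scons]
    | succ i => simp only [tl, scons]; congr 1; push_cast; ring

lemma app_inj (n : ℕ) : ∀ (w : List A) (_ : w.length = n) (y : ℕ → A) (x : ℤ → A) (k : ℤ), app w y = tl x k →
    w = win x k n ∧ y = tl x (k + n) := by
  induction n with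
  | zero =>
    intro w hw y x k h
    rw [List.length_eq_zero_iff] at hw
    subst hw
    simpa [app] using h
  | succ n ih =>
    intro w hw y x k h
    cases w with
    | nil => simp at hw
    | cons a w =>
      simp only [List.length_cons, Nat.add_right_cancel_iff] at hw
      have h0 : a = x k := by have := congrFun h 0; simpa [tl, app, scons] using this
      have h1 : app w y = tl x (k+1) := by
        funext i
        have := congrFun h (i+1)
        simp only [tl, app, scons, List.foldr_cons] at this ⊢
        rw [this]; congr 1; push_cast; ring
      obtain ⟨g1, g2⟩ := ih w hw y x (k+1) h1
      refine ⟨by rw [win_succ, ← g1, h0], ?_⟩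
      rw [g2]; congr 1; push_cast; ring

end words

section subsh
variable {A : Type}

/-- one-sided subshift -/
def Xp (X : Set (ℤ → A)) : Set (ℕ → A) := {y | ∃ B ∈ X, y = tl B 0}

/-- states -/
def F (X : Set (ℤ → A)) (w : List A) : Set (ℕ → A) := run (Xp X) w

lemma F_append (X : Set (ℤ → A)) (w v : List A) : F X (w ++ v) = run (F X w) v := run_append _ _ _

variable [TopologicalSpace A]

lemma shift_mem_iff {X : Set (ℤ → A)} (hX : IsSubshift X) (x : ℤ → A) : shift x ∈ X ↔ x ∈ X := by
  constructor
  · intro h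
    rw [← hX.2] at h
    obtain ⟨y, hy, hxy⟩ := h
    have : x = y := by
      funext n
      have := congrFun hxy (n - 1)
      simpa [shift] using this.symm
    rwa [this]
  · intro h
    rw [← hX.2]; exact ⟨x, h, rfl⟩

lemma sh_nat_mem_iff {X : Set (ℤ → A)} (hX : IsSubshift X) (n : ℕ) : ∀ x : ℤ → A, sh n x ∈ X ↔ x ∈ X := by
  induction n with
  | zero => intro x; rw [show sh ((0:ℕ):ℤ) x = x by funext i; simp [sh]]
  | succ n ih =>
    intro x
    rw [← shift_mem_iff hX x, ← ih (shift x)]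
    have : sh ((n+1:ℕ):ℤ) x = sh n (shift x) := by
      funext i; simp only [sh, shift]; congr 1; push_cast; ring
    rw [this]

lemma sh_mem_iff {X : Set (ℤ → A)} (hX : IsSubshift X) (k : ℤ) (x : ℤ → A) : sh k x ∈ X ↔ x ∈ X := by
  rcases Int.eq_nat_or_neg k with ⟨n, rfl | rfl⟩
  · exact sh_nat_mem_iff hX n x
  · rw [← sh_nat_mem_iff hX n (sh (-(n:ℤ)) x)]
    have : sh (n:ℤ) (sh (-(n:ℤ)) x) = x := by funext i; simp [sh]
    rw [this]

lemma tl_sh (x : ℤ → A) (k l : ℤ) : tl (sh k x) l = tl x (l + k) := by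
  funext i; simp only [tl, sh]; congr 1; ring

lemma win_sh (x : ℤ → A) (k l : ℤ) (n : ℕ) : win (sh k x) l n = win x (l + k) n := by
  apply win_congr; intro i _; simp only [sh]; congr 1; ring

lemma tl_mem {X : Set (ℤ → A)} (hX : IsSubshift X) {x : ℤ → A} (hx : x ∈ X) (k : ℤ) : tl x k ∈ Xp X := by
  refine ⟨sh k x, (sh_mem_iff hX k x).2 hx, ?_⟩
  rw [tl_sh]; simp

lemma mem_F {X : Set (ℤ → A)} (hX : IsSubshift X) {w : List A} {y : ℕ → A} :
    y ∈ F X w ↔ ∃ B ∈ X, ∃ k : ℤ, win B k w.length = w ∧ y = tl B (k + w.length) := by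
  rw [F, mem_run]
  constructor
  · rintro ⟨B, hB, h⟩
    obtain ⟨h1, h2⟩ := app_inj w.length w rfl y B 0 h
    exact ⟨B, hB, 0, h1.symm, h2⟩
  · rintro ⟨B, hB, k, h1, h2⟩
    rw [h2]
    conv => enter [2, 1]; rw [← h1]
    rw [← tl_eq]
    exact tl_mem hX hB k

lemma tl_mem_F {X : Set (ℤ → A)} (hX : IsSubshift X) {x : ℤ → A} (hx : x ∈ X) (k : ℤ) (n : ℕ) :
    tl x (k + n) ∈ F X (win x k n) :=
  (mem_F hX).2 ⟨x, hx, k, by simp, by simp⟩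

lemma F_win_ne {X : Set (ℤ → A)} (hX : IsSubshift X) {x : ℤ → A} (hx : x ∈ X) (k : ℤ) (n : ℕ) :
    F X (win x k n) ≠ ∅ := Set.Nonempty.ne_empty ⟨_, tl_mem_F hX hx k n⟩

lemma step_Xp {X : Set (ℤ → A)} (hX : IsSubshift X) (a : A) : step (Xp X) a ⊆ Xp X := by
  intro y hy
  have h : y ∈ F X [a] := hy
  obtain ⟨B, hB, k, h1, h2⟩ := (mem_F hX).1 h
  rw [h2]; exact tl_mem hX hB _

lemma F_cons_sub {X : Set (ℤ → A)} (hX : IsSubshift X) (a : A) (w : List A) : F X (a :: w) ⊆ F X w :=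
  run_mono (step_Xp hX a) w

lemma F_append_sub {X : Set (ℤ → A)} (hX : IsSubshift X) (v w : List A) : F X (v ++ w) ⊆ F X w := by
  induction v with
  | nil => exact subset_rfl
  | cons a v ih => exact (F_cons_sub hX a _).trans ih

lemma lang_iff {X : Set (ℤ → A)} (hX : IsSubshift X) (n : ℕ) (w : List A) :
    w ∈ Lang X n ↔ w.length = n ∧ F X w ≠ ∅ := by
  rw [← Set.nonempty_iff_ne_empty]
  simp only [Lang, mem_ofPred_eq]
  refine and_congr_right fun hn => ?_
  constructor
  · rintro ⟨x, hx, h⟩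
    refine ⟨_, (mem_F hX).2 ⟨x, hx, 0, ?_, rfl⟩⟩
    apply List.ext_getElem (by simp)
    intro i h1 h2
    rw [win_getElem]; exact h ⟨i, h2⟩
  · rintro ⟨y, hy⟩
    obtain ⟨B, hB, k, h1, -⟩ := (mem_F hX).1 hy
    refine ⟨sh k B, (sh_mem_iff hX k B).2 hB, fun i => ?_⟩
    simp only [sh, List.get_eq_getElem]
    have h3 : ∀ (u : List A) (j : ℕ) (_ : u = w) (h : j < u.length) (h' : j < w.length), u[j] = w[j] := by
      rintro u j rfl h h'; rfl
    rw [← h3 _ i h1 (by simp) i.2, win_getElem]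
    congr 1; ring

lemma mem_of_windows {X : Set (ℤ → A)} [DiscreteTopology A] (hX : IsSubshift X) (x : ℤ → A)
    (h : ∀ n : ℕ, ∃ B ∈ X, ∀ i : ℤ, |i| ≤ n → B i = x i) : x ∈ X := by
  choose B hB h using h
  have : Tendsto B atTop (nhds x) := by
    rw [tendsto_pi_nhds]
    intro i
    apply tendsto_const_nhds.congr'
    filter_upwards [eventually_ge_atTop i.natAbs] with n hn
    rw [h n i]
    rw [Int.abs_eq_natAbs]; exact_mod_cast hn
  exact hX.1.mem_of_tendsto this (Eventually.of_forall hB)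

lemma mem_of_F {X : Set (ℤ → A)} [DiscreteTopology A] (hX : IsSubshift X) (x : ℤ → A)
    (h : ∀ n : ℕ, F X (win x (-n) (2*n+1)) ≠ ∅) : x ∈ X := by
  refine mem_of_windows hX x fun n => ?_
  obtain ⟨y, hy⟩ := Set.nonempty_iff_ne_empty.2 (h n)
  obtain ⟨B, hB, k, h1, -⟩ := (mem_F hX).1 hy
  refine ⟨sh (k+n) B, (sh_mem_iff hX _ B).2 hB, fun i hi => ?_⟩
  rw [win_length, win_eq_iff] at h1
  have h2 := h1 (i+n).toNat (by rw [abs_le] at hi; omega)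
  rw [abs_le] at hi
  rw [Int.toNat_of_nonneg (by omega)] at h2
  simp only [sh]
  rw [show i + (k+n) = k + (i+n) by ring, h2]; congr 1; ring

/-- left constraints, state version -/
def LC' (X : Set (ℤ → A)) (w : List A) : Prop := w ≠ [] ∧ F X w ≠ ∅ ∧ F X w ≠ F X w.tail

lemma mem_fol {X : Set (ℤ → A)} (hX : IsSubshift X) (w : List A) (a : A) (y : ℕ → A) :
    y ∈ fol X (w ++ [a]) ↔ y 0 = a ∧ (fun i => y (i+1)) ∈ F X (w ++ [a]) := by
  constructor
  · rintro ⟨B, hB, h1, h2⟩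
    have hw : win B 0 (w ++ [a]).length = w ++ [a] := by
      apply List.ext_getElem (by simp)
      intro i g1 g2
      rw [win_getElem, zero_add]; exact h1 ⟨i, g2⟩
    refine ⟨?_, (mem_F hX).2 ⟨B, hB, 0, hw, ?_⟩⟩
    · rw [h2 0]
      have := h1 ⟨w.length, by simp⟩
      simp at this ⊢
      exact this
    · funext i; simp only [tl]; rw [h2]; congr 1; push_cast; ring
  · rintro ⟨h0, h⟩
    obtain ⟨B, hB, k, h1, h2⟩ := (mem_F hX).1 h
    have h3 : ∀ i (hi : i < (w ++ [a]).length), B (k + i) = (w ++ [a])[i] := by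
      intro i hi
      have h3 : ∀ (u v : List A) (j : ℕ) (_ : u = v) (h : j < u.length) (h' : j < v.length), u[j] = v[j] := by
        rintro u _ j rfl h h'; rfl
      rw [← h3 _ _ i h1 (by rw [win_length]; exact hi) hi, win_getElem]
    refine ⟨sh k B, (sh_mem_iff hX k B).2 hB, fun i => ?_, fun i => ?_⟩
    · simp only [sh, List.get_eq_getElem]
      rw [← h3 _ i.2]; congr 1; ring
    · cases i with
      | zero =>
        rw [h0]
        have := h3 w.length (by simp)
        simp at this
        simp [sh]
        rw [← this]; congr 1; ring
      | succ i =>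
        have := congrFun h2 i
        simp only [tl] at this
        rw [this]; simp only [sh]; congr 1; push_cast; ring

lemma fol_sub_iff {X : Set (ℤ → A)} (hX : IsSubshift X) (w v : List A) (a : A) :
    fol X (w ++ [a]) ⊆ fol X (v ++ [a]) ↔ F X (w ++ [a]) ⊆ F X (v ++ [a]) := by
  constructor
  · intro h y hy
    have : scons a y ∈ fol X (w ++ [a]) := (mem_fol hX _ _ _).2 ⟨rfl, hy⟩
    exact ((mem_fol hX _ _ _).1 (h this)).2
  · intro h y hy
    rw [mem_fol hX] at hy ⊢
    exact ⟨hy.1, h hy.2⟩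

lemma isLC_iff {X : Set (ℤ → A)} (hX : IsSubshift X) (w : List A) (hw : 2 ≤ w.length) :
    IsLeftConstraint X w ↔ LC' X w := by
  obtain ⟨b, v, rfl⟩ : ∃ b v, w = b :: v := by
    cases w with
    | nil => simp at hw
    | cons b v => exact ⟨b, v, rfl⟩
  obtain ⟨u, a, rfl⟩ : ∃ u a, v = u ++ [a] := by
    refine ⟨v.dropLast, v.getLast (by rintro rfl; simp at hw), ?_⟩
    rw [List.dropLast_append_getLast]
  have e : b :: (u ++ [a]) = (b :: u) ++ [a] := rfl
  rw [IsLeftConstraint, LC', List.tail_cons]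
  refine and_congr_right fun _ => and_congr ?_ ?_
  · rw [← Set.nonempty_iff_ne_empty, ← Set.nonempty_iff_ne_empty, e]
    constructor
    · rintro ⟨y, hy⟩; exact ⟨_, ((mem_fol hX _ _ _).1 hy).2⟩
    · rintro ⟨y, hy⟩; exact ⟨scons a y, (mem_fol hX _ _ _).2 ⟨rfl, hy⟩⟩
  · rw [ssubset_iff_subset_not_subset, e, fol_sub_iff hX, fol_sub_iff hX, ← e]
    have := F_cons_sub hX b (u ++ [a])
    constructor
    · rintro ⟨_, h⟩ h'; exact h h'.symm.subset
    · intro h; exact ⟨this, fun h' => h (this.antisymm h')⟩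

lemma LC'_prefix {X : Set (ℤ → A)} (w v : List A) (hw : w ≠ []) (h : LC' X (w ++ v)) : LC' X w := by
  obtain ⟨-, h2, h3⟩ := h
  refine ⟨hw, fun h => h2 ?_, fun h => h3 ?_⟩
  · rw [F_append, h, run_empty]
  · rw [List.tail_append_of_ne_nil hw, F_append, F_append, h]

end subsh
end QFTPaper

namespace QFTPaper

section wfin
variable {A : Type} [Fintype A]

/-- all words of length `n` -/
noncomputable def words (A : Type) [Fintype A] (n : ℕ) : Finset (List A) := (List.finite_length_eq A n).toFinset

@[simp] lemma mem_words (n : ℕ) (w : List A) : w ∈ words A n ↔ w.length = n := by simp [words]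

lemma words_zero : words A 0 = {[]} := by ext w; simp

lemma sum_words_succ {M : Type*} [AddCommMonoid M] (n : ℕ) (P : List A → M) :
    ∑ w ∈ words A (n+1), P w = ∑ a : A, ∑ w ∈ words A n, P (a :: w) := by
  rw [← Finset.sum_product']
  symm
  refine Finset.sum_bij (fun p _ => p.1 :: p.2) ?_ ?_ ?_ ?_
  · rintro ⟨a, w⟩ h; simpa using h
  · rintro ⟨a, w⟩ _ ⟨b, v⟩ _ h; simpa using h
  · intro w hw
    cases w with
    | nil => simp at hw
    | cons a w => exact ⟨(a, w), by simpa using hw, rfl⟩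
  · intros; rfl

lemma sum_words_add {M : Type*} [AddCommMonoid M] (m n : ℕ) : ∀ (P : List A → M),
    ∑ w ∈ words A (m+n), P w = ∑ u ∈ words A m, ∑ v ∈ words A n, P (u ++ v) := by
  induction m with
  | zero => intro P; simp [words_zero]
  | succ m ih =>
    intro P
    rw [show m + 1 + n = (m + n) + 1 by omega, sum_words_succ, sum_words_succ]
    refine Finset.sum_congr rfl fun a _ => ?_
    rw [ih]; rfl

lemma sum_words_one {M : Type*} [AddCommMonoid M] (P : List A → M) :
    ∑ w ∈ words A 1, P w = ∑ a : A, P [a] := by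
  rw [sum_words_succ]; simp [words_zero]

lemma sum_ofFn {M : Type*} [AddCommMonoid M] (n : ℕ) (P : List A → M) :
    ∑ w : Fin n → A, P (List.ofFn w) = ∑ w ∈ words A n, P w := by
  refine Finset.sum_bij (fun w _ => List.ofFn w) ?_ ?_ ?_ ?_
  · intro w _; simp
  · intro w _ v _ h; exact List.ofFn_injective h
  · intro w hw
    rw [mem_words] at hw
    subst hw
    exact ⟨w.get, Finset.mem_univ _, List.ofFn_get w⟩
  · intros; rfl

lemma card_words (n : ℕ) : (words A n).card = Fintype.card A ^ n := by
  have := sum_ofFn (A := A) n (fun _ => (1:ℕ))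
  simp at this
  exact this.symm

open Classical in
/-- number of words of length `n` in `L` -/
noncomputable def nw (L : Set (List A)) (n : ℕ) : ℝ := ∑ w ∈ words A n, if w ∈ L then 1 else 0

lemma nw_nonneg (L : Set (List A)) (n : ℕ) : 0 ≤ nw L n :=
  Finset.sum_nonneg fun w _ => by split_ifs <;> norm_num

lemma nw_mono {L L' : Set (List A)} (h : L ⊆ L') (n : ℕ) : nw L n ≤ nw L' n := by
  refine Finset.sum_le_sum fun w _ => ?_
  by_cases h1 : w ∈ L
  · simp [h1, h h1]
  · simp only [h1, if_false]; split_ifs <;> norm_num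

lemma nw_mono' {L L' : Set (List A)} (n : ℕ) (h : ∀ w ∈ L, w.length = n → w ∈ L') : nw L n ≤ nw L' n := by
  refine Finset.sum_le_sum fun w hw => ?_
  by_cases h1 : w ∈ L
  · simp [h1, h w h1 (by simpa using hw)]
  · simp only [h1, if_false]; split_ifs <;> norm_num

lemma card_eq_nw (L : Set (List A)) (n : ℕ) : (Nat.card ↥({w | w.length = n ∧ w ∈ L} : Set (List A)) : ℝ) = nw L n := by
  classical
  rw [nw, Finset.sum_ite, Finset.sum_const_zero, add_zero, Finset.sum_const, nsmul_eq_mul, mul_one]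
  congr 1
  rw [Nat.card_coe_set_eq, ← Set.ncard_coe_finset]
  congr 1
  ext w; simp

lemma nw_le (L : Set (List A)) (n : ℕ) : nw L n ≤ (Fintype.card A : ℝ) ^ n := by
  calc nw L n ≤ ∑ w ∈ words A n, (1:ℝ) := Finset.sum_le_sum fun w _ => by split_ifs <;> norm_num
    _ = _ := by simp [card_words]

lemma card_Lang (X : Set (ℤ → A)) (n : ℕ) : (Nat.card ↥(Lang X n) : ℝ) = nw {w | ∃ n, w ∈ Lang X n} n := by
  rw [← card_eq_nw]
  congr 3
  ext w
  constructor
  · intro h; exact ⟨h.1, n, h⟩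
  · rintro ⟨h, m, h'⟩
    have := h'.1
    rw [h] at this; rwa [this]

lemma log_nw_div_le (c : ℝ) (n : ℕ) (h0 : 0 ≤ c) (hc : c ≤ (Fintype.card A : ℝ) ^ n) :
    Real.log c / n ≤ Real.log (Fintype.card A) := by
  rcases Nat.eq_zero_or_pos n with rfl | hn
  · simp; exact Real.log_natCast_nonneg _
  · rw [div_le_iff₀ (by exact_mod_cast hn)]
    rcases h0.eq_or_lt with rfl | hpos
    · simp; exact mul_nonneg (Real.log_natCast_nonneg _) (by positivity)
    · rw [mul_comm, ← Real.log_pow]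
      exact Real.log_le_log hpos hc

/-- exponential bounds from limsup -/
lemma exp_bound_of_limsup {c u : ℕ → ℝ} (hc : ∀ n, 0 ≤ c n) (K : ℝ) (huK : ∀ n, u n ≤ K)
    (hu : ∀ n, 1 ≤ n → 0 < c n → Real.log (c n) / n ≤ u n) {t : ℝ} (ht : limsup u atTop < t) :
    ∃ C : ℝ, 0 < C ∧ ∀ n, c n ≤ C * Real.exp (t * n) := by
  have hev : ∀ᶠ n in atTop, u n < t := eventually_lt_of_limsup_lt ht (isBoundedUnder_of ⟨K, huK⟩)
  obtain ⟨N, hN⟩ := eventually_atTop.1 hev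
  set C := 1 + ∑ n ∈ Finset.range (N+1), c n * Real.exp (-t * n) with hC
  have hsum : 0 ≤ ∑ n ∈ Finset.range (N+1), c n * Real.exp (-t * n) :=
    Finset.sum_nonneg fun n _ => mul_nonneg (hc n) (Real.exp_pos _).le
  refine ⟨C, by linarith, fun n => ?_⟩
  by_cases hn : n < N + 1
  · have h1 : c n * Real.exp (-t * n) ≤ C := by
      have := Finset.single_le_sum (f := fun n : ℕ => c n * Real.exp (-t * n))
        (fun n _ => mul_nonneg (hc n) (Real.exp_pos _).le) (Finset.mem_range.2 hn)
      linarith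
    calc c n = (c n * Real.exp (-t * n)) * Real.exp (t * n) := by
          rw [mul_assoc, ← Real.exp_add]; simp
      _ ≤ _ := mul_le_mul_of_nonneg_right h1 (Real.exp_pos _).le
  · push Not at hn
    have h1 : 1 ≤ C := by linarith
    rcases (hc n).eq_or_lt with h0 | hpos
    · rw [← h0]; positivity
    · have h2 := (hu n (by omega) hpos).trans (hN n (by omega)).le
      have hnp : (0:ℝ) < n := by exact_mod_cast (by omega : 0 < n)
      rw [div_le_iff₀ hnp, Real.log_le_iff_le_exp hpos] at h2
      calc c n ≤ 1 * Real.exp (t * n) := by rw [one_mul]; exact h2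
        _ ≤ _ := mul_le_mul_of_nonneg_right h1 (Real.exp_pos _).le

lemma limsup_nonneg {u : ℕ → ℝ} (K : ℝ) (huK : ∀ n, u n ≤ K) (h0 : ∀ n, 0 ≤ u n) : 0 ≤ limsup u atTop := by
  exact le_limsup_of_frequently_le (Frequently.of_forall h0) (isBoundedUnder_of ⟨K, huK⟩)

lemma limsup_le_of {u : ℕ → ℝ} {b : ℝ} (m : ℝ) (hm : ∀ n, m ≤ u n) (h : ∀ᶠ n in atTop, u n ≤ b) : limsup u atTop ≤ b := by
  apply limsup_le_of_le _ h
  exact IsBoundedUnder.isCoboundedUnder_le (isBoundedUnder_of ⟨m, hm⟩)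

variable [TopologicalSpace A]

/-- the language as a set of words -/
def LL (X : Set (ℤ → A)) : Set (List A) := {w | F X w ≠ ∅}

lemma card_Lang' {X : Set (ℤ → A)} (hX : IsSubshift X) (n : ℕ) : (Nat.card ↥(Lang X n) : ℝ) = nw (LL X) n := by
  rw [← card_eq_nw]
  congr 3
  ext w; exact lang_iff hX n w

lemma nw_LL_add {X : Set (ℤ → A)} (hX : IsSubshift X) (m n : ℕ) : nw (LL X) (m+n) ≤ nw (LL X) m * nw (LL X) n := by
  classical
  rw [nw, sum_words_add, nw, nw, Finset.sum_mul_sum]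
  refine Finset.sum_le_sum fun u _ => Finset.sum_le_sum fun v _ => ?_
  by_cases h : u ++ v ∈ LL X
  · have hu : u ∈ LL X := by
      intro h'; apply h; rw [F_append, h', run_empty]
    have hv : v ∈ LL X := by
      intro h'; apply h
      have := F_append_sub hX u v
      rw [h'] at this; exact subset_empty_iff.1 this
    simp [h, hu, hv]
  · simp only [h, if_false]
    split_ifs <;> norm_num

lemma hTop_eq {X : Set (ℤ → A)} (hX : IsSubshift X) : hTop X = limsup (fun n : ℕ => Real.log (nw (LL X) n) / n) atTop := by
  simp only [hTop, card_Lang' hX]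

lemma nonempty_of_hTop {X : Set (ℤ → A)} (hX : IsSubshift X) (h : 0 < hTop X) : X.Nonempty := by
  by_contra hne
  rw [Set.not_nonempty_iff_eq_empty] at hne
  have : ∀ n, nw (LL X) n = 0 := by
    intro n
    rw [nw]; apply Finset.sum_eq_zero; intro w _
    rw [if_neg]
    simp only [LL, mem_ofPred_eq, ne_eq, not_not]
    ext y
    rw [mem_F hX, hne]; simp
  rw [hTop_eq hX] at h
  simp [this] at h

lemma nw_LL_pos {X : Set (ℤ → A)} (hX : IsSubshift X) (h : X.Nonempty) (n : ℕ) : 1 ≤ nw (LL X) n := by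
  classical
  obtain ⟨x, hx⟩ := h
  have := Finset.single_le_sum (f := fun w => if w ∈ LL X then (1:ℝ) else 0) (s := words A n)
    (fun w _ => by split_ifs <;> norm_num) (a := win x 0 n) (by simp)
  have h2 : win x 0 n ∈ LL X := F_win_ne hX hx 0 n
  simp only [h2, if_true] at this
  rw [nw]; exact this

lemma subadd {X : Set (ℤ → A)} (hX : IsSubshift X) (h : X.Nonempty) : Subadditive (fun n => Real.log (nw (LL X) n)) := by
  intro m n
  have h1 := nw_LL_pos hX h
  rw [← Real.log_mul (by linarith [h1 m]) (by linarith [h1 n])]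
  exact Real.log_le_log (by linarith [h1 (m+n)]) (nw_LL_add hX m n)

lemma exp_le_nw {X : Set (ℤ → A)} (hX : IsSubshift X) (h : X.Nonempty) (n : ℕ) : Real.exp (hTop X * n) ≤ nw (LL X) n := by
  have h1 := nw_LL_pos hX h
  rcases Nat.eq_zero_or_pos n with rfl | hn
  · simpa using h1 0
  have hb : BddBelow (range fun n : ℕ => Real.log (nw (LL X) n) / n) := by
    refine ⟨0, ?_⟩
    rintro _ ⟨n, rfl⟩
    exact div_nonneg (Real.log_nonneg (h1 n)) (by positivity)
  have h2 := (subadd hX h).tendsto_lim hb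
  have h3 := (subadd hX h).lim_le_div hb hn.ne'
  rw [hTop_eq hX, h2.limsup_eq]
  rw [le_div_iff₀ (by exact_mod_cast hn)] at h3
  rw [← Real.le_log_iff_exp_le (by linarith [h1 n])]
  exact h3

lemma nw_le_exp {X : Set (ℤ → A)} (hX : IsSubshift X) {t : ℝ} (ht : hTop X < t) :
    ∃ C : ℝ, 0 < C ∧ ∀ n, nw (LL X) n ≤ C * Real.exp (t * n) := by
  refine exp_bound_of_limsup (fun n => nw_nonneg _ n) (Real.log (Fintype.card A))
    (fun n => log_nw_div_le _ n (nw_nonneg _ n) (nw_le _ n)) (fun n _ _ => le_rfl) ?_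
  rwa [hTop_eq hX] at ht

lemma LC_bound {X : Set (ℤ → A)} (hX : IsSubshift X) {t : ℝ} (ht : hC X < t) :
    ∃ C : ℝ, 0 < C ∧ ∀ n, nw {w | LC' X w} n ≤ C * Real.exp (t * n) := by
  have hcard : ∀ n, 2 ≤ n → nw {w | LC' X w} n = Nat.card ↥(LC X n) := by
    intro n hn
    rw [← card_eq_nw]
    congr 3
    ext w
    simp only [LC, mem_ofPred_eq]
    refine and_congr_right fun h => ?_
    rw [isLC_iff hX w (by omega)]
  have hle : ∀ n, (Nat.card ↥(LC X n) : ℝ) ≤ (Fintype.card A : ℝ) ^ n := by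
    intro n
    have := card_eq_nw {w : List A | IsLeftConstraint X w} n
    exact this.trans_le (nw_le _ n)
  obtain ⟨C, hC0, hC⟩ := exp_bound_of_limsup (c := fun n => (Nat.card ↥(LC X n) : ℝ)) (fun n => Nat.cast_nonneg _) (Real.log (Fintype.card A))
    (u := fun n : ℕ => max 0 (Real.log (Nat.card ↥(LC X n))) / (n : ℝ))
    (fun n => by
      rw [max_eq_right (Real.log_natCast_nonneg _)]
      exact log_nw_div_le _ n (Nat.cast_nonneg _) (hle n))
    (fun n _ _ => by gcongr; exact le_max_right _ _) ht
  set q := nw {w | LC' X w} with hq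
  have hq0 : ∀ n, 0 ≤ q n := fun n => nw_nonneg _ n
  refine ⟨C + q 0 + q 1 * Real.exp (-t), by have := hq0 0; have := mul_nonneg (hq0 1) (Real.exp_pos (-t)).le; linarith, fun n => ?_⟩
  have := hq0 0; have := mul_nonneg (hq0 1) (Real.exp_pos (-t)).le
  match n with
  | 0 => simp; linarith
  | 1 =>
    have e : q 1 = q 1 * Real.exp (-t) * Real.exp (t * (1:ℕ)) := by rw [mul_assoc, ← Real.exp_add]; simp
    calc q 1 = q 1 * Real.exp (-t) * Real.exp (t * (1:ℕ)) := e
      _ ≤ _ := mul_le_mul_of_nonneg_right (by linarith) (Real.exp_pos _).le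
  | n+2 =>
    rw [hcard _ (by omega)]
    exact (hC _).trans (mul_le_mul_of_nonneg_right (by linarith) (Real.exp_pos _).le)

lemma hC_nonneg (X : Set (ℤ → A)) : 0 ≤ hC X := by
  refine limsup_nonneg (Real.log (Fintype.card A)) (fun n => ?_) (fun n => div_nonneg (le_max_left _ _) (by positivity))
  rw [max_eq_right (Real.log_natCast_nonneg _)]
  refine log_nw_div_le _ n (Nat.cast_nonneg _) ?_
  have := card_eq_nw {w : List A | IsLeftConstraint X w} n
  exact this.trans_le (nw_le _ n)

lemma ELC_card_le (X : Set (ℤ → A)) (n : ℕ) : (Nat.card ↥(ELC X n) : ℝ) ≤ (Fintype.card A : ℝ) ^ n :=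
  (card_eq_nw {w : List A | IsExtendable X w} n).trans_le (nw_le _ n)

lemma hCstar_nonneg (X : Set (ℤ → A)) : 0 ≤ hCstar X :=
  limsup_nonneg (Real.log (Fintype.card A)) (fun n => log_nw_div_le _ n (Nat.cast_nonneg _) (ELC_card_le X n))
    (fun n => div_nonneg (Real.log_natCast_nonneg _) (by positivity))

lemma ELC_bound {X : Set (ℤ → A)} {t : ℝ} (ht : hCstar X < t) :
    ∃ C : ℝ, 0 < C ∧ ∀ n, nw {w | IsExtendable X w} n ≤ C * Real.exp (t * n) := by
  refine exp_bound_of_limsup (u := fun n : ℕ => Real.log (Nat.card ↥(ELC X n)) / (n : ℝ)) (fun n => nw_nonneg _ n) (Real.log (Fintype.card A))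
    (fun n => log_nw_div_le _ n (Nat.cast_nonneg _) (ELC_card_le X n)) (fun n _ _ => ?_) ht
  rw [← card_eq_nw]; rfl

end wfin
end QFTPaper

namespace QFTPaper

section loops
variable {A : Type} [Fintype A]

open Classical in
/-- number of words of length `n` leading from `v` to `u` -/
noncomputable def nl (v u : Set (ℕ → A)) (n : ℕ) : ℝ := ∑ w ∈ words A n, if run v w = u then 1 else 0

lemma nl_eq_nw (v u : Set (ℕ → A)) (n : ℕ) : nl v u n = nw {w | run v w = u} n := rfl

lemma nl_nonneg (v u : Set (ℕ → A)) (n : ℕ) : 0 ≤ nl v u n := nw_nonneg _ n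

lemma cnt_eq (n : ℕ) : ∀ v : Set (ℕ → A), v ≠ ∅ → cnt step {∅} n v = nw {w | run v w ≠ ∅} n := by
  classical
  induction n with
  | zero => intro v hv; simp [cnt, nw, words_zero, hv]
  | succ n ih =>
    intro v hv
    rw [cnt, nw, sum_words_succ]
    refine Finset.sum_congr rfl fun a _ => ?_
    by_cases h : step v a = ∅
    · simp [h, run_empty]
    · simp only [mem_singleton_iff, h, if_false, ih _ h, nw]; rfl

lemma pth_eq {u : Set (ℕ → A)} (hu : u ≠ ∅) (n : ℕ) : ∀ v : Set (ℕ → A), pth step {∅} u n v = nl v u n := by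
  classical
  induction n with
  | zero => intro v; rw [pth, nl, words_zero, Finset.sum_singleton, run_nil]; congr
  | succ n ih =>
    intro v
    rw [pth, nl, sum_words_succ]
    refine Finset.sum_congr rfl fun a _ => ?_
    by_cases h : step v a = ∅
    · simp [h, run_empty, hu.symm]
    · simp only [mem_singleton_iff, h, if_false, ih, nl]; rfl

lemma nl_mul_le (v s u : Set (ℕ → A)) (m n : ℕ) : nl v s m * nl s u n ≤ nl v u (m+n) := by
  classical
  rw [nl, nl, nl, sum_words_add, Finset.sum_mul_sum]
  refine Finset.sum_le_sum fun w _ => Finset.sum_le_sum fun g _ => ?_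
  by_cases h1 : run v w = s
  · by_cases h2 : run s g = u
    · simp [h1, h2, run_append]
    · simp only [h1, h2, if_true, if_false, mul_zero]; split_ifs <;> norm_num
  · simp only [h1, if_false, zero_mul]; split_ifs <;> norm_num

lemma nl_pow_le (s : Set (ℕ → A)) (n k : ℕ) : nl s s n ^ k ≤ nl s s (n*k) := by
  induction k with
  | zero => rw [mul_zero, pow_zero, nl, words_zero, Finset.sum_singleton, run_nil]; simp
  | succ k ih =>
    rw [pow_succ, mul_add, mul_one]
    exact (mul_le_mul_of_nonneg_right ih (nl_nonneg _ _ _)).trans (nl_mul_le _ _ _ _ _)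

variable [TopologicalSpace A]

lemma nl_le_nw {X : Set (ℤ → A)} (hX : IsSubshift X) (w0 : List A) {u : Set (ℕ → A)} (hu : u ≠ ∅) (n : ℕ) :
    nl (F X w0) u n ≤ nw (LL X) n := by
  rw [nl_eq_nw]
  refine nw_mono (fun w hw => ?_) n
  simp only [mem_ofPred_eq, LL] at hw ⊢
  rw [← F_append] at hw
  intro h
  have := F_append_sub hX w0 w
  rw [hw, h] at this
  exact hu (subset_empty_iff.1 this)

lemma nl_le_exp {X : Set (ℤ → A)} (hX : IsSubshift X) (w0 : List A) (hu : F X w0 ≠ ∅) (n : ℕ) :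
    nl (F X w0) (F X w0) n ≤ Real.exp (hTop X * n) := by
  have key : ∀ t, hTop X < t → nl (F X w0) (F X w0) n ≤ Real.exp (t * n) := by
    intro t ht
    obtain ⟨C, hC0, hC⟩ := nw_le_exp hX ht
    by_contra hcon
    push Not at hcon
    set p := nl (F X w0) (F X w0) n
    have h1 : ∀ k : ℕ, (p / Real.exp (t*n)) ^ k ≤ C := by
      intro k
      rw [div_pow, div_le_iff₀ (by positivity), ← Real.exp_nat_mul]
      refine (nl_pow_le _ n k).trans ((nl_le_nw hX w0 hu _).trans ((hC _).trans_eq ?_))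
      congr 2; push_cast; ring
    have h2 : 1 < p / Real.exp (t*n) := by rw [one_lt_div (Real.exp_pos _)]; exact hcon
    obtain ⟨k, hk⟩ := pow_unbounded_of_one_lt C h2
    exact absurd (h1 k) (not_le.2 hk)
  have hlim : Tendsto (fun t : ℝ => Real.exp (t * n)) (nhdsWithin (hTop X) (Ioi (hTop X))) (nhds (Real.exp (hTop X * n))) := by
    have : Continuous fun t : ℝ => Real.exp (t * n) := by fun_prop
    exact (this.tendsto _).mono_left nhdsWithin_le_nhds
  refine ge_of_tendsto hlim ?_
  filter_upwards [self_mem_nhdsWithin] with t ht using key t ht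

/-- periodicity -/
lemma shift_iter (n : ℕ) : ∀ (x : ℤ → A) (i : ℤ), shift^[n] x i = x (i + n) := by
  induction n with
  | zero => intro x i; simp
  | succ n ih =>
    intro x i
    rw [Function.iterate_succ_apply, ih]; simp only [shift]; congr 1; push_cast; ring

/-- periodic points -/
def Per (X : Set (ℤ → A)) (n : ℕ) : Set (ℤ → A) := {x | x ∈ X ∧ ∀ i : ℤ, x (i + n) = x i}

lemma perCount_eq (X : Set (ℤ → A)) (n : ℕ) : perCount X n = Nat.card ↥(Per X n) := by
  rw [perCount]
  congr 2
  ext x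
  simp only [Per, mem_ofPred_eq]
  refine and_congr_right fun _ => ?_
  constructor
  · intro h i; rw [← shift_iter n x i, h]
  · intro h; funext i; rw [shift_iter, h]

lemma per_mul {x : ℤ → A} {n : ℕ} (h : ∀ i : ℤ, x (i + n) = x i) (k : ℕ) (i : ℤ) : x (i + n * k) = x i := by
  induction k with
  | zero => simp
  | succ k ih => rw [← ih, ← h (i + n * k)]; congr 1; push_cast; ring

lemma per_mul' {x : ℤ → A} {n : ℕ} (h : ∀ i : ℤ, x (i + n) = x i) (k : ℤ) (i : ℤ) : x (i + n * k) = x i := by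
  rcases Int.eq_nat_or_neg k with ⟨m, rfl | rfl⟩
  · exact per_mul h m i
  · rw [← per_mul h m]; congr 1; ring

lemma per_mod {x : ℤ → A} {n : ℕ} (h : ∀ i : ℤ, x (i + n) = x i) (i : ℤ) : x i = x (i % n) := by
  conv_lhs => rw [← Int.emod_add_mul_ediv i n]
  rw [per_mul' h]

lemma per_inj {n : ℕ} (hn : 1 ≤ n) {x y : ℤ → A} (hx : ∀ i : ℤ, x (i + n) = x i) (hy : ∀ i : ℤ, y (i + n) = y i)
    (k : ℤ) (h : win x k n = win y k n) : x = y := by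
  rw [win_eq_iff] at h
  funext i
  have hn' : (0:ℤ) < n := by exact_mod_cast hn
  have h1 := Int.emod_nonneg (i - k) hn'.ne'
  have h2 := Int.emod_lt_of_pos (i - k) hn'
  have h3 := h ((i-k) % n).toNat (by omega)
  rw [Int.toNat_of_nonneg h1] at h3
  have e : i = (k + (i-k) % n) + n * ((i-k)/n) := by
    have := Int.emod_add_mul_ediv (i-k) n
    linarith
  rw [e, per_mul' hx, per_mul' hy]; exact h3

lemma perCount_nw (X : Set (ℤ → A)) {n : ℕ} (hn : 1 ≤ n) (k : ℤ) :
    (perCount X n : ℝ) = nw {w | ∃ x ∈ Per X n, w = win x k n} n := by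
  rw [perCount_eq, ← card_eq_nw]
  congr 1
  rw [Nat.card_coe_set_eq, Nat.card_coe_set_eq]
  have : {w | w.length = n ∧ w ∈ {w | ∃ x ∈ Per X n, w = win x k n}} = (fun x => win x k n) '' Per X n := by
    ext w
    simp only [mem_ofPred_eq, mem_image]
    constructor
    · rintro ⟨_, x, hx, rfl⟩; exact ⟨x, hx, rfl⟩
    · rintro ⟨x, hx, rfl⟩; exact ⟨by simp, x, hx, rfl⟩
  rw [this, Set.ncard_image_of_injOn]
  intro x hx y hy h
  exact per_inj hn hx.2 hy.2 k h

lemma perCount_le_LL {X : Set (ℤ → A)} (hX : IsSubshift X) {n : ℕ} (hn : 1 ≤ n) : (perCount X n : ℝ) ≤ nw (LL X) n := by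
  rw [perCount_nw X hn 0]
  refine nw_mono ?_ n
  rintro w ⟨x, hx, rfl⟩
  exact F_win_ne hX hx.1 _ _

lemma mem_of_F' {X : Set (ℤ → A)} [DiscreteTopology A] (hX : IsSubshift X) (x : ℤ → A)
    (h : ∀ n : ℕ, ∃ a b : ℕ, n ≤ a ∧ n < b ∧ F X (win x (-a) (a+b)) ≠ ∅) : x ∈ X := by
  refine mem_of_windows hX x fun n => ?_
  obtain ⟨a, b, ha, hb, h⟩ := h n
  obtain ⟨y, hy⟩ := Set.nonempty_iff_ne_empty.2 h
  obtain ⟨B, hB, k, h1, -⟩ := (mem_F hX).1 hy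
  refine ⟨sh (k+a) B, (sh_mem_iff hX _ B).2 hB, fun i hi => ?_⟩
  rw [win_length, win_eq_iff] at h1
  have h2 := h1 (i+a).toNat (by rw [abs_le] at hi; omega)
  rw [abs_le] at hi
  rw [Int.toNat_of_nonneg (by omega)] at h2
  simp only [sh]
  rw [show i + (k+a) = k + (i+a) by ring, h2]; congr 1; ring

lemma exists_per (g : List A) (hg : g ≠ []) : ∃ x : ℤ → A, (∀ i : ℤ, x (i + g.length) = x i) ∧
    ∀ j : ℤ, win x (g.length * j) g.length = g := by
  have hn : 0 < g.length := List.length_pos_iff.2 hg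
  have hn' : (0:ℤ) < g.length := by exact_mod_cast hn
  refine ⟨fun i => g[(i % g.length).toNat]'(by
    have h1 := Int.emod_nonneg i hn'.ne'
    have h2 := Int.emod_lt_of_pos i hn'
    omega), fun i => by simp, fun j => ?_⟩
  apply List.ext_getElem (by simp)
  intro i h1 h2
  rw [win_getElem]
  congr 1
  rw [add_comm, Int.add_mul_emod_self_left, Int.emod_eq_of_lt (by omega) (by omega)]
  simp

lemma nl_le_perCount {X : Set (ℤ → A)} [DiscreteTopology A] (hX : IsSubshift X) (w0 : List A) (hu : F X w0 ≠ ∅) {n : ℕ} (hn : 1 ≤ n) :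
    nl (F X w0) (F X w0) n ≤ perCount X n := by
  rw [perCount_nw X hn 0, nl_eq_nw]
  refine nw_mono' n fun g hg hgn => ?_
  simp only [mem_ofPred_eq] at hg ⊢
  have hg0 : g ≠ [] := by rintro rfl; simp at hgn; omega
  obtain ⟨x, hx, hw⟩ := exists_per g hg0
  rw [hgn] at hx hw
  refine ⟨x, ⟨?_, hx⟩, ?_⟩
  · apply mem_of_F' hX
    have hr : ∀ (k : ℕ) (j : ℤ), run (F X w0) (win x (n * j) (n * k)) = F X w0 := by
      intro k
      induction k with
      | zero => intro j; simp
      | succ k ih =>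
        intro j
        rw [Nat.mul_succ, win_add, run_append, ih]
        have : (n:ℤ) * j + ((n * k : ℕ) : ℤ) = n * (j + k) := by push_cast; ring
        rw [this, hw, hg]
    intro m
    refine ⟨n * (m+1), n * (m+1), by nlinarith, by nlinarith, ?_⟩
    have h1 := hr (2 * (m+1)) (-(m+1))
    have e : (n:ℤ) * (-(m+1)) = -((n * (m+1) : ℕ) : ℤ) := by push_cast; ring
    rw [e, show n * (2 * (m+1)) = n * (m+1) + n*(m+1) by ring, ← F_append] at h1
    intro h
    have := F_append_sub hX w0 (win x (-((n * (m+1) : ℕ) : ℤ)) (n * (m+1) + n * (m+1)))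
    rw [h1, h] at this
    exact hu (subset_empty_iff.1 this)
  · have := hw 0
    simpa using this.symm

end loops
end QFTPaper

namespace QFTPaper

section kraft
variable {A : Type} [Fintype A]

open Classical in
/-- parsing weight with fuel -/
noncomputable def Qf (β : List A → ℝ) : ℕ → List A → ℝ
  | 0, w => if w = [] then 1 else 0
  | k+1, w => (if w = [] then 1 else 0) +
      ∑ l ∈ Finset.range w.length, β (w.take (l+1)) * Qf β k (w.drop (l+1))

lemma Qf_nonneg {β : List A → ℝ} (hβ : ∀ w, 0 ≤ β w) (k : ℕ) : ∀ w, 0 ≤ Qf β k w := by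
  induction k with
  | zero => intro w; rw [Qf]; split_ifs <;> norm_num
  | succ k ih =>
    intro w
    rw [Qf]
    refine add_nonneg (by split_ifs <;> norm_num) (Finset.sum_nonneg fun l _ => mul_nonneg (hβ _) (ih _))

lemma Qf_sum {β : List A → ℝ} (hβ : ∀ w, 0 ≤ β w)
    (hs : ∀ L, ∑ l ∈ Finset.range L, ∑ v ∈ words A l, β v ≤ 1) (k : ℕ) :
    ∀ n, ∑ w ∈ words A n, Qf β k w ≤ 1 := by
  induction k with
  | zero =>
    intro n
    cases n with
    | zero => rw [words_zero, Finset.sum_singleton]; simp [Qf]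
    | succ n =>
      rw [Finset.sum_eq_zero]
      · norm_num
      · intro w hw
        rw [Qf, if_neg]
        rintro rfl; simp at hw
  | succ k ih =>
    intro n
    cases n with
    | zero => rw [words_zero, Finset.sum_singleton]; simp [Qf]
    | succ n =>
      have h1 : ∑ w ∈ words A (n+1), Qf β (k+1) w =
          ∑ l ∈ Finset.range (n+1), ∑ u ∈ words A (l+1), ∑ v ∈ words A (n - l), β u * Qf β k v := by
        have : ∀ w ∈ words A (n+1), Qf β (k+1) w =
            ∑ l ∈ Finset.range (n+1), β (w.take (l+1)) * Qf β k (w.drop (l+1)) := by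
          intro w hw
          rw [mem_words] at hw
          rw [Qf, if_neg (by rintro rfl; simp at hw), zero_add, hw]
        rw [Finset.sum_congr rfl this, Finset.sum_comm]
        refine Finset.sum_congr rfl fun l hl => ?_
        rw [Finset.mem_range] at hl
        have e : n + 1 = (l + 1) + (n - l) := by omega
        rw [e, sum_words_add]
        refine Finset.sum_congr rfl fun u hu => Finset.sum_congr rfl fun v hv => ?_
        rw [mem_words] at hu
        rw [List.take_left' hu, List.drop_left' hu]
      rw [h1]
      calc _ ≤ ∑ l ∈ Finset.range (n+1), ∑ u ∈ words A (l+1), β u := by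
            refine Finset.sum_le_sum fun l _ => Finset.sum_le_sum fun u _ => ?_
            rw [← Finset.mul_sum]
            exact mul_le_of_le_one_right (hβ u) (ih _)
        _ ≤ ∑ l ∈ Finset.range (n+2), ∑ u ∈ words A l, β u := by
            rw [Finset.sum_range_succ' _ (n+1)]
            exact le_add_of_nonneg_right (Finset.sum_nonneg fun u _ => hβ u)
        _ ≤ 1 := hs _

lemma Qf_flatten {β : List A → ℝ} (hβ : ∀ w, 0 ≤ β w) (h0 : β [] = 0) (L : List (List A)) :
    ∀ k, L.length ≤ k → (L.map β).prod ≤ Qf β k L.flatten := by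
  induction L with
  | nil => intro k _; cases k <;> simp [Qf]
  | cons v L ih =>
    intro k hk
    cases k with
    | zero => simp at hk
    | succ k =>
      rw [List.map_cons, List.prod_cons, List.flatten_cons]
      rcases eq_or_ne v [] with rfl | hv
      · rw [h0, zero_mul]; exact Qf_nonneg hβ _ _
      · have hvp : 0 < v.length := List.length_pos_iff.2 hv
        rw [Qf, if_neg (by simp [hv]), zero_add]
        have h1 := Finset.single_le_sum (f := fun l => β ((v ++ L.flatten).take (l+1)) * Qf β k ((v ++ L.flatten).drop (l+1)))
          (s := Finset.range (v ++ L.flatten).length) (fun l _ => mul_nonneg (hβ _) (Qf_nonneg hβ _ _))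
          (a := v.length - 1) (by simp; omega)
        refine le_trans ?_ h1
        have hl : v.length = v.length - 1 + 1 := by omega
        rw [List.take_left' hl, List.drop_left' hl]
        exact mul_le_mul_of_nonneg_left (ih k (by simpa using hk)) (hβ v)

lemma kraft {β : List A → ℝ} (hβ : ∀ w, 0 ≤ β w) (h0 : β [] = 0)
    (hs : ∀ L, ∑ l ∈ Finset.range L, ∑ v ∈ words A l, β v ≤ 1) :
    ∃ Q : List A → ℝ, (∀ w, 0 ≤ Q w) ∧ (∀ n, ∑ w ∈ words A n, Q w ≤ 1) ∧
      ∀ L : List (List A), (L.map β).prod ≤ Q L.flatten := by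
  refine ⟨fun w => Qf β w.length w, fun w => Qf_nonneg hβ _ _, fun n => ?_, fun L => ?_⟩
  · refine le_trans (le_of_eq (Finset.sum_congr rfl fun w hw => ?_)) (Qf_sum hβ hs n n)
    rw [mem_words] at hw
    simp only [hw]
  · by_cases h : [] ∈ L
    · have : (L.map β).prod = 0 := by
        rw [List.prod_eq_zero_iff]
        exact List.mem_map.2 ⟨[], h, h0⟩
      rw [this]; exact Qf_nonneg hβ _ _
    · apply Qf_flatten hβ h0
      clear hs
      induction L with
      | nil => simp
      | cons v L ih =>
        simp only [List.mem_cons, not_or] at h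
        have := ih h.2
        have h2 : 0 < v.length := List.length_pos_iff.2 (fun e => h.1 e.symm)
        simp only [List.length_cons, List.flatten_cons, List.length_append]
        omega

/-- concatenations of blocks -/
def Par (𝓑 : Set (List A)) (w : List A) : Prop := ∃ L : List (List A), (∀ b ∈ L, b ∈ 𝓑) ∧ L.flatten = w

lemma Par_nil (𝓑 : Set (List A)) : Par 𝓑 [] := ⟨[], by simp, rfl⟩

lemma Par_append {𝓑 : Set (List A)} {w b : List A} (h : Par 𝓑 w) (hb : b ∈ 𝓑) : Par 𝓑 (w ++ b) := by
  obtain ⟨L, h1, rfl⟩ := h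
  refine ⟨L ++ [b], ?_, by simp⟩
  intro c hc
  rcases List.mem_append.1 hc with h | h
  · exact h1 c h
  · simp at h; rwa [h]

lemma Par_cons {𝓑 : Set (List A)} {w b : List A} (h : Par 𝓑 w) (hb : b ∈ 𝓑) : Par 𝓑 (b ++ w) := by
  obtain ⟨L, h1, rfl⟩ := h
  refine ⟨b :: L, ?_, by simp⟩
  intro c hc
  rcases List.mem_cons.1 hc with h | h
  · rwa [h]
  · exact h1 c h

lemma sum_indic (𝓑 : Set (List A)) (t : ℝ) (l : ℕ) [DecidablePred (· ∈ 𝓑)] :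
    ∑ v ∈ words A l, (if v ∈ 𝓑 then Real.exp (-t * v.length) else 0) = nw 𝓑 l * Real.exp (-t * l) := by
  rw [nw, Finset.sum_mul]
  refine Finset.sum_congr rfl fun v hv => ?_
  rw [mem_words] at hv
  by_cases h : v ∈ 𝓑 <;> simp [h, hv]

lemma prod_exp (t : ℝ) (L : List (List A)) : (L.map (fun v => Real.exp (-t * v.length))).prod = Real.exp (-t * L.flatten.length) := by
  induction L with
  | nil => simp
  | cons v L ih =>
    rw [List.map_cons, List.prod_cons, ih, ← Real.exp_add, List.flatten_cons, List.length_append]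
    congr 1; push_cast; ring

lemma Par_count {𝓑 : Set (List A)} {t : ℝ} (h0 : [] ∉ 𝓑)
    (hs : ∀ L, ∑ l ∈ Finset.range L, nw 𝓑 l * Real.exp (-t * l) ≤ 1) (n : ℕ) :
    nw {w | Par 𝓑 w} n ≤ Real.exp (t * n) := by
  classical
  obtain ⟨Q, hQ0, hQ1, hQ⟩ := kraft (β := fun v => if v ∈ 𝓑 then Real.exp (-t * v.length) else 0)
    (fun w => by split_ifs; exacts [(Real.exp_pos _).le, le_rfl]) (by simp [h0])
    (fun L => by simp only [sum_indic]; exact hs L)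
  have h1 : nw {w | Par 𝓑 w} n ≤ ∑ w ∈ words A n, Real.exp (t * n) * Q w := by
    refine Finset.sum_le_sum fun w hw => ?_
    rw [mem_words] at hw
    split_ifs with h
    · obtain ⟨L, hL, rfl⟩ := h
      have h2 := hQ L
      have h3 : L.map (fun v => if v ∈ 𝓑 then Real.exp (-t * v.length) else 0) = L.map (fun v => Real.exp (-t * v.length)) := by
        apply List.map_congr_left
        intro b hb; simp [hL b hb]
      rw [h3, prod_exp, hw] at h2
      calc (1:ℝ) = Real.exp (t * n) * Real.exp (-t * n) := by rw [← Real.exp_add]; simp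
        _ ≤ _ := mul_le_mul_of_nonneg_left h2 (Real.exp_pos _).le
    · exact mul_nonneg (Real.exp_pos _).le (hQ0 _)
  rw [← Finset.mul_sum] at h1
  exact h1.trans (mul_le_of_le_one_right (Real.exp_pos _).le (hQ1 n))

lemma weight_tail {L : Set (List A)} {C t s : ℝ} (hL : ∀ n, nw L n ≤ C * Real.exp (t * n)) (hts : t < s)
    {ε : ℝ} (hε : 0 < ε) : ∃ N : ℕ, ∀ M, N ≤ M → ∀ K, ∑ l ∈ Finset.range K, nw {w | w ∈ L ∧ M < w.length} l * Real.exp (-s * l) ≤ ε := by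
  have hC : 0 ≤ C := by
    have := (nw_nonneg L 0).trans (hL 0)
    simpa using this
  set r := Real.exp (t - s) with hr
  have hr0 : 0 ≤ r := (Real.exp_pos _).le
  have hr1 : r < 1 := by rw [hr, Real.exp_lt_one_iff]; linarith
  have hsum : Summable fun l : ℕ => C * r ^ l := (summable_geometric_of_lt_one hr0 hr1).mul_left C
  have htail := tendsto_sum_nat_add (fun l : ℕ => C * r ^ l)
  obtain ⟨N, hN⟩ := eventually_atTop.1 (htail.eventually (gt_mem_nhds hε))
  refine ⟨N, fun M hM K => ?_⟩
  refine le_trans ?_ (hN M hM).le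
  have hg : ∀ l, nw {w | w ∈ L ∧ M < w.length} l * Real.exp (-s * l) ≤ if M < l then C * r ^ l else 0 := by
    intro l
    split_ifs with h
    · have : nw {w | w ∈ L ∧ M < w.length} l ≤ nw L l := nw_mono (fun w hw => hw.1) l
      calc _ ≤ C * Real.exp (t * l) * Real.exp (-s * l) := mul_le_mul_of_nonneg_right (this.trans (hL l)) (Real.exp_pos _).le
        _ = C * r ^ l := by rw [mul_assoc, ← Real.exp_add, hr, ← Real.exp_nat_mul]; congr 2; ring
    · have : nw {w | w ∈ L ∧ M < w.length} l ≤ nw (∅ : Set (List A)) l := by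
        refine nw_mono' l ?_
        rintro w ⟨_, h1⟩ h2
        omega
      have h0 : nw (∅ : Set (List A)) l = 0 := by simp [nw]
      rw [h0] at this
      exact mul_nonpos_of_nonpos_of_nonneg this (Real.exp_pos _).le
  refine (Finset.sum_le_sum fun l _ => hg l).trans ?_
  rw [← Finset.sum_filter]
  have hsum' : Summable fun k : ℕ => C * r ^ (k + M) := (summable_nat_add_iff M).2 hsum
  calc _ ≤ ∑ k ∈ Finset.range K, C * r ^ (k + M) := by
        rw [← Finset.sum_image (s := Finset.range K) (g := fun k => k + M) (f := fun l => C * r ^ l) (fun a _ b _ h => by simpa using h)]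
        refine Finset.sum_le_sum_of_subset_of_nonneg ?_ (fun _ _ _ => by positivity)
        intro l hl
        simp only [Finset.mem_filter, Finset.mem_range, Finset.mem_image] at hl ⊢
        exact ⟨l - M, by omega, by omega⟩
    _ ≤ _ := hsum'.sum_le_tsum _ fun _ _ => by positivity

lemma nw_concat (P R : Set (List A)) (n : ℕ) :
    nw {g | ∃ p q, g = p ++ q ∧ p ∈ P ∧ q ∈ R} n ≤ ∑ j ∈ Finset.range (n+1), nw P j * nw R (n-j) := by
  classical
  have h1 : ∑ j ∈ Finset.range (n+1), nw P j * nw R (n-j) =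
      ∑ g ∈ words A n, ∑ j ∈ Finset.range (n+1), (if g.take j ∈ P then 1 else 0) * (if g.drop j ∈ R then (1:ℝ) else 0) := by
    rw [Finset.sum_comm]
    refine Finset.sum_congr rfl fun j hj => ?_
    rw [Finset.mem_range] at hj
    conv_rhs => rw [show n = j + (n - j) by omega]
    rw [sum_words_add, nw, nw, Finset.sum_mul_sum]
    refine Finset.sum_congr rfl fun u hu => Finset.sum_congr rfl fun v hv => ?_
    rw [mem_words] at hu
    rw [List.take_left' hu, List.drop_left' hu]
  rw [h1]
  refine Finset.sum_le_sum fun g hg => ?_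
  rw [mem_words] at hg
  have hnn : ∀ j, (0:ℝ) ≤ (if g.take j ∈ P then 1 else 0) * (if g.drop j ∈ R then (1:ℝ) else 0) := by
    intro j; split_ifs <;> norm_num
  by_cases h : g ∈ {g | ∃ p q, g = p ++ q ∧ p ∈ P ∧ q ∈ R}
  · simp only [h, if_true]
    obtain ⟨p, q, rfl, hp, hq⟩ := h
    have := Finset.single_le_sum (fun j _ => hnn j) (s := Finset.range (n+1)) (a := p.length)
      (by rw [Finset.mem_range, ← hg, List.length_append]; omega)
    refine le_trans ?_ this
    rw [List.take_left' rfl, List.drop_left' rfl]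
    simp [hp, hq]
  · simp only [h, if_false]
    exact Finset.sum_nonneg fun j _ => hnn j

lemma nw_or_le (P R : Set (List A)) (n : ℕ) : nw {g | g ∈ P ∨ g ∈ R} n ≤ nw P n + nw R n := by
  classical
  rw [nw, nw, nw, ← Finset.sum_add_distrib]
  refine Finset.sum_le_sum fun w _ => ?_
  by_cases h1 : w ∈ P <;> by_cases h2 : w ∈ R <;> simp [h1, h2]

lemma nw_iUnion_le {ι : Type*} (s : Finset ι) (P : ι → Set (List A)) (n : ℕ) : nw {g | ∃ i ∈ s, g ∈ P i} n ≤ ∑ i ∈ s, nw (P i) n := by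
  classical
  simp only [nw]
  rw [Finset.sum_comm]
  refine Finset.sum_le_sum fun w _ => ?_
  by_cases h : w ∈ {g | ∃ i ∈ s, g ∈ P i}
  · simp only [h, if_true]
    obtain ⟨i, hi, hw⟩ := h
    have := Finset.single_le_sum (f := fun i => if w ∈ P i then (1:ℝ) else 0) (fun i _ => by split_ifs <;> norm_num) hi
    simpa [hw] using this
  · simp only [h, if_false]
    exact Finset.sum_nonneg fun i _ => by split_ifs <;> norm_num

lemma nw_prefix_le (P : Set (List A)) (u : List A) (j : ℕ) : nw {p | u ++ p ∈ P} j ≤ nw P (u.length + j) := by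
  classical
  rw [nw, nw, sum_words_add]
  exact Finset.single_le_sum (f := fun u => ∑ v ∈ words A j, if u ++ v ∈ P then (1:ℝ) else 0)
    (fun u _ => Finset.sum_nonneg fun v _ => by split_ifs <;> norm_num) (by simp)

end kraft
end QFTPaper

namespace QFTPaper

section part1
variable {A : Type} [Fintype A] [TopologicalSpace A]

lemma exists_LC_suffix {X : Set (ℤ → A)} (hX : IsSubshift X) (v z2 : List A) (hne : F X (v ++ z2) ≠ ∅) (h : F X (v ++ z2) ≠ F X z2) :
    ∃ v1 v2, v = v1 ++ v2 ∧ v2 ≠ [] ∧ LC' X (v2 ++ z2) := by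
  induction v with
  | nil => simp at h
  | cons a v ih =>
    by_cases h1 : F X (a :: v ++ z2) = F X (v ++ z2)
    · rw [h1] at hne h
      obtain ⟨v1, v2, rfl, g⟩ := ih hne h
      exact ⟨a :: v1, v2, rfl, g⟩
    · exact ⟨[], a :: v, rfl, by simp, by simp, hne, h1⟩

/-- long left constraints -/
def Blk (X : Set (ℤ → A)) (N : ℕ) : Set (List A) := {w | LC' X w ∧ N < w.length}

/-- states of short words -/
def TT (X : Set (ℤ → A)) (N : ℕ) : Set (Set (ℕ → A)) := {u | u ≠ ∅ ∧ ∃ w : List A, w.length ≤ N ∧ F X w = u}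

lemma TT_finite (X : Set (ℤ → A)) (N : ℕ) : (TT X N).Finite := by
  have : TT X N ⊆ ⋃ n ∈ Finset.range (N+1), (F X) '' (words A n) := by
    rintro u ⟨_, w, hw, rfl⟩
    simp only [mem_iUnion]
    exact ⟨w.length, by simp; omega, w, by simp, rfl⟩
  refine Set.Finite.subset ?_ this
  exact Set.Finite.biUnion (Finset.finite_toSet _) fun n _ => (Finset.finite_toSet _).image _

lemma suffix_blk {X : Set (ℤ → A)} (hX : IsSubshift X) {N : ℕ} (z : List A) (hne : F X z ≠ ∅) (hT : F X z ∉ TT X N) :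
    ∃ z1 b, z = z1 ++ b ∧ b ∈ Blk X N := by
  have hlen : N < z.length := by
    by_contra h
    exact hT ⟨hne, z, by omega, rfl⟩
  set v := z.take (z.length - N) with hv
  set z2 := z.drop (z.length - N) with hz2
  have hz : v ++ z2 = z := List.take_append_drop _ _
  have hl : z2.length = N := by rw [hz2, List.length_drop]; omega
  have h2 : F X z2 ≠ ∅ := by
    intro h
    have := F_append_sub hX v z2
    rw [hz, h] at this
    exact hne (subset_empty_iff.1 this)
  obtain ⟨v1, v2, h3, h4, h5⟩ := exists_LC_suffix hX v z2 (by rwa [hz]) (by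
    rw [hz]; intro h; exact hT ⟨hne, z2, hl.le, h.symm⟩)
  refine ⟨v1, v2 ++ z2, by rw [← hz, h3, List.append_assoc], h5, ?_⟩
  have := List.length_pos_iff.2 h4
  rw [List.length_append]; omega

/-- all the states after the start avoid `D` -/
def Av (D : Set (Set (ℕ → A))) (v : Set (ℕ → A)) (g : List A) : Prop :=
  ∀ p s, g = p ++ s → p ≠ [] → run v p ∉ D

lemma Av_nil (D : Set (Set (ℕ → A))) (v : Set (ℕ → A)) : Av D v [] := by
  intro p s h hp
  have := List.append_eq_nil_iff.1 h.symm
  exact absurd this.1 hp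

lemma Av_cons (D : Set (Set (ℕ → A))) (v : Set (ℕ → A)) (a : A) (g : List A) :
    Av D v (a :: g) ↔ step v a ∉ D ∧ Av D (step v a) g := by
  constructor
  · intro h
    refine ⟨h [a] g rfl (by simp), fun p s hp hp0 => h (a :: p) s (by rw [hp]; rfl) (by simp)⟩
  · rintro ⟨h1, h2⟩ p s hp hp0
    cases p with
    | nil => exact absurd rfl hp0
    | cons b p =>
      rw [List.cons_append, List.cons.injEq] at hp
      obtain ⟨rfl, hp⟩ := hp
      rw [run_cons]
      rcases eq_or_ne p [] with rfl | h
      · exact h1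
      · exact h2 p s hp h

lemma Av_prefix {D : Set (Set (ℕ → A))} {v : Set (ℕ → A)} {g g' : List A} (h : Av D v (g ++ g')) : Av D v g := by
  intro p s hp hp0
  exact h p (s ++ g') (by rw [hp, List.append_assoc]) hp0

lemma cnt_eq_av (D : Set (Set (ℕ → A))) (n : ℕ) : ∀ v, cnt step D n v = nw {g | Av D v g} n := by
  classical
  induction n with
  | zero => intro v; rw [cnt, nw, words_zero, Finset.sum_singleton, if_pos (show [] ∈ {g | Av D v g} from Av_nil D v)]
  | succ n ih =>
    intro v
    rw [cnt, nw, sum_words_succ]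
    refine Finset.sum_congr rfl fun a _ => ?_
    by_cases h : step v a ∈ D
    · simp [h, Av_cons]
    · simp only [h, if_false, ih, nw, mem_ofPred_eq, Av_cons, not_false_eq_true, true_and]

lemma av_decomp {X : Set (ℤ → A)} (hX : IsSubshift X) {N : ℕ} (w : List A) (n : ℕ) : ∀ g : List A, g.length = n →
    Av ({∅} ∪ TT X N) (F X w) g →
    ∃ p q, g = p ++ q ∧ (p = [] ∨ ∃ w1 w', w = w1 ++ w' ∧ LC' X (w' ++ p)) ∧ Par (Blk X N) q := by
  induction n using Nat.strong_induction_on with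
  | _ n ih =>
    intro g hg hav
    rcases eq_or_ne g [] with rfl | hg0
    · exact ⟨[], [], rfl, Or.inl rfl, Par_nil _⟩
    have h1 := hav g [] (by simp) hg0
    rw [← F_append] at h1
    simp only [mem_union, mem_singleton_iff, not_or] at h1
    obtain ⟨z1, b, hz, hb⟩ := suffix_blk hX (w ++ g) h1.1 h1.2
    rw [List.append_eq_append_iff] at hz
    rcases hz with ⟨as, h2, h3⟩ | ⟨bs, h2, h3⟩
    · -- g = as ++ b
      subst h3
      have hbp : 0 < b.length := by have := hb.2; omega
      obtain ⟨p, q, h4, h5, h6⟩ := ih as.length (by rw [← hg, List.length_append]; omega) as rfl (Av_prefix hav)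
      refine ⟨p, q ++ b, by rw [h4, List.append_assoc], h5, Par_append h6 hb⟩
    · refine ⟨g, [], by simp, Or.inr ⟨z1, bs, h2, ?_⟩, Par_nil _⟩
      rw [← h3]; exact hb.1

lemma succ_le_exp {δ : ℝ} (hδ : 0 < δ) (n : ℕ) : ((n:ℝ) + 1) ≤ (1 + 1/δ) * Real.exp (δ * n) := by
  have h1 := Real.add_one_le_exp (δ * n)
  have h2 : (1:ℝ) ≤ Real.exp (δ * n) := Real.one_le_exp (by positivity)
  have h3 : (n:ℝ) ≤ 1/δ * Real.exp (δ * n) := by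
    rw [div_mul_eq_mul_div, one_mul, le_div_iff₀ hδ]; linarith
  linarith

lemma nw_nil_le {s : ℝ} (hs : 0 ≤ s) (j : ℕ) : nw ({[]} : Set (List A)) j ≤ Real.exp (s * j) := by
  cases j with
  | zero => rw [nw, words_zero, Finset.sum_singleton]; simp
  | succ j =>
    rw [nw, Finset.sum_eq_zero]
    · exact (Real.exp_pos _).le
    · intro w hw
      rw [if_neg]
      rintro rfl
      simp at hw

lemma cnt_av_le {X : Set (ℤ → A)} (hX : IsSubshift X) {N : ℕ} {C s : ℝ} (hs : 0 ≤ s) (hC : 0 < C)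
    (hLC : ∀ n, nw {w | LC' X w} n ≤ C * Real.exp (s * n))
    (hB : ∀ K, ∑ l ∈ Finset.range K, nw (Blk X N) l * Real.exp (-s * l) ≤ 1) (w : List A) :
    ∃ K : ℝ, 0 < K ∧ ∀ n, cnt step ({∅} ∪ TT X N) n (F X w) ≤ K * ((n+1) * Real.exp (s * n)) := by
  set K := 1 + (w.length + 1) * (C * Real.exp (s * w.length)) with hK
  refine ⟨K, by positivity, fun n => ?_⟩
  rw [cnt_eq_av]
  set P : Set (List A) := {p | p ∈ ({[]} : Set (List A)) ∨ p ∈ {p | ∃ i ∈ Finset.range (w.length + 1), p ∈ {p | w.drop i ++ p ∈ {w | LC' X w}}}} with hP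
  have hPj : ∀ j, nw P j ≤ K * Real.exp (s * j) := by
    intro j
    refine (nw_or_le _ _ j).trans ?_
    rw [hK, add_mul, one_mul]
    refine add_le_add (nw_nil_le hs j) ?_
    refine (nw_iUnion_le _ _ j).trans ?_
    calc _ ≤ ∑ i ∈ Finset.range (w.length + 1), (C * Real.exp (s * w.length)) * Real.exp (s * j) := by
          refine Finset.sum_le_sum fun i _ => (nw_prefix_le _ _ j).trans ((hLC _).trans ?_)
          rw [mul_assoc, ← Real.exp_add, ← mul_add]
          gcongr
          push_cast
          gcongr
          rw [List.length_drop]; omega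
      _ = _ := by rw [Finset.sum_const, Finset.card_range, nsmul_eq_mul]; push_cast; ring
  have hsub : {g | Av ({∅} ∪ TT X N) (F X w) g} ⊆ {g | ∃ p q, g = p ++ q ∧ p ∈ P ∧ q ∈ {q | Par (Blk X N) q}} := by
    intro g hg
    obtain ⟨p, q, h1, h2, h3⟩ := av_decomp hX w g.length g rfl hg
    refine ⟨p, q, h1, ?_, h3⟩
    rcases h2 with h2 | ⟨w1, w', rfl, h2⟩
    · exact Or.inl h2
    · refine Or.inr ⟨w1.length, by simp, ?_⟩
      simpa using h2
  refine (nw_mono hsub n).trans ((nw_concat _ _ n).trans ?_)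
  calc _ ≤ ∑ j ∈ Finset.range (n+1), K * Real.exp (s * n) := by
        refine Finset.sum_le_sum fun j hj => ?_
        have hj' : j ≤ n := by simp at hj; omega
        have h0 : [] ∉ Blk X N := by rintro ⟨h, _⟩; exact h.1 rfl
        have h1 := mul_le_mul (hPj j) (Par_count h0 hB (n-j)) (nw_nonneg _ _) (by positivity)
        refine h1.trans_eq ?_
        rw [mul_assoc, ← Real.exp_add, ← mul_add]
        congr 3
        rw [Nat.cast_sub hj']; ring
    _ = _ := by rw [Finset.sum_const, Finset.card_range, nsmul_eq_mul]; push_cast; ring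

lemma slow_TT {X : Set (ℤ → A)} (hX : IsSubshift X) {N : ℕ} {C s : ℝ} (hs : 0 ≤ s) (hC : 0 < C)
    (hLC : ∀ n, nw {w | LC' X w} n ≤ C * Real.exp (s * n))
    (hB : ∀ K, ∑ l ∈ Finset.range K, nw (Blk X N) l * Real.exp (-s * l) ≤ 1) {h : ℝ} (hsh : s < h) :
    Slow step (fun v => ∃ w, v = F X w) (Real.exp h) ({∅} ∪ TT X N) := by
  set δ := (h - s) / 2 with hδ
  have hδ0 : 0 < δ := by rw [hδ]; linarith
  refine ⟨Real.exp (s + δ), Real.exp_pos _, Real.exp_lt_exp.2 (by rw [hδ]; linarith), ?_⟩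
  rintro _ ⟨w, rfl⟩
  obtain ⟨K, hK0, hK⟩ := cnt_av_le hX hs hC hLC hB w
  refine ⟨K * (1 + 1/δ), fun n => (hK n).trans ?_⟩
  rw [mul_assoc]
  refine mul_le_mul_of_nonneg_left ?_ hK0.le
  calc _ ≤ ((1 + 1/δ) * Real.exp (δ * n)) * Real.exp (s * n) :=
        mul_le_mul_of_nonneg_right (succ_le_exp hδ0 n) (Real.exp_pos _).le
    _ = _ := by rw [mul_assoc, ← Real.exp_add, ← Real.exp_nat_mul]; congr 2; ring

lemma exists_params {X : Set (ℤ → A)} (hX : IsSubshift X) (h : hC X < hTop X) :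
    ∃ (N : ℕ) (C s : ℝ), 0 ≤ s ∧ 0 < C ∧ s < hTop X ∧ (∀ n, nw {w | LC' X w} n ≤ C * Real.exp (s * n)) ∧
      (∀ K, ∑ l ∈ Finset.range K, nw (Blk X N) l * Real.exp (-s * l) ≤ 1) := by
  obtain ⟨t, ht1, ht2⟩ := exists_between h
  obtain ⟨s, hs1, hs2⟩ := exists_between ht2
  obtain ⟨C, hC0, hC⟩ := LC_bound hX ht1
  obtain ⟨N, hN⟩ := weight_tail hC hs1 one_pos
  have := hC_nonneg X
  refine ⟨N, C, s, by linarith, hC0, hs2, fun n => (hC n).trans ?_, fun K => hN N le_rfl K⟩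
  gcongr

lemma part1_lower_aux {X : Set (ℤ → A)} [DiscreteTopology A] (hX : IsSubshift X) (h : hC X < hTop X)
    (hlim : Tendsto (fun n : ℕ => (perCount X n : ℝ) * Real.exp (-(n:ℝ) * hTop X)) atTop (nhds 0)) : False := by
  obtain ⟨N, C, s, hs, hC, hsh, hLC, hB⟩ := exists_params hX h
  have hpos : 0 < hTop X := (hC_nonneg X).trans_lt h
  have hne := nonempty_of_hTop hX hpos
  have hslow := slow_TT hX hs hC hLC hB hsh
  set T := (TT_finite X N).toFinset with hT
  have hTT : (T : Set (Set (ℕ → A))) = TT X N := by simp [hT]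
  rw [← hTT] at hslow
  have := slow_finset step (Real.exp_pos _) T {∅} (R := fun v => ∃ w, v = F X w) (H := Real.exp (hTop X)) ?_ hslow
  · obtain ⟨α, hα0, hα, hc⟩ := this
    obtain ⟨K, hK⟩ := hc (F X []) ⟨[], rfl⟩
    have hF : F X [] ≠ ∅ := by
      obtain ⟨x, hx⟩ := hne
      exact F_win_ne hX hx 0 0
    have h1 : ∀ n : ℕ, (Real.exp (hTop X) / α) ^ n ≤ K := by
      intro n
      rw [div_pow, div_le_iff₀ (by positivity), ← Real.exp_nat_mul, mul_comm]
      refine (exp_le_nw hX hne n).trans (le_trans ?_ (hK n))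
      rw [cnt_eq n _ hF]
      apply le_of_eq
      congr 1
    have h2 : 1 < Real.exp (hTop X) / α := by rwa [one_lt_div hα0]
    obtain ⟨k, hk⟩ := pow_unbounded_of_one_lt K h2
    exact absurd (h1 k) (not_le.2 hk)
  · intro u hu
    have hu' : u ∈ TT X N := by rw [← hTT]; exact hu
    obtain ⟨hu0, w, -, rfl⟩ := hu'
    refine ⟨hu0, ⟨w, rfl⟩, fun n => ?_, ?_⟩
    · rw [pth_eq hu0, ← Real.exp_nat_mul, mul_comm]
      exact nl_le_exp hX w hu0 n
    · simp only [pth_eq hu0]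
      refine squeeze_zero' (Eventually.of_forall fun n => div_nonneg (nl_nonneg _ _ _) (by positivity)) ?_ hlim
      filter_upwards [eventually_ge_atTop 1] with n hn
      rw [div_eq_mul_inv, ← Real.exp_nat_mul, ← Real.exp_neg, neg_mul]
      gcongr
      exact nl_le_perCount hX w hu0 hn

lemma part1_lower {X : Set (ℤ → A)} [DiscreteTopology A] (hX : IsSubshift X) (h : hC X < hTop X) :
    0 < limsup (fun n : ℕ => (perCount X n : ENNReal) * ENNReal.ofReal (Real.exp (-(n : ℝ) * hTop X))) atTop := by
  rw [pos_iff_ne_zero]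
  intro h0
  apply part1_lower_aux hX h
  have h1 : Tendsto (fun n : ℕ => (perCount X n : ENNReal) * ENNReal.ofReal (Real.exp (-(n : ℝ) * hTop X))) atTop (nhds 0) :=
    tendsto_of_le_liminf_of_limsup_le bot_le h0.le
  have h2 := (ENNReal.tendsto_toReal ENNReal.zero_ne_top).comp h1
  refine h2.congr fun n => ?_
  simp [ENNReal.toReal_mul, ENNReal.toReal_ofReal (Real.exp_pos _).le]

end part1
end QFTPaper

namespace QFTPaper

section part1u
variable {A : Type} [Fintype A] [TopologicalSpace A]

lemma Per_finite (X : Set (ℤ → A)) {n : ℕ} (hn : 1 ≤ n) : (Per X n).Finite := by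
  refine Set.Finite.of_finite_image (f := fun x => win x 0 n) ?_ ?_
  · refine (Finset.finite_toSet (words A n)).subset ?_
    rintro _ ⟨x, _, rfl⟩; simp
  · intro x hx y hy h; exact per_inj hn hx.2 hy.2 0 h

lemma ncard_le_nw {X : Set (ℤ → A)} {n : ℕ} (hn : 1 ≤ n) {S : Set (ℤ → A)} (hS : S ⊆ Per X n) (k : ℤ) {P : Set (List A)}
    (hP : ∀ x ∈ S, win x k n ∈ P) : (S.ncard : ℝ) ≤ nw P n := by
  rw [← card_eq_nw, Nat.card_coe_set_eq]
  have hf : {w | w.length = n ∧ w ∈ P}.Finite := (List.finite_length_eq A n).subset fun w hw => hw.1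
  have : S.ncard ≤ {w | w.length = n ∧ w ∈ P}.ncard := by
    refine Set.ncard_le_ncard_of_injOn (fun x => win x k n) (fun x hx => ⟨by simp, hP x hx⟩) ?_ hf
    intro x hx y hy h
    exact per_inj hn (hS hx).2 (hS hy).2 k h
  exact_mod_cast this

lemma ncard_cover {α ι : Type*} (s : Finset ι) (P : ι → Set α) (hP : ∀ i, (P i).Finite) :
    ∀ S : Set α, S.Finite → (∀ x ∈ S, ∃ i ∈ s, x ∈ P i) → (S.ncard : ℝ) ≤ ∑ i ∈ s, ((P i).ncard : ℝ) := by
  classical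
  induction s using Finset.induction_on with
  | empty =>
    intro S _ h
    have : S = ∅ := by ext x; simp; intro hx; simpa using h x hx
    simp [this]
  | insert i s hi ih =>
    intro S hSf h
    rw [Finset.sum_insert hi]
    have h1 : S ⊆ P i ∪ (S \ P i) := by
      intro x hx; by_cases h : x ∈ P i
      · exact Or.inl h
      · exact Or.inr ⟨hx, h⟩
    have h2 := Set.ncard_le_ncard h1 ((hP i).union (hSf.subset diff_subset))
    have h3 := Set.ncard_union_le (P i) (S \ P i)
    have h4 := ih (S \ P i) (hSf.subset diff_subset) (fun x hx => by
      obtain ⟨j, hj, hxj⟩ := h x hx.1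
      rcases Finset.mem_insert.1 hj with rfl | hj
      · exact absurd hxj hx.2
      · exact ⟨j, hj, hxj⟩)
    have h5 : (S.ncard : ℝ) ≤ (P i).ncard + (S \ P i).ncard := by exact_mod_cast h2.trans h3
    linarith

/-- eventual state at position `i` -/
def Est (X : Set (ℤ → A)) (x : ℤ → A) (i : ℤ) (u : Set (ℕ → A)) : Prop :=
  ∃ M : ℕ, ∀ m, M ≤ m → F X (win x (i - m) m) = u

lemma Est_unique {X : Set (ℤ → A)} {x : ℤ → A} {i : ℤ} {u v : Set (ℕ → A)} (h : Est X x i u) (h' : Est X x i v) : u = v := by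
  obtain ⟨M, hM⟩ := h
  obtain ⟨M', hM'⟩ := h'
  rw [← hM (max M M') (le_max_left _ _), hM' _ (le_max_right _ _)]

lemma Est_run {X : Set (ℤ → A)} {x : ℤ → A} {i : ℤ} {u : Set (ℕ → A)} (h : Est X x i u) (j : ℕ) :
    Est X x (i + j) (run u (win x i j)) := by
  obtain ⟨M, hM⟩ := h
  refine ⟨M + j, fun m hm => ?_⟩
  obtain ⟨k, rfl⟩ : ∃ k, m = k + j := ⟨m - j, by omega⟩
  rw [← hM k (by omega), ← F_append]
  have e : (i + j - ((k + j : ℕ) : ℤ)) = i - k := by push_cast; ring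
  rw [e, win_add]; congr 3; ring

lemma per_win {x : ℤ → A} {n : ℕ} (h : ∀ i : ℤ, x (i + n) = x i) (k : ℤ) (i : ℤ) (m : ℕ) : win x (i + n * k) m = win x i m := by
  apply win_congr
  intro j _
  rw [← per_mul' h k (i + j)]; congr 1; ring

lemma Est_per {X : Set (ℤ → A)} {x : ℤ → A} {n : ℕ} (h : ∀ i : ℤ, x (i + n) = x i) {i : ℤ} {u : Set (ℕ → A)} (hu : Est X x i u) (k : ℤ) :
    Est X x (i + n * k) u := by
  obtain ⟨M, hM⟩ := hu
  refine ⟨M, fun m hm => ?_⟩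
  rw [← hM m hm, show i + n * k - m = (i - m) + n * k by ring, per_win h]

lemma const_of_no_blk {X : Set (ℤ → A)} (hX : IsSubshift X) {x : ℤ → A} (hx : x ∈ X) (N : ℕ) (i : ℤ)
    (h : ∀ b : ℕ, win x (i - b) b ∉ Blk X N) (m : ℕ) : F X (win x (i - (N + m : ℕ)) (N + m)) = F X (win x (i - N) N) := by
  induction m with
  | zero => simp
  | succ m ih =>
    rw [← ih]
    by_contra hne
    apply h (N + (m+1))
    have e : win x (i - (N + (m+1) : ℕ)) (N + (m+1)) = x (i - (N + (m+1) : ℕ)) :: win x (i - (N + m : ℕ)) (N + m) := by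
      rw [← add_assoc, win_succ]; congr 2; push_cast; ring
    refine ⟨⟨?_, F_win_ne hX hx _ _, ?_⟩, by rw [win_length]; omega⟩
    · rw [e]; simp
    · intro h'; apply hne; rw [h', e]; rfl

lemma blk_or_TT {X : Set (ℤ → A)} (hX : IsSubshift X) {x : ℤ → A} (hx : x ∈ X) (N : ℕ) (i : ℤ) :
    (∃ b : ℕ, win x (i - b) b ∈ Blk X N) ∨ ∃ u ∈ TT X N, Est X x i u := by
  by_cases h : ∃ b : ℕ, win x (i - b) b ∈ Blk X N
  · exact Or.inl h
  · push Not at h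
    refine Or.inr ⟨F X (win x (i - N) N), ⟨F_win_ne hX hx _ _, _, by simp, rfl⟩, N, fun m hm => ?_⟩
    obtain ⟨k, rfl⟩ : ∃ k, m = N + k := ⟨m - N, by omega⟩
    exact const_of_no_blk hX hx N i h k

lemma Par_prefix {𝓑 : Set (List A)} {y z : List A} (h : Par 𝓑 (y ++ z)) :
    ∃ q p r, y = q ++ p ∧ Par 𝓑 q ∧ (p = [] ∨ p ++ r ∈ 𝓑) := by
  obtain ⟨L, h1, h2⟩ := h
  induction L generalizing y with
  | nil =>
    simp at h2
    exact ⟨[], [], [], by simp [h2.1], Par_nil _, Or.inl rfl⟩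
  | cons b L ih =>
    rw [List.flatten_cons, List.append_eq_append_iff] at h2
    have hb : b ∈ 𝓑 := h1 b (by simp)
    rcases h2 with ⟨as, h3, h4⟩ | ⟨bs, h3, h4⟩
    · obtain ⟨q, p, r, h5, h6, h7⟩ := ih (y := as) (fun c hc => h1 c (by simp [hc])) h4
      exact ⟨b ++ q, p, r, by rw [h3, h5, List.append_assoc], Par_cons h6 hb, h7⟩
    · exact ⟨[], y, bs, by simp, Par_nil _, Or.inr (by rwa [← h3])⟩

lemma exists_long_par {X : Set (ℤ → A)} {x : ℤ → A} (N : ℕ)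
    (h : ∀ i, ∃ b : ℕ, win x (i - b) b ∈ Blk X N) (k : ℕ) : ∃ b : ℕ, k ≤ b ∧ Par (Blk X N) (win x (-b) b) := by
  induction k with
  | zero => exact ⟨0, le_rfl, Par_nil _⟩
  | succ k ih =>
    obtain ⟨b, hb, hp⟩ := ih
    obtain ⟨c, hc⟩ := h (-b)
    have hc0 : N < c := by have := hc.2; rwa [win_length] at this
    refine ⟨c + b, by omega, ?_⟩
    rw [win_add]
    have e1 : -((c + b : ℕ) : ℤ) = -(b:ℤ) - c := by push_cast; ring
    have e2 : -((c + b : ℕ) : ℤ) + c = -(b:ℤ) := by push_cast; ring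
    rw [e2, e1]
    exact Par_cons hp hc

/-- periodic points of the second kind -/
lemma caseb {X : Set (ℤ → A)} (hX : IsSubshift X) {N : ℕ} {C s : ℝ} (hs : 0 ≤ s) (hC : 0 < C)
    (hLC : ∀ n, nw {w | LC' X w} n ≤ C * Real.exp (s * n))
    (hB : ∀ K, ∑ l ∈ Finset.range K, nw (Blk X N) l * Real.exp (-s * l) ≤ 1) {n : ℕ} (hn : 1 ≤ n) :
    (({x ∈ Per X n | ∀ i : ℤ, ∃ b : ℕ, win x (i - b) b ∈ Blk X N}).ncard : ℝ) ≤ (1 + C) * ((n+1) * (n+1) * Real.exp (s * n)) := by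
  have h0 : [] ∉ Blk X N := by rintro ⟨h, _⟩; exact h.1 rfl
  set S := {x ∈ Per X n | ∀ i : ℤ, ∃ b : ℕ, win x (i - b) b ∈ Blk X N} with hS
  set P : Set (List A) := {g | ∃ q p, g = q ++ p ∧ q ∈ {q | Par (Blk X N) q} ∧ p ∈ {p | p ∈ ({[]} : Set (List A)) ∨ p ∈ {w | LC' X w}}} with hP
  have hSf : S.Finite := (Per_finite X hn).subset fun x hx => hx.1
  have hcov := ncard_cover (Finset.range n) (fun o : ℕ => {x ∈ S | win x (-(o:ℤ)) n ∈ P}) (fun o => hSf.subset fun x hx => hx.1) S hSf ?_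
  · refine hcov.trans ?_
    calc _ ≤ ∑ o ∈ Finset.range n, (1 + C) * ((n+1) * Real.exp (s * n)) := by
          refine Finset.sum_le_sum fun o _ => ?_
          refine (ncard_le_nw (X := X) hn (fun x hx => hx.1.1) (-(o:ℤ)) (P := P) (fun x hx => hx.2)).trans ?_
          refine (nw_concat _ _ n).trans ?_
          calc _ ≤ ∑ j ∈ Finset.range (n+1), (1 + C) * Real.exp (s * n) := by
                refine Finset.sum_le_sum fun j hj => ?_
                have hj' : j ≤ n := by simp at hj; omega
                have h1 : nw {p | p ∈ ({[]} : Set (List A)) ∨ p ∈ {w | LC' X w}} (n-j) ≤ (1 + C) * Real.exp (s * (n - j : ℕ)) := by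
                  refine (nw_or_le _ _ _).trans ?_
                  rw [add_mul, one_mul]
                  exact add_le_add (nw_nil_le hs _) (hLC _)
                have h2 := mul_le_mul (Par_count h0 hB j) h1 (nw_nonneg _ _) (Real.exp_pos _).le
                refine h2.trans_eq ?_
                rw [mul_left_comm, ← Real.exp_add, ← mul_add]
                congr 3
                rw [Nat.cast_sub hj']; ring
            _ = _ := by rw [Finset.sum_const, Finset.card_range, nsmul_eq_mul]; push_cast; ring
      _ = n * ((1 + C) * ((n+1) * Real.exp (s * n))) := by rw [Finset.sum_const, Finset.card_range, nsmul_eq_mul]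
      _ ≤ (n+1) * ((1 + C) * ((n+1) * Real.exp (s * n))) := by gcongr; linarith
      _ = _ := by ring
  · intro x hx
    obtain ⟨b, hb, hp⟩ := exists_long_par N hx.2 n
    have hn' : (0:ℤ) < n := by exact_mod_cast hn
    refine ⟨b % n, Finset.mem_range.2 (Nat.mod_lt _ hn), hx, ?_⟩
    have e : win x (-((b % n : ℕ) : ℤ)) n = win x (-(b:ℤ)) n := by
      rw [← per_win hx.1.2 (-(b / n : ℕ)) (-((b % n : ℕ) : ℤ)) n]
      congr 1
      have := Nat.mod_add_div b n
      have h3 : ((b % n : ℕ) : ℤ) + n * (b / n : ℕ) = b := by exact_mod_cast this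
      linarith
    rw [e]
    obtain ⟨m, rfl⟩ : ∃ m, b = n + m := ⟨b - n, by omega⟩
    rw [win_add x n m] at hp
    obtain ⟨q, p, r, h1, h2, h3⟩ := Par_prefix hp
    refine ⟨q, p, h1, h2, ?_⟩
    rcases h3 with h3 | h3
    · exact Or.inl h3
    · rcases eq_or_ne p [] with h4 | h4
      · exact Or.inl h4
      · exact Or.inr (LC'_prefix p r h4 h3.1)

/-- the piece of periodic points seeing consecutive hits `u`, `v` around the origin -/
def Pc (X : Set (ℤ → A)) (N n l o : ℕ) (u v : Set (ℕ → A)) : Set (ℤ → A) :=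
  {x ∈ Per X n | Est X x (-(o:ℤ)) u ∧ Est X x (-(o:ℤ) + l) v ∧ Av ({∅} ∪ TT X N) u (win x (-(o:ℤ)) (l-1))}

lemma Pc_le {X : Set (ℤ → A)} (hX : IsSubshift X) {N : ℕ} {C s : ℝ} (hs : 0 ≤ s) (hC : 0 < C)
    (hLC : ∀ n, nw {w | LC' X w} n ≤ C * Real.exp (s * n))
    (hB : ∀ K, ∑ l ∈ Finset.range K, nw (Blk X N) l * Real.exp (-s * l) ≤ 1)
    (hp : 0 ≤ hTop X)
    {u v : Set (ℕ → A)} (hu : u ∈ TT X N) (hv : v ∈ TT X N) :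
    ∃ M : ℝ, 0 < M ∧ ∀ n l o : ℕ, 1 ≤ l → l ≤ n → ((Pc X N n l o u v).ncard : ℝ) ≤ M * ((l+1) * Real.exp (s * l) * Real.exp (hTop X * (n - l : ℕ))) := by
  classical
  obtain ⟨hu0, wu, -, rfl⟩ := hu
  set u := F X wu with hudef
  obtain ⟨K, hK0, hK⟩ := cnt_av_le hX hs hC hLC hB wu
  by_cases hpath : ∃ g, run u g = v
  · obtain ⟨g0, hg0⟩ := hpath
    refine ⟨K * (Fintype.card A * Real.exp (hTop X * g0.length) + 1), by positivity, fun n l o hl hln => ?_⟩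
    have hback : ∀ k, nl v u k ≤ Real.exp (hTop X * g0.length) * Real.exp (hTop X * k) := by
      intro k
      have h1 := nl_mul_le u v u g0.length k
      have h2 : 1 ≤ nl u v g0.length := by
        have := Finset.single_le_sum (f := fun w => if run u w = v then (1:ℝ) else 0) (s := words A g0.length)
          (fun w _ => by split_ifs <;> norm_num) (a := g0) (by simp)
        simp only [hg0, if_true] at this
        rw [nl_eq_nw, nw]; exact this
      have h3 := nl_le_exp hX wu hu0 (g0.length + k)
      calc nl v u k ≤ nl u v g0.length * nl v u k := le_mul_of_one_le_left (nl_nonneg _ _ _) h2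
        _ ≤ _ := h1.trans h3
        _ = _ := by rw [← Real.exp_add]; push_cast; ring_nf
    have hn : 1 ≤ n := by omega
    set R : Set (List A) := {g | run v g = u}
    have h1 := ncard_le_nw (X := X) hn (S := Pc X N n l o u v) (fun x hx => hx.1) (-(o:ℤ))
      (P := {g | g.take (l-1) ∈ {g | Av ({∅} ∪ TT X N) u g} ∧ g.drop l ∈ R}) ?_
    · refine h1.trans ?_
      have h2 : nw {g | g.take (l-1) ∈ {g | Av ({∅} ∪ TT X N) u g} ∧ g.drop l ∈ R} n =
          nw {g | Av ({∅} ∪ TT X N) u g} (l-1) * (Fintype.card A * nl v u (n-l)) := by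
        rw [nw]
        conv_lhs => rw [show n = (l-1) + (1 + (n-l)) by omega]
        rw [sum_words_add, nw, Finset.sum_mul]
        refine Finset.sum_congr rfl fun p hp => ?_
        rw [mem_words] at hp
        rw [sum_words_add, sum_words_one]
        have : ∀ (a : A) (r : List A), (p ++ ([a] ++ r) ∈ {g | g.take (l-1) ∈ {g | Av ({∅} ∪ TT X N) u g} ∧ g.drop l ∈ R}) ↔
            (p ∈ {g | Av ({∅} ∪ TT X N) u g} ∧ r ∈ R) := by
          intro a r
          simp only [mem_ofPred_eq]
          rw [List.take_left' hp, ← List.append_assoc, List.drop_left' (by simp [hp]; omega)]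
        simp only [this]
        by_cases h : p ∈ {g | Av ({∅} ∪ TT X N) u g}
        · simp only [h, true_and, if_true, one_mul, Finset.sum_const, Finset.card_univ, nsmul_eq_mul]
          rfl
        · simp only [h, false_and, if_false, zero_mul, Finset.sum_const_zero]
      rw [h2, ← cnt_eq_av]
      have hl1 : ((l-1 : ℕ):ℝ) + 1 ≤ l + 1 := by
        have : ((l-1:ℕ):ℝ) ≤ l := by exact_mod_cast (Nat.sub_le l 1)
        linarith
      calc _ ≤ (K * ((l+1) * Real.exp (s * l))) * (Fintype.card A * (Real.exp (hTop X * g0.length) * Real.exp (hTop X * (n - l : ℕ)))) := by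
            refine mul_le_mul ((hK (l-1)).trans ?_) ?_ (mul_nonneg (by positivity) (nl_nonneg _ _ _)) (by positivity)
            · gcongr; omega
            · gcongr; exact hback _
        _ = K * (Fintype.card A * Real.exp (hTop X * g0.length)) * ((l+1) * Real.exp (s * l) * Real.exp (hTop X * (n - l : ℕ))) := by ring
        _ ≤ _ := by gcongr; linarith
    · rintro x ⟨hx, hEu, hEv, hav⟩
      have e : win x (-(o:ℤ)) n = win x (-(o:ℤ)) l ++ win x (-(o:ℤ) + l) (n-l) := by
        rw [← win_add]; congr 1; omega
      have e2 : win x (-(o:ℤ)) l = win x (-(o:ℤ)) (l-1) ++ [x (-(o:ℤ) + (l-1:ℕ))] := by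
        rw [← win_succ']; congr 1; omega
      refine ⟨?_, ?_⟩
      · rw [e, e2, List.append_assoc, List.take_left' (by simp)]; exact hav
      · rw [e, List.drop_left' (by simp)]
        have h3 := Est_run hEv (n-l)
        have h4 := Est_per hx.2 hEu 1
        have e3 : -(o:ℤ) + l + (n-l:ℕ) = -(o:ℤ) + n * 1 := by rw [Nat.cast_sub hln]; ring
        rw [e3] at h3
        exact Est_unique h3 h4
  · refine ⟨1, one_pos, fun n l o hl hln => ?_⟩
    have : Pc X N n l o u v = ∅ := by
      ext x
      simp only [mem_empty_iff_false, iff_false]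
      rintro ⟨_, hEu, hEv, _⟩
      exact hpath ⟨_, Est_unique (Est_run hEu l) hEv⟩
    rw [this]; simp; positivity

end part1u
end QFTPaper

namespace QFTPaper

section part1v
variable {A : Type} [Fintype A] [TopologicalSpace A]

lemma Est_ne {X : Set (ℤ → A)} (hX : IsSubshift X) {x : ℤ → A} (hx : x ∈ X) {i : ℤ} {u : Set (ℕ → A)} (h : Est X x i u) : u ≠ ∅ := by
  obtain ⟨M, hM⟩ := h
  rw [← hM M le_rfl]; exact F_win_ne hX hx _ _

lemma Per_cover {X : Set (ℤ → A)} (hX : IsSubshift X) (N : ℕ) {n : ℕ} (hn : 1 ≤ n) {x : ℤ → A} (hx : x ∈ Per X n)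
    (hnb : ¬ ∀ i : ℤ, ∃ b : ℕ, win x (i - b) b ∈ Blk X N) :
    ∃ l o, 1 ≤ l ∧ l ≤ n ∧ o < l ∧ ∃ u ∈ TT X N, ∃ v ∈ TT X N, x ∈ Pc X N n l o u v := by
  classical
  push Not at hnb
  obtain ⟨i, hi⟩ := hnb
  set Hit : ℤ → Prop := fun j => ∃ u ∈ TT X N, Est X x j u with hHit
  have hiH : Hit i := by
    rcases blk_or_TT hX hx.1 N i with ⟨b, hb⟩ | h
    · exact absurd hb (hi b)
    · exact h
  have hper : ∀ j, Hit j → ∀ k : ℤ, Hit (j + n * k) := fun j ⟨u, hu, he⟩ k => ⟨u, hu, Est_per hx.2 he k⟩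
  have hn' : (0:ℤ) < n := by exact_mod_cast hn
  have h0 : ∃ o : ℕ, Hit (-(o:ℤ)) := by
    refine ⟨((-i) % n).toNat, ?_⟩
    rw [Int.toNat_of_nonneg (Int.emod_nonneg _ hn'.ne')]
    have := hper i hiH ((-i) / n)
    have e := Int.emod_add_mul_ediv (-i) n
    rwa [show -(-i % (n:ℤ)) = i + n * (-i / n) by linarith]
  set o := Nat.find h0 with ho
  have hoH : Hit (-(o:ℤ)) := Nat.find_spec h0
  have h1 : ∃ l : ℕ, 1 ≤ l ∧ Hit (-(o:ℤ) + l) := ⟨n, hn, by simpa using hper _ hoH 1⟩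
  set l := Nat.find h1 with hl
  obtain ⟨hl1, hlH⟩ : 1 ≤ l ∧ Hit (-(o:ℤ) + l) := Nat.find_spec h1
  have hln : l ≤ n := Nat.find_min' h1 ⟨hn, by simpa using hper _ hoH 1⟩
  have hol : o < l := by
    by_contra hcon
    push Not at hcon
    refine Nat.find_min h0 (m := o - l) (by omega) ?_
    rw [Nat.cast_sub hcon]
    convert hlH using 1; ring
  obtain ⟨u, hu, hEu⟩ := hoH
  obtain ⟨v, hv, hEv⟩ := hlH
  refine ⟨l, o, hl1, hln, hol, u, hu, v, hv, hx, hEu, hEv, ?_⟩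
  intro p s hps hp0
  have hlen : p.length + s.length = l - 1 := by
    have := congrArg List.length hps
    simpa using this.symm
  have hpw : p = win x (-(o:ℤ)) p.length := by
    have h2 : win x (-(o:ℤ)) (l-1) = win x (-(o:ℤ)) p.length ++ win x (-(o:ℤ) + p.length) s.length := by
      rw [← win_add, hlen]
    rw [h2] at hps
    exact (List.append_inj_left hps (by simp)).symm
  have hE := Est_run hEu p.length
  rw [← hpw] at hE
  have hpl : 1 ≤ p.length := List.length_pos_iff.2 hp0
  rintro (h3 | h3)
  · exact Est_ne hX hx.1 hE h3
  · exact Nat.find_min h1 (m := p.length) (by omega) ⟨hpl, _, h3, hE⟩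

lemma part1_upper_aux {X : Set (ℤ → A)} (hX : IsSubshift X) (h : hC X < hTop X) :
    ∃ M : ℝ, ∀ n : ℕ, 1 ≤ n → (perCount X n : ℝ) ≤ M * Real.exp (hTop X * n) := by
  classical
  obtain ⟨N, C, s, hs, hC, hsh, hLC, hB⟩ := exists_params hX h
  have hpos : 0 ≤ hTop X := hs.trans hsh.le
  set T := (TT_finite X N).toFinset with hT
  have hTT : ∀ u, u ∈ T ↔ u ∈ TT X N := by simp [hT]
  have hM : ∀ q : Set (ℕ → A) × Set (ℕ → A), ∃ M : ℝ, 0 < M ∧ (q ∈ T ×ˢ T → ∀ n l o : ℕ, 1 ≤ l → l ≤ n → ((Pc X N n l o q.1 q.2).ncard : ℝ) ≤ M * ((l+1) * Real.exp (s * l) * Real.exp (hTop X * (n - l : ℕ)))) := by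
    intro q
    by_cases hq : q ∈ T ×ˢ T
    · rw [Finset.mem_product, hTT, hTT] at hq
      obtain ⟨M, hM0, hM⟩ := Pc_le hX hs hC hLC hB hpos hq.1 hq.2
      exact ⟨M, hM0, fun _ => hM⟩
    · exact ⟨1, one_pos, fun h => absurd h hq⟩
  choose M hM0 hM using hM
  set δ := (hTop X - s) / 4 with hδ
  have hδ0 : 0 < δ := by rw [hδ]; linarith
  set K := 1 + 1/δ with hK
  have hK0 : 0 < K := by positivity
  -- geometric bound
  have hgeo : ∃ G : ℝ, 0 ≤ G ∧ ∀ n : ℕ, ∑ l ∈ Finset.range (n+1), Real.exp (-δ * l) ≤ G := by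
    have hsum : Summable fun l : ℕ => Real.exp (-δ * l) := by
      have : (fun l : ℕ => Real.exp (-δ * l)) = fun l : ℕ => (Real.exp (-δ)) ^ l := by
        ext l; rw [← Real.exp_nat_mul]; ring_nf
      rw [this]
      exact summable_geometric_of_lt_one (Real.exp_pos _).le (by rw [Real.exp_lt_one_iff]; linarith)
    exact ⟨_, tsum_nonneg fun l => (Real.exp_pos _).le, fun n => hsum.sum_le_tsum _ fun l _ => (Real.exp_pos _).le⟩
  obtain ⟨G, hG0, hG⟩ := hgeo
  have hKle : ∀ n : ℕ, ((n:ℝ)+1) * (n+1) * Real.exp (s * n) ≤ K * K * (Real.exp (hTop X * n) * Real.exp (-δ * n)) := by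
    intro n
    have h1 := succ_le_exp hδ0 n
    calc _ ≤ (K * Real.exp (δ * n)) * (K * Real.exp (δ * n)) * Real.exp (s * n) := by gcongr
      _ = K * K * Real.exp (δ * n + δ * n + s * n) := by rw [Real.exp_add, Real.exp_add]; ring
      _ ≤ _ := by
        rw [← Real.exp_add]
        refine mul_le_mul_of_nonneg_left (Real.exp_le_exp.2 ?_) (by positivity)
        have : (0:ℝ) ≤ n := by positivity
        have h4 : s = hTop X - 4 * δ := by rw [hδ]; ring
        rw [h4]; nlinarith
  refine ⟨(1 + C) * (K * K) + (∑ q ∈ T ×ˢ T, M q) * (K * K * G), fun n hn => ?_⟩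
  set S1 := {x ∈ Per X n | ∀ i : ℤ, ∃ b : ℕ, win x (i - b) b ∈ Blk X N} with hS1
  have hb1 : (S1.ncard : ℝ) ≤ (1 + C) * (K * K) * Real.exp (hTop X * n) := by
    refine (caseb hX hs hC hLC hB hn).trans ?_
    have := hKle n
    have h5 : Real.exp (-δ * n) ≤ 1 := by rw [Real.exp_le_one_iff]; have : (0:ℝ) ≤ n := by positivity
                                          nlinarith
    calc _ ≤ (1 + C) * (K * K * (Real.exp (hTop X * n) * Real.exp (-δ * n))) := by gcongr
      _ ≤ (1 + C) * (K * K * (Real.exp (hTop X * n) * 1)) := by gcongr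
      _ = _ := by ring
  have hPf := Per_finite X hn
  have hb2 : ((Per X n \ S1).ncard : ℝ) ≤ ∑ i ∈ (T ×ˢ T) ×ˢ (Finset.range (n+1) ×ˢ Finset.range (n+1)),
      ((if 1 ≤ i.2.1 ∧ i.2.2 < i.2.1 then Pc X N n i.2.1 i.2.2 i.1.1 i.1.2 else ∅).ncard : ℝ) := by
    refine ncard_cover _ (fun i : (Set (ℕ → A) × Set (ℕ → A)) × (ℕ × ℕ) => if 1 ≤ i.2.1 ∧ i.2.2 < i.2.1 then Pc X N n i.2.1 i.2.2 i.1.1 i.1.2 else ∅) ?_ _ (hPf.subset diff_subset) ?_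
    · intro i
      split_ifs
      · exact hPf.subset fun x hx => hx.1
      · exact Set.finite_empty
    · rintro x ⟨hx, hx1⟩
      obtain ⟨l, o, h1, h2, h3, u, hu, v, hv, hP⟩ := Per_cover hX N hn hx (fun h => hx1 ⟨hx, h⟩)
      refine ⟨((u, v), (l, o)), ?_, ?_⟩
      · simp only [Finset.mem_product, hTT, Finset.mem_range]
        exact ⟨⟨hu, hv⟩, by omega, by omega⟩
      · dsimp only
        rwa [if_pos ⟨h1, h3⟩]
  have hb3 : ∑ i ∈ (T ×ˢ T) ×ˢ (Finset.range (n+1) ×ˢ Finset.range (n+1)),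
      ((if 1 ≤ i.2.1 ∧ i.2.2 < i.2.1 then Pc X N n i.2.1 i.2.2 i.1.1 i.1.2 else ∅).ncard : ℝ) ≤ (∑ q ∈ T ×ˢ T, M q) * (K * K * G) * Real.exp (hTop X * n) := by
    rw [Finset.sum_product, Finset.sum_mul, Finset.sum_mul]
    refine Finset.sum_le_sum fun q hq => ?_
    rw [Finset.sum_product]
    calc _ ≤ ∑ l ∈ Finset.range (n+1), M q * (K * K * Real.exp (hTop X * n)) * Real.exp (-δ * l) := by
          refine Finset.sum_le_sum fun l hl => ?_
          have hln : l ≤ n := by simp at hl; omega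
          have h1 : ∀ o ∈ Finset.range (n+1), ((if 1 ≤ l ∧ o < l then Pc X N n l o q.1 q.2 else ∅).ncard : ℝ) ≤
              if o ∈ Finset.range l then M q * ((l+1) * Real.exp (s * l) * Real.exp (hTop X * (n - l : ℕ))) else 0 := by
            intro o _
            by_cases hc : 1 ≤ l ∧ o < l
            · rw [if_pos hc, if_pos (Finset.mem_range.2 hc.2)]
              exact hM q hq n l o hc.1 hln
            · rw [if_neg hc, if_neg (by rw [Finset.mem_range]; omega)]
              simp
          refine (Finset.sum_le_sum h1).trans ?_
          rw [← Finset.sum_filter]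
          have h2 : (Finset.range (n+1)).filter (fun o => o ∈ Finset.range l) = Finset.range l := by
            ext o; simp; omega
          rw [h2, Finset.sum_const, Finset.card_range, nsmul_eq_mul]
          have hMq := hM0 q
          calc _ ≤ ((l:ℝ)+1) * (M q * ((l+1) * Real.exp (s * l) * Real.exp (hTop X * (n - l : ℕ)))) := by gcongr; linarith
            _ = M q * (((l+1) * (l+1) * Real.exp (s * l)) * Real.exp (hTop X * (n - l : ℕ))) := by ring
            _ ≤ M q * ((K * K * (Real.exp (hTop X * l) * Real.exp (-δ * l))) * Real.exp (hTop X * (n - l : ℕ))) := by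
              exact mul_le_mul_of_nonneg_left (mul_le_mul_of_nonneg_right (hKle l) (Real.exp_pos _).le) hMq.le
            _ = M q * (K * K * (Real.exp (hTop X * l) * Real.exp (hTop X * (n - l : ℕ)))) * Real.exp (-δ * l) := by ring
            _ = _ := by
              rw [← Real.exp_add, ← mul_add, Nat.cast_sub hln]; congr 5; ring
      _ = M q * (K * K * Real.exp (hTop X * n)) * ∑ l ∈ Finset.range (n+1), Real.exp (-δ * l) := by rw [Finset.mul_sum]
      _ ≤ M q * (K * K * Real.exp (hTop X * n)) * G := by
        have hMq := hM0 q
        gcongr; exact hG n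
      _ = _ := by ring
  rw [perCount_eq, Nat.card_coe_set_eq]
  have h6 : (Per X n).ncard ≤ S1.ncard + (Per X n \ S1).ncard := by
    have := Set.ncard_union_le S1 (Per X n \ S1)
    rwa [Set.union_diff_cancel (fun x hx => hx.1)] at this
  have h7 : ((Per X n).ncard : ℝ) ≤ S1.ncard + (Per X n \ S1).ncard := by exact_mod_cast h6
  linarith

lemma part1_upper {X : Set (ℤ → A)} (hX : IsSubshift X) (h : hC X < hTop X) :
    limsup (fun n : ℕ => (perCount X n : ENNReal) * ENNReal.ofReal (Real.exp (-(n : ℝ) * hTop X))) atTop < ⊤ := by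
  obtain ⟨M, hM⟩ := part1_upper_aux hX h
  refine lt_of_le_of_lt (b := ENNReal.ofReal M) ?_ ENNReal.ofReal_lt_top
  refine limsup_le_of_le (by isBoundedDefault) ?_
  filter_upwards [eventually_ge_atTop 1] with n hn
  rw [← ENNReal.ofReal_natCast, ← ENNReal.ofReal_mul (by positivity)]
  apply ENNReal.ofReal_le_ofReal
  have := mul_le_mul_of_nonneg_right (hM n hn) (Real.exp_pos (-(n : ℝ) * hTop X)).le
  refine this.trans_eq ?_
  rw [mul_assoc, ← Real.exp_add]; ring_nf; simp

end part1v
end QFTPaper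

namespace QFTPaper

section meas
variable {A : Type}

lemma win_ofFn (x : ℤ → A) (n : ℕ) : ∀ k : ℤ, win x k n = List.ofFn (fun i : Fin n => x (k + (i:ℕ))) := by
  intro k
  apply List.ext_getElem
  · simp
  · intro i h1 h2
    rw [win_getElem]; simp

variable [Fintype A] [TopologicalSpace A] [DiscreteTopology A]

lemma clopen_win (n : ℕ) (k : ℤ) (P : Set (List A)) : IsClopen {x : ℤ → A | win x k n ∈ P} := by
  have : {x : ℤ → A | win x k n ∈ P} = (fun x : ℤ → A => fun i : Fin n => x (k + (i:ℕ))) ⁻¹' {v | List.ofFn v ∈ P} := by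
    ext x; simp [win_ofFn]
  rw [this]
  exact (isClopen_discrete _).preimage (by fun_prop)

variable [MeasurableSpace A] [BorelSpace A]

lemma meas_win (n : ℕ) (k : ℤ) (P : Set (List A)) : MeasurableSet {x : ℤ → A | win x k n ∈ P} :=
  (clopen_win n k P).2.measurableSet

lemma meas_win_eq (n : ℕ) (k : ℤ) (w : List A) : MeasurableSet {x : ℤ → A | win x k n = w} :=
  meas_win n k {w}

lemma shift_meas : Measurable (shift : (ℤ → A) → (ℤ → A)) :=
  measurable_pi_lambda _ fun _ => measurable_pi_apply _

lemma sh_meas (k : ℤ) : Measurable (sh k : (ℤ → A) → (ℤ → A)) :=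
  measurable_pi_lambda _ fun _ => measurable_pi_apply _

lemma sum_cyl (μ : Measure (ℤ → A)) [IsFiniteMeasure μ] (n : ℕ) (k : ℤ) (E : Set (ℤ → A)) :
    ∑ w ∈ words A n, μ.real ({x | win x k n = w} ∩ E) = μ.real E := by
  classical
  have h1 : E = ⋃ w ∈ words A n, ({x | win x k n = w} ∩ E) := by
    ext x
    simp only [mem_iUnion, mem_inter_iff, mem_ofPred_eq, exists_prop]
    exact ⟨fun h => ⟨win x k n, by simp, rfl, h⟩, fun ⟨_, _, _, h⟩ => h⟩
  have h2 := measureReal_biUnion_finset₀ (μ := μ) (s := words A n) (f := fun w => {x | win x k n = w} ∩ E)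
  have h3 : μ E = ∑ w ∈ words A n, μ ({x | win x k n = w} ∩ E) := by
    have h4 : ∀ s : Finset (List A), μ ((⋃ w ∈ s, {x | win x k n = w}) ∩ E) = ∑ w ∈ s, μ ({x | win x k n = w} ∩ E) := by
      intro s
      have h5 := measure_biUnion_finset (μ := μ.restrict E) (s := s) (f := fun w => {x | win x k n = w}) ?_ (fun w _ => meas_win_eq n k w)
      · rw [Measure.restrict_apply (Finset.measurableSet_biUnion _ fun w _ => meas_win_eq n k w)] at h5
        rw [h5]
        exact Finset.sum_congr rfl fun w _ => Measure.restrict_apply (meas_win_eq n k w)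
      · intro w _ w' _ hne
        rw [Function.onFun, Set.disjoint_left]
        intro x hx hx'
        exact hne (hx.symm.trans hx')
    rw [← h4]
    congr 1
    ext x
    simp
  rw [measureReal_def, h3, ENNReal.toReal_sum (fun _ _ => measure_ne_top _ _)]
  rfl

lemma int_win (μ : Measure (ℤ → A)) [IsFiniteMeasure μ] (n : ℕ) (k : ℤ) (g : List A → ℝ) :
    Integrable (fun x => g (win x k n)) μ ∧
    ∫ x, g (win x k n) ∂μ = ∑ w ∈ words A n, g w * μ.real {x | win x k n = w} := by
  classical
  have h1 : (fun x => g (win x k n)) = fun x => ∑ w ∈ words A n, ({x : ℤ → A | win x k n = w}).indicator (fun _ => g w) x := by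
    ext x
    rw [Finset.sum_eq_single (win x k n)]
    · simp [indicator]
    · intro w _ hw
      rw [indicator_of_notMem]; exact fun h => hw h.symm
    · intro h; exact absurd (by simp) h
  have h2 : ∀ w ∈ words A n, Integrable (({x : ℤ → A | win x k n = w}).indicator (fun _ => g w)) μ :=
    fun w _ => (integrable_const _).indicator (meas_win_eq n k w)
  rw [h1]
  refine ⟨integrable_finset_sum _ h2, ?_⟩
  rw [integral_finset_sum _ h2]
  refine Finset.sum_congr rfl fun w _ => ?_
  rw [integral_indicator (meas_win_eq n k w), setIntegral_const, smul_eq_mul, mul_comm]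

lemma blockEntropy_eq (μ : Measure (ℤ → A)) (n : ℕ) :
    blockEntropy μ n = ∑ w ∈ words A n, Real.negMulLog (μ.real {x | win x 0 n = w}) := by
  rw [blockEntropy, ← sum_ofFn n (fun w => Real.negMulLog (μ.real {x | win x 0 n = w}))]
  refine Finset.sum_congr rfl fun w _ => ?_
  rw [measureReal_def]
  congr 3
  ext x
  simp only [cylSet, mem_ofPred_eq, win_ofFn, List.ofFn_inj, funext_iff, zero_add]

lemma blockEntropy_nonneg (μ : Measure (ℤ → A)) [IsProbabilityMeasure μ] (n : ℕ) : 0 ≤ blockEntropy μ n := by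
  rw [blockEntropy_eq]
  exact Finset.sum_nonneg fun w _ => Real.negMulLog_nonneg measureReal_nonneg measureReal_le_one

lemma KS_le (μ : Measure (ℤ → A)) [IsProbabilityMeasure μ] (n : ℕ) (hn : 1 ≤ n) : KSEntropy μ * n ≤ blockEntropy μ n := by
  obtain ⟨m, rfl⟩ : ∃ m, n = m + 1 := ⟨n - 1, by omega⟩
  have : KSEntropy μ ≤ blockEntropy μ (m + 1) / (m + 1) := by
    refine ciInf_le ⟨0, ?_⟩ m
    rintro _ ⟨k, rfl⟩
    have := blockEntropy_nonneg μ (k+1)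
    positivity
  rw [le_div_iff₀ (by positivity)] at this
  push_cast; exact this

lemma gibbs_pt {p q : ℝ} (hp : 0 ≤ p) (hq : 0 ≤ q) (h : 0 < p → 0 < q) : Real.negMulLog p ≤ -Real.log q * p + (q - p) := by
  rcases hp.eq_or_lt with rfl | hp'
  · simp [hq]
  · have hq' := h hp'
    have h1 := Real.log_le_sub_one_of_pos (div_pos hq' hp')
    rw [Real.log_div hq'.ne' hp'.ne'] at h1
    have h2 := mul_le_mul_of_nonneg_left h1 hp
    have h3 : p * (q / p - 1) = q - p := by field_simp
    rw [Real.negMulLog]; linarith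

lemma gibbs_int (μ : Measure (ℤ → A)) [IsProbabilityMeasure μ] (n : ℕ) (Q : List A → ℝ) (hQ0 : ∀ w, 0 ≤ Q w)
    (hQ1 : ∑ w ∈ words A n, Q w ≤ 1) (f : (ℤ → A) → ℝ) (hf : Integrable f μ)
    (h : ∀ᵐ x ∂μ, Real.exp (- f x) ≤ Q (win x 0 n)) : blockEntropy μ n ≤ ∫ x, f x ∂μ := by
  have h1 : blockEntropy μ n ≤ ∑ w ∈ words A n, (-Real.log (Q w) * μ.real {x | win x 0 n = w} + (Q w - μ.real {x | win x 0 n = w})) := by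
    rw [blockEntropy_eq]
    refine Finset.sum_le_sum fun w _ => gibbs_pt measureReal_nonneg (hQ0 w) fun hp => ?_
    rcases (hQ0 w).eq_or_lt with h0 | h0
    · exfalso
      have : μ {x | win x 0 n = w} = 0 := by
        refine measure_mono_null (fun x hx => ?_) (ae_iff.1 h)
        simp only [mem_ofPred_eq] at hx ⊢
        rw [hx, ← h0, not_le]; exact Real.exp_pos _
      rw [measureReal_def, this] at hp
      simp at hp
    · exact h0
  have h2 : ∑ w ∈ words A n, μ.real {x | win x 0 n = w} = 1 := by
    have := sum_cyl μ n 0 univ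
    simpa using this
  rw [Finset.sum_add_distrib, Finset.sum_sub_distrib, h2] at h1
  obtain ⟨h3, h4⟩ := int_win μ n 0 (fun w => -Real.log (Q w))
  rw [← h4] at h1
  have h5 : ∫ x, -Real.log (Q (win x 0 n)) ∂μ ≤ ∫ x, f x ∂μ := by
    refine integral_mono_ae h3 hf ?_
    filter_upwards [h] with x hx
    have := Real.log_le_log (Real.exp_pos _) hx
    rw [Real.log_exp] at this; linarith
  linarith

end meas

section greedy
variable {A : Type} [Fintype A] [TopologicalSpace A]

open Classical in
lemma greedy {𝓑 : Set (List A)} {lam c : ℝ} (hlam : 0 ≤ lam) (hc : 0 ≤ c) {β : List A → ℝ} (hβ : ∀ b, 0 ≤ β b)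
    (h1 : ∀ b ∈ 𝓑, Real.exp (-lam * b.length) ≤ β b) (h2 : ∀ a : A, Real.exp (-c) ≤ β [a]) (x : ℤ → A) (Z : ℕ → Prop)
    (hZ : ∀ τ : ℕ, 1 ≤ τ → ¬ Z τ → ∃ l : ℕ, 1 ≤ l ∧ l ≤ τ ∧ win x (τ - l) l ∈ 𝓑) (t : ℕ) :
    ∃ L : List (List A), L.flatten = win x 0 t ∧
      Real.exp (-(lam * t + c * ∑ τ ∈ Finset.range t, if Z (τ+1) then 1 else 0)) ≤ (L.map β).prod := by
  induction t using Nat.strong_induction_on with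
  | _ t ih =>
    rcases Nat.eq_zero_or_pos t with rfl | ht
    · exact ⟨[], by simp, by simp⟩
    by_cases hz : Z t
    · obtain ⟨s, rfl⟩ : ∃ s, t = s + 1 := ⟨t - 1, by omega⟩
      obtain ⟨L, hL, hp⟩ := ih s (by omega)
      refine ⟨L ++ [[x s]], ?_, ?_⟩
      · rw [List.flatten_append, hL, win_succ']; simp
      · rw [List.map_append, List.prod_append, Finset.sum_range_succ, if_pos hz]
        simp only [List.map_cons, List.map_nil, List.prod_cons, List.prod_nil, mul_one]
        refine le_trans ?_ (mul_le_mul hp (h2 (x s)) (Real.exp_pos _).le ((Real.exp_pos _).le.trans hp))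
        rw [← Real.exp_add, Real.exp_le_exp]
        push_cast; nlinarith
    · obtain ⟨l, hl1, hl2, hl⟩ := hZ t ht hz
      obtain ⟨L, hL, hp⟩ := ih (t - l) (by omega)
      refine ⟨L ++ [win x (t - l) l], ?_, ?_⟩
      · rw [List.flatten_append, hL]
        have : t = (t - l) + l := by omega
        conv_rhs => rw [this, win_add]
        simp [Nat.cast_sub hl2]
      · rw [List.map_append, List.prod_append]
        simp only [List.map_cons, List.map_nil, List.prod_cons, List.prod_nil, mul_one]
        refine le_trans ?_ (mul_le_mul hp (h1 _ hl) (Real.exp_pos _).le ((Real.exp_pos _).le.trans hp))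
        rw [← Real.exp_add, Real.exp_le_exp, win_length, Nat.cast_sub hl2]
        have h3 : (∑ τ ∈ Finset.range (t-l), if Z (τ+1) then (1:ℝ) else 0) ≤ ∑ τ ∈ Finset.range t, if Z (τ+1) then 1 else 0 :=
          Finset.sum_le_sum_of_subset_of_nonneg (Finset.range_mono (by omega)) fun _ _ _ => by split_ifs <;> norm_num
        nlinarith

/-- no block of length at most `K` ends at the origin -/
def ZK (𝓑 : Set (List A)) (K : ℕ) : Set (ℤ → A) := {x | ∀ l : ℕ, 1 ≤ l → l ≤ K → win x (-l) l ∉ 𝓑}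

lemma ZK_anti (𝓑 : Set (List A)) {K J : ℕ} (h : J ≤ K) : ZK 𝓑 K ⊆ ZK 𝓑 J := fun _ hx l h1 h2 => hx l h1 (h2.trans h)

open Classical in
lemma exists_Q {𝓑 : Set (List A)} {lam : ℝ} (hlam : 0 ≤ lam) (h0 : [] ∉ 𝓑)
    (hs : ∀ K, ∑ l ∈ Finset.range K, nw 𝓑 l * Real.exp (-lam * l) ≤ 1/2) :
    ∃ (Q : List A → ℝ) (c : ℝ), 0 ≤ c ∧ (∀ w, 0 ≤ Q w) ∧ (∀ n, ∑ w ∈ words A n, Q w ≤ 1) ∧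
      ∀ (x : ℤ → A) (n K : ℕ), Real.exp (-(lam * n + c * (K + ∑ τ ∈ Finset.range n, if sh ((τ:ℤ)+1) x ∈ ZK 𝓑 K then 1 else 0))) ≤ Q (win x 0 n) := by
  rcases isEmpty_or_nonempty A with hA | hA
  · exact ⟨fun w => if w = [] then 1 else 0, 0, le_rfl, fun w => by dsimp only; split_ifs <;> norm_num, fun n => by rw [Finset.sum_ite_eq']; split_ifs <;> norm_num, fun x => hA.elim (x 0)⟩
  have hA0 : (0:ℝ) < Fintype.card A := by exact_mod_cast Fintype.card_pos
  have hA1 : (1:ℝ) ≤ Fintype.card A := by exact_mod_cast Fintype.card_pos (α := A)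
  set β : List A → ℝ := fun v => (if v ∈ 𝓑 then Real.exp (-lam * v.length) else 0) + (if v.length = 1 then 1 / (2 * (Fintype.card A : ℝ)) else 0) with hβdef
  have hβ1 : ∀ v, (0:ℝ) ≤ if v ∈ 𝓑 then Real.exp (-lam * v.length) else 0 := fun v => by
    split_ifs; exacts [(Real.exp_pos _).le, le_rfl]
  have hβ2 : ∀ v : List A, (0:ℝ) ≤ if v.length = 1 then 1 / (2 * (Fintype.card A : ℝ)) else 0 := fun v => by
    split_ifs; exacts [by positivity, le_rfl]
  have hβ : ∀ v, 0 ≤ β v := fun v => add_nonneg (hβ1 v) (hβ2 v)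
  obtain ⟨Q, hQ0, hQ1, hQ⟩ := kraft hβ (by simp [hβdef, h0]) (fun L => by
    simp only [hβdef, Finset.sum_add_distrib]
    have h1 := hs L
    have h2 : ∑ l ∈ Finset.range L, ∑ v ∈ words A l, (if v.length = 1 then 1 / (2 * (Fintype.card A : ℝ)) else 0) ≤ 1/2 := by
      calc _ ≤ ∑ l ∈ Finset.range L, if l = 1 then (1/2:ℝ) else 0 := by
            refine Finset.sum_le_sum fun l _ => ?_
            split_ifs with hl
            · subst hl
              rw [sum_words_one]
              simp
            · rw [Finset.sum_eq_zero]
              intro v hv; rw [mem_words] at hv; rw [if_neg (by omega)]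
        _ ≤ _ := by rw [Finset.sum_ite_eq']; split_ifs <;> norm_num
    have h3 : ∑ l ∈ Finset.range L, ∑ v ∈ words A l, (if v ∈ 𝓑 then Real.exp (-lam * v.length) else 0) ≤ 1/2 := by
      simp only [sum_indic]; exact hs L
    linarith)
  have hc : 0 ≤ Real.log (2 * Fintype.card A) := Real.log_nonneg (by linarith)
  refine ⟨Q, Real.log (2 * Fintype.card A), hc, hQ0, hQ1, fun x n K => ?_⟩
  obtain ⟨L, hL1, hL2⟩ := greedy hlam hc hβ (𝓑 := 𝓑) (fun b hb => by
      simp only [hβdef, if_pos hb]; linarith [hβ2 b])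
    (fun a => by
      have := hβ1 [a]
      simp only [hβdef]
      rw [if_pos (List.length_singleton (a := a)), Real.exp_neg, Real.exp_log (by positivity), one_div]
      exact le_add_of_nonneg_left this) x
    (fun τ => τ ≤ K ∨ sh (τ:ℤ) x ∈ ZK 𝓑 K) (fun τ hτ hn => by
      push Not at hn
      obtain ⟨h1, h2⟩ := hn
      simp only [ZK, mem_ofPred_eq] at h2
      push Not at h2
      obtain ⟨l, hl1, hl2, hl3⟩ := h2
      refine ⟨l, hl1, by omega, ?_⟩
      rw [win_sh] at hl3
      rwa [show (τ:ℤ) - l = -l + τ by ring]) n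
  rw [← hL1]
  refine le_trans ?_ (hL2.trans (hQ L))
  rw [Real.exp_le_exp, neg_le_neg_iff]
  gcongr
  calc _ ≤ ∑ τ ∈ Finset.range n, ((if τ < K then (1:ℝ) else 0) + if sh ((τ:ℤ)+1) x ∈ ZK 𝓑 K then 1 else 0) := by
        refine Finset.sum_le_sum fun τ _ => ?_
        push_cast
        by_cases h2 : τ < K
        · rw [if_pos (Or.inl (by omega)), if_pos h2]
          split_ifs <;> norm_num
        · by_cases h3 : sh ((τ:ℤ)+1) x ∈ ZK 𝓑 K
          · rw [if_pos (Or.inr h3), if_pos h3, if_neg h2]; norm_num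
          · rw [if_neg (by rintro (h | h); exacts [h2 (by omega), h3 h]), if_neg h3, if_neg h2]; norm_num
    _ ≤ _ := by
      rw [Finset.sum_add_distrib]
      gcongr
      rw [← Finset.sum_filter, Finset.sum_const, nsmul_eq_mul, mul_one]
      have : ((Finset.range n).filter (fun τ => τ < K)).card ≤ (Finset.range K).card := Finset.card_le_card fun τ h => by simp at h ⊢; exact h.2
      rw [Finset.card_range] at this
      exact_mod_cast this

end greedy
end QFTPaper

namespace QFTPaper

lemma lin_bound {a b : ℝ} (N : ℕ) (h : ∀ n : ℕ, N ≤ n → a * n ≤ b) : a ≤ 0 := by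
  by_contra hc
  push Not at hc
  obtain ⟨n, hn⟩ := exists_nat_gt (b / a)
  have h1 := h (max n N) (le_max_right _ _)
  have h2 : (n:ℝ) ≤ (max n N : ℕ) := by exact_mod_cast le_max_left _ _
  rw [div_lt_iff₀ hc] at hn
  nlinarith

section lemA
variable {A : Type} [Fintype A] [TopologicalSpace A] [DiscreteTopology A] [MeasurableSpace A] [BorelSpace A]

lemma sh_one : (sh 1 : (ℤ → A) → (ℤ → A)) = shift := rfl

lemma sh_sh (k l : ℤ) (x : ℤ → A) : sh k (sh l x) = sh (k + l) x := by
  ext n; simp only [sh]; congr 1; ring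

lemma sh_zero (x : ℤ → A) : sh 0 x = x := by ext n; simp [sh]

lemma sh_mp {μ : Measure (ℤ → A)} (h : MeasurePreserving shift μ μ) (k : ℤ) : MeasurePreserving (sh k) μ μ := by
  have hn : ∀ n : ℕ, MeasurePreserving (sh (n:ℤ)) μ μ := by
    intro n
    induction n with
    | zero =>
      have : (sh ((0:ℕ):ℤ) : (ℤ → A) → (ℤ → A)) = id := by funext x; exact sh_zero x
      rw [this]; exact MeasurePreserving.id μ
    | succ n ih =>
      have : (sh ((n+1 : ℕ):ℤ) : (ℤ → A) → (ℤ → A)) = shift ∘ sh (n:ℤ) := by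
        funext x; rw [Function.comp_apply, ← sh_one, sh_sh]; congr 1; push_cast; ring
      rw [this]; exact h.comp ih
  rcases Int.eq_nat_or_neg k with ⟨n, rfl | rfl⟩
  · exact hn n
  · refine ⟨sh_meas _, ?_⟩
    conv_lhs => rw [← (hn n).map_eq]
    rw [Measure.map_map (sh_meas _) (sh_meas _)]
    have : (sh (-(n:ℤ)) : (ℤ → A) → (ℤ → A)) ∘ sh (n:ℤ) = id := by
      funext x; rw [Function.comp_apply, sh_sh]; simp [sh_zero]
    rw [this, Measure.map_id]

lemma ZK_clopen (𝓑 : Set (List A)) (K : ℕ) : IsClopen (ZK 𝓑 K : Set (ℤ → A)) := by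
  have : (ZK 𝓑 K : Set (ℤ → A)) = ⋂ l ∈ Finset.Icc 1 K, {x | win x (-l) l ∈ 𝓑ᶜ} := by
    ext x; simp [ZK]
  rw [this]
  exact isClopen_biInter_finset fun l _ => clopen_win l _ _

lemma int_sh {μ : Measure (ℤ → A)} [IsFiniteMeasure μ] (h : MeasurePreserving shift μ μ) (k : ℤ) {E : Set (ℤ → A)} (hE : MeasurableSet E) [∀ x, Decidable (sh k x ∈ E)] :
    Integrable (fun x => if sh k x ∈ E then (1:ℝ) else 0) μ ∧ ∫ x, (if sh k x ∈ E then (1:ℝ) else 0) ∂μ = μ.real E := by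
  classical
  have h1 : (fun x => if sh k x ∈ E then (1:ℝ) else 0) = (sh k ⁻¹' E).indicator (fun _ => (1:ℝ)) := by
    ext x; simp only [indicator, mem_preimage]
  have hm : MeasurableSet (sh k ⁻¹' E) := sh_meas k hE
  rw [h1]
  refine ⟨(integrable_const _).indicator hm, ?_⟩
  rw [integral_indicator hm, setIntegral_const, smul_eq_mul, mul_one, measureReal_def, (sh_mp h k).measure_preimage hE.nullMeasurableSet, measureReal_def]

lemma lemA {μ : Measure (ℤ → A)} [IsProbabilityMeasure μ] (hμ : MeasurePreserving shift μ μ)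
    {𝓑 : Set (List A)} {lam : ℝ} (hlam : 0 ≤ lam) (h0 : [] ∉ 𝓑)
    (hs : ∀ K, ∑ l ∈ Finset.range K, nw 𝓑 l * Real.exp (-lam * l) ≤ 1/2)
    (hae : ∀ᵐ x ∂μ, ∃ l : ℕ, 1 ≤ l ∧ win x (-l) l ∈ 𝓑) : KSEntropy μ ≤ lam := by
  classical
  obtain ⟨Q, c, hc, hQ0, hQ1, hQ⟩ := exists_Q hlam h0 hs
  have hmZ : ∀ K, MeasurableSet (ZK 𝓑 K : Set (ℤ → A)) := fun K => (ZK_clopen 𝓑 K).2.measurableSet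
  have hK : ∀ K : ℕ, KSEntropy μ ≤ lam + c * μ.real (ZK 𝓑 K) := by
    intro K
    have h1 : KSEntropy μ - (lam + c * μ.real (ZK 𝓑 K)) ≤ 0 := by
      refine lin_bound (b := c * K) 1 fun n hn => ?_
      have h2 := KS_le μ n hn
      have h_integ : ∀ τ ∈ Finset.range n, Integrable (fun x => if sh ((τ:ℤ)+1) x ∈ ZK 𝓑 K then (1:ℝ) else 0) μ :=
        fun τ _ => (int_sh hμ _ (hmZ K)).1
      have hint2 := integrable_finset_sum _ h_integ
      have h3 := gibbs_int μ n Q hQ0 (hQ1 n) (fun x => lam * n + c * (K + ∑ τ ∈ Finset.range n, if sh ((τ:ℤ)+1) x ∈ ZK 𝓑 K then 1 else 0))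
        ((integrable_const _).add (((integrable_const _).add hint2).const_mul c)) (ae_of_all _ fun x => by convert hQ x n K)
      have hint3 : Integrable (fun x => c * ((K:ℝ) + ∑ τ ∈ Finset.range n, if sh ((τ:ℤ)+1) x ∈ ZK 𝓑 K then (1:ℝ) else 0)) μ :=
        ((integrable_const _).add hint2).const_mul c
      rw [integral_add (integrable_const _) hint3, integral_const_mul, integral_const_mul,
        integral_add (integrable_const _) hint2, integral_finset_sum _ h_integ, Finset.sum_congr rfl (fun τ _ => (int_sh hμ _ (hmZ K)).2)] at h3
      simp at h3
      linarith
    linarith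
  have hlim : Tendsto (fun K => μ.real (ZK 𝓑 K : Set (ℤ → A))) atTop (nhds 0) := by
    have h1 := tendsto_measure_iInter_atTop (μ := μ) (s := fun K => (ZK 𝓑 K : Set (ℤ → A))) (fun K => (hmZ K).nullMeasurableSet)
      (fun J K h => ZK_anti 𝓑 h) ⟨0, measure_ne_top _ _⟩
    have h2 : μ (⋂ K, (ZK 𝓑 K : Set (ℤ → A))) = 0 := by
      refine measure_mono_null (fun x hx => ?_) (ae_iff.1 hae)
      simp only [mem_iInter, ZK, mem_ofPred_eq] at hx ⊢
      rintro ⟨l, hl, h⟩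
      exact hx l l hl le_rfl h
    rw [h2] at h1
    have := (ENNReal.tendsto_toReal ENNReal.zero_ne_top).comp h1
    rw [ENNReal.toReal_zero] at this
    exact this
  have := (hlim.const_mul c).const_add lam
  simp at this
  exact ge_of_tendsto' this hK

lemma ext_cyl {μ ν : Measure (ℤ → A)} [IsProbabilityMeasure μ] [IsProbabilityMeasure ν]
    (h : ∀ (k : ℤ) (n : ℕ) (w : List A), μ {x | win x k n = w} = ν {x | win x k n = w}) : μ = ν := by
  have hP : ∀ (k : ℤ) (n : ℕ) (P : Set (List A)), μ {x | win x k n ∈ P} = ν {x | win x k n ∈ P} := by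
    classical
    intro k n P
    have h1 := sum_cyl μ n k {x | win x k n ∈ P}
    have h2 := sum_cyl ν n k {x | win x k n ∈ P}
    have h3 : ∀ w, μ.real ({x | win x k n = w} ∩ {x | win x k n ∈ P}) = ν.real ({x | win x k n = w} ∩ {x | win x k n ∈ P}) := by
      intro w
      by_cases hw : w ∈ P
      · have : ({x : ℤ → A | win x k n = w} ∩ {x | win x k n ∈ P}) = {x | win x k n = w} := by
          ext x; simp only [mem_inter_iff, mem_ofPred_eq, and_iff_left_iff_imp]; rintro rfl; exact hw
        rw [this, measureReal_def, measureReal_def, h]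
      · have : ({x : ℤ → A | win x k n = w} ∩ {x | win x k n ∈ P}) = ∅ := by
          ext x; simp only [mem_inter_iff, mem_ofPred_eq, mem_empty_iff_false, iff_false]; rintro ⟨rfl, h⟩; exact hw h
        rw [this]; simp
    rw [← ENNReal.toReal_eq_toReal_iff' (measure_ne_top _ _) (measure_ne_top _ _)]
    change μ.real _ = ν.real _
    rw [← h1, ← h2]
    exact Finset.sum_congr rfl fun w _ => h3 w
  have hgen := generateFrom_measurableCylinders (α := fun _ : ℤ => A)
  refine ext_of_generate_finite _ hgen.symm isPiSystem_measurableCylinders ?_ (by simp)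
  intro s hs
  obtain ⟨I, S, hS, rfl⟩ := (mem_measurableCylinders s).1 hs
  obtain ⟨M, hM⟩ : ∃ M : ℕ, ∀ i ∈ I, |i| ≤ M := by
    refine ⟨I.sup Int.natAbs, fun i hi => ?_⟩
    have := Finset.le_sup (f := Int.natAbs) hi
    rw [Int.abs_eq_natAbs]; exact_mod_cast this
  have : (cylinder I S) = {x : ℤ → A | win x (-M) (2*M+1) ∈ {w | ∃ y ∈ cylinder I S, w = win y (-M) (2*M+1)}} := by
    ext x
    constructor
    · intro hx; exact ⟨x, hx, rfl⟩
    · rintro ⟨y, hy, hw⟩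
      rw [win_eq_iff] at hw
      rw [mem_cylinder] at hy ⊢
      convert hy using 1
      funext i
      have h1 := hM i i.2
      have := hw ((i:ℤ) + M).toNat (by rw [abs_le] at h1; omega)
      rw [abs_le] at h1
      rw [Int.toNat_of_nonneg (by omega)] at this
      simpa using this
  rw [this]; exact hP _ _ _

end lemA
end QFTPaper

namespace QFTPaper

section lemA2
variable {A : Type} [Fintype A] [TopologicalSpace A] [DiscreteTopology A] [MeasurableSpace A] [BorelSpace A]

/-- empirical measure -/
noncomputable def emp (n : ℕ) (x : ℤ → A) : Measure (ℤ → A) :=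
  (n : ENNReal)⁻¹ • ∑ τ ∈ Finset.range n, Measure.dirac (sh ((τ:ℤ)+1) x)

open Classical in
lemma emp_apply (n : ℕ) (x : ℤ → A) {E : Set (ℤ → A)} (hE : MeasurableSet E) :
    emp n x E = (n : ENNReal)⁻¹ * ∑ τ ∈ Finset.range n, if sh ((τ:ℤ)+1) x ∈ E then 1 else 0 := by
  rw [emp, Measure.smul_apply, Measure.finset_sum_apply, smul_eq_mul]
  congr 1
  refine Finset.sum_congr rfl fun τ _ => ?_
  rw [Measure.dirac_apply' _ hE, indicator]
  simp

open Classical in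
lemma emp_real (n : ℕ) (x : ℤ → A) {E : Set (ℤ → A)} (hE : MeasurableSet E) :
    (emp n x).real E = (∑ τ ∈ Finset.range n, if sh ((τ:ℤ)+1) x ∈ E then (1:ℝ) else 0) / n := by
  rw [measureReal_def, emp_apply n x hE, ENNReal.toReal_mul, ENNReal.toReal_inv, ENNReal.toReal_natCast,
    ENNReal.toReal_sum (fun τ _ => by split_ifs <;> simp), div_eq_inv_mul]
  congr 1
  refine Finset.sum_congr rfl fun τ _ => ?_
  split_ifs <;> simp

lemma emp_prob {n : ℕ} (hn : 1 ≤ n) (x : ℤ → A) : IsProbabilityMeasure (emp n x) := by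
  classical
  constructor
  rw [emp_apply n x MeasurableSet.univ]
  simp
  exact ENNReal.inv_mul_cancel (by simp; omega) (ENNReal.natCast_ne_top n)

lemma exists_limit {X : Set (ℤ → A)} (hX : IsSubshift X) {ε : ℝ} (hε : 0 < ε) (Z : ℕ → Set (ℤ → A))
    (hZc : ∀ K, IsClopen (Z K)) (hZ : Antitone Z) (n : ℕ → ℕ) (hn : ∀ K, K + 1 ≤ n K) (x : ℕ → ℤ → A) (hx : ∀ K, x K ∈ X)
    (h : ∀ K, ε ≤ (emp (n K) (x K)).real (Z K)) :
    ∃ μ : Measure (ℤ → A), IsProbabilityMeasure μ ∧ MeasurePreserving shift μ μ ∧ μ Xᶜ = 0 ∧ ∀ K, ε ≤ μ.real (Z K) := by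
  classical
  have hp : ∀ K, IsProbabilityMeasure (emp (n K) (x K)) := fun K => emp_prob (by have := hn K; omega) _
  set u : ℕ → ProbabilityMeasure (ℤ → A) := fun K => ⟨emp (n K) (x K), hp K⟩ with hu
  set 𝓤 : Ultrafilter ℕ := hyperfilter ℕ
  have h𝓤 : (𝓤 : Filter ℕ) ≤ atTop := by rw [← Nat.cofinite_eq_atTop]; exact hyperfilter_le_cofinite
  obtain ⟨μ, -, hμ⟩ := isCompact_univ.ultrafilter_le_nhds (𝓤.map u) (by simp)
  have hlim : Tendsto u 𝓤 (nhds μ) := hμ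
  have hcl : ∀ E : Set (ℤ → A), IsClopen E → Tendsto (fun K => (emp (n K) (x K)).real E) 𝓤 (nhds ((μ : Measure (ℤ → A)).real E)) := by
    intro E hE
    have := ProbabilityMeasure.tendsto_measure_of_null_frontier_of_tendsto' hlim (E := E) (by rw [hE.frontier_eq]; simp)
    exact (ENNReal.tendsto_toReal (measure_ne_top _ _)).comp this
  refine ⟨μ, inferInstance, ⟨shift_meas, ?_⟩, ?_, ?_⟩
  · have : IsProbabilityMeasure (Measure.map shift (μ : Measure (ℤ → A))) := Measure.isProbabilityMeasure_map shift_meas.aemeasurable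
    refine ext_cyl fun k m w => ?_
    set E := {x : ℤ → A | win x k m = w} with hE
    have hEc : IsClopen E := clopen_win m k {w}
    have hcont : Continuous (shift : (ℤ → A) → (ℤ → A)) := by unfold shift; fun_prop
    have hEc' : IsClopen (shift ⁻¹' E) := hEc.preimage hcont
    rw [Measure.map_apply shift_meas hEc.2.measurableSet]
    have h1 := (hcl _ hEc').sub (hcl _ hEc)
    have h2 : Tendsto (fun K => (emp (n K) (x K)).real (shift ⁻¹' E) - (emp (n K) (x K)).real E) 𝓤 (nhds 0) := by
      have h3 : Tendsto (fun K : ℕ => 1 / ((K:ℝ) + 1)) 𝓤 (nhds 0) := tendsto_one_div_add_atTop_nhds_zero_nat.mono_left h𝓤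
      refine squeeze_zero_norm (fun K => ?_) h3
      rw [emp_real _ _ hEc'.2.measurableSet, emp_real _ _ hEc.2.measurableSet, ← sub_div, ← Finset.sum_sub_distrib]
      have h4 := Finset.sum_range_sub (fun τ : ℕ => if sh ((τ:ℤ)+1) (x K) ∈ E then (1:ℝ) else 0) (n K)
      have h5 : ∀ τ : ℕ, sh ((τ:ℤ)+1) (x K) ∈ shift ⁻¹' E ↔ sh (((τ+1:ℕ):ℤ)+1) (x K) ∈ E := by
        intro τ
        rw [mem_preimage, ← sh_one, sh_sh]
        rw [show (1:ℤ) + (τ + 1) = ((τ+1:ℕ):ℤ)+1 by push_cast; ring]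
      simp only [h5]
      have h7 : ∀ s t r : ℝ, s = t → ‖t / (n K : ℝ)‖ ≤ r → ‖s / (n K : ℝ)‖ ≤ r := by rintro s t r rfl h; exact h
      refine h7 _ _ _ (Eq.trans ?_ h4) ?_
      · refine Finset.sum_congr rfl fun τ _ => ?_
        congr
      rw [norm_div, Real.norm_natCast]
      have h6 : ((K:ℝ) + 1) ≤ n K := by exact_mod_cast hn K
      refine div_le_div₀ zero_le_one ?_ (by positivity) h6
      split_ifs <;> simp
    have h3 := tendsto_nhds_unique h1 h2
    rw [← ENNReal.toReal_eq_toReal_iff' (measure_ne_top _ _) (measure_ne_top _ _)]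
    change (μ : Measure (ℤ → A)).real _ = (μ : Measure (ℤ → A)).real _
    linarith
  · have h1 := ProbabilityMeasure.limsup_measure_closed_le_of_tendsto hlim hX.1
    have h2 : ∀ K, ((u K : ProbabilityMeasure (ℤ → A)) : Measure (ℤ → A)) X = 1 := by
      intro K
      change emp (n K) (x K) X = 1
      rw [emp_apply _ _ hX.1.measurableSet]
      simp only [sh_mem_iff hX, hx K, if_true, Finset.sum_const, Finset.card_range, nsmul_eq_mul, mul_one]
      exact ENNReal.inv_mul_cancel (by simp; have := hn K; omega) (ENNReal.natCast_ne_top _)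
    simp only [h2, limsup_const] at h1
    rw [prob_compl_eq_zero_iff hX.1.measurableSet]
    exact le_antisymm prob_le_one h1
  · intro J
    refine ge_of_tendsto (hcl _ (hZc J)) (h𝓤 ?_)
    filter_upwards [eventually_ge_atTop J] with K hK
    have := hp K
    exact (h K).trans (measureReal_mono (hZ hK))

lemma lemA' {X : Set (ℤ → A)} (hX : IsSubshift X) (hne : X.Nonempty)
    {𝓑 : Set (List A)} {lam : ℝ} (hlam : 0 ≤ lam) (h0 : [] ∉ 𝓑)
    (hs : ∀ K, ∑ l ∈ Finset.range K, nw 𝓑 l * Real.exp (-lam * l) ≤ 1/2)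
    (hae : ∀ μ : Measure (ℤ → A), IsProbabilityMeasure μ → MeasurePreserving shift μ μ → μ Xᶜ = 0 →
      ∀ᵐ x ∂μ, ∃ l : ℕ, 1 ≤ l ∧ win x (-l) l ∈ 𝓑) : hTop X ≤ lam := by
  classical
  obtain ⟨Q, c, hc, hQ0, hQ1, hQ⟩ := exists_Q hlam h0 hs
  have key : ∀ ε : ℝ, 0 < ε → ∃ K n0 : ℕ, ∀ n, n0 ≤ n → ∀ x ∈ X, (∑ τ ∈ Finset.range n, if sh ((τ:ℤ)+1) x ∈ ZK 𝓑 K then (1:ℝ) else 0) ≤ ε * n := by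
    intro ε hε
    by_contra hcon
    push Not at hcon
    choose n hn x hx hh using fun K => hcon K (K+1)
    obtain ⟨μ, h1, h2, h3, h4⟩ := exists_limit hX hε (ZK 𝓑) (ZK_clopen 𝓑) (fun J K h => ZK_anti 𝓑 h) n hn x hx (fun K => by
      rw [emp_real _ _ (ZK_clopen 𝓑 K).2.measurableSet, le_div_iff₀ (by have := hn K; exact_mod_cast (by omega : 0 < n K))]
      exact (hh K).le)
    have h5 : μ (⋂ K, (ZK 𝓑 K : Set (ℤ → A))) = 0 := by
      refine measure_mono_null (fun x hx => ?_) (ae_iff.1 (hae μ h1 h2 h3))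
      simp only [mem_iInter, ZK, mem_ofPred_eq] at hx ⊢
      rintro ⟨l, hl, h⟩
      exact hx l l hl le_rfl h
    have h6 := tendsto_measure_iInter_atTop (μ := μ) (s := fun K => (ZK 𝓑 K : Set (ℤ → A))) (fun K => (ZK_clopen 𝓑 K).2.measurableSet.nullMeasurableSet)
      (fun J K h => ZK_anti 𝓑 h) ⟨0, measure_ne_top _ _⟩
    rw [h5] at h6
    have h7 := (ENNReal.tendsto_toReal ENNReal.zero_ne_top).comp h6
    have := ge_of_tendsto' h7 (fun K => h4 K)
    simp at this
    linarith
  refine le_of_forall_pos_le_add fun δ hδ => ?_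
  obtain ⟨K, n0, hK⟩ := key (δ / (c + 1)) (by positivity)
  have h1 : hTop X - (lam + δ) ≤ 0 := by
    refine lin_bound (b := c * K) n0 fun n hn => ?_
    have h2 : nw (LL X) n ≤ Real.exp (lam * n + c * (K + δ / (c+1) * n)) := by
      calc nw (LL X) n ≤ ∑ w ∈ words A n, Real.exp (lam * n + c * (K + δ / (c+1) * n)) * Q w := by
            refine Finset.sum_le_sum fun w hw => ?_
            rw [mem_words] at hw
            split_ifs with hwL
            · have h3 := (lang_iff hX n w).2 ⟨hw, hwL⟩
              obtain ⟨_, x, hx, hocc⟩ := h3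
              have h4 : w = win x 0 n := by
                apply List.ext_getElem (by simp [hw])
                intro i h5 h6
                rw [win_getElem]
                have := hocc ⟨i, h5⟩
                simpa using this.symm
              have h5 : Real.exp (-(lam * n + c * (K + δ / (c+1) * n))) ≤ Q w := by
                rw [h4]
                refine le_trans (Real.exp_le_exp.2 (neg_le_neg ?_)) (hQ x n K)
                gcongr
                convert hK n hn x hx
              calc (1:ℝ) = Real.exp (lam * n + c * (K + δ / (c+1) * n)) * Real.exp (-(lam * n + c * (K + δ / (c+1) * n))) := by
                    rw [← Real.exp_add]; simp
                _ ≤ _ := by gcongr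
            · exact mul_nonneg (Real.exp_pos _).le (hQ0 w)
        _ ≤ _ := by
          rw [← Finset.mul_sum]
          exact mul_le_of_le_one_right (Real.exp_pos _).le (hQ1 n)
    have h3 := (exp_le_nw hX hne n).trans h2
    rw [Real.exp_le_exp] at h3
    have h4 : c * (δ / (c+1)) ≤ δ := by
      rw [mul_div_assoc', div_le_iff₀ (by positivity)]; nlinarith
    have h5 : (0:ℝ) ≤ n := by positivity
    nlinarith
  linarith

end lemA2
end QFTPaper

namespace QFTPaper

section part2a
variable {A : Type}

lemma wordOf_win (x : ℤ → A) (m : ℕ) : wordOf (fun j : ℕ => x (-1 - j)) m = win x (-((m+1:ℕ):ℤ)) (m+1) := by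
  apply List.ext_getElem (by simp [wordOf])
  intro i h1 h2
  rw [win_getElem]
  simp only [wordOf, List.getElem_map, List.getElem_range]
  rw [win_length] at h2
  congr 1; push_cast [Nat.cast_sub (show i ≤ m by omega)]; ring

variable [Fintype A] [TopologicalSpace A]

lemma bad_elc {X : Set (ℤ → A)} (hX : IsSubshift X) {x : ℤ → A} (hx : x ∈ X) (h : ¬ ∃ S, Est X x 0 S) (N : ℕ) :
    ∃ l : ℕ, N < l ∧ IsExtendable X (win x (-l) l) := by
  have key : ∀ N : ℕ, ∃ m, N ≤ m ∧ 1 ≤ m ∧ LC' X (win x (-((m+1:ℕ):ℤ)) (m+1)) := by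
    intro N
    by_contra hc
    push Not at hc
    apply h
    refine ⟨F X (win x (-((N+1:ℕ):ℤ)) (N+1)), N+1, fun m hm => ?_⟩
    obtain ⟨k, rfl⟩ : ∃ k, m = N + 1 + k := ⟨m - (N+1), by omega⟩
    rw [zero_sub]
    induction k with
    | zero => rfl
    | succ k ih =>
      rw [← ih (by omega)]
      by_contra hne
      apply hc (N + 1 + k) (by omega) (by omega)
      have e : win x (-((N+1+k+1:ℕ):ℤ)) (N+1+k+1) = x (-((N+1+k+1:ℕ):ℤ)) :: win x (-((N+1+k:ℕ):ℤ)) (N+1+k) := by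
        rw [win_succ]; congr 2; push_cast; ring
      refine ⟨by rw [e]; simp, F_win_ne hX hx _ _, ?_⟩
      intro h'; apply hne
      rw [← add_assoc, h', e]; rfl
  have key2 : ∀ m, 1 ≤ m → LC' X (win x (-((m+1:ℕ):ℤ)) (m+1)) → IsLeftConstraint X (win x (-((m+1:ℕ):ℤ)) (m+1)) := by
    intro m hm h
    exact (isLC_iff hX _ (by rw [win_length]; omega)).2 h
  obtain ⟨m, h1, h2, h3⟩ := key N
  refine ⟨m+1, by omega, key2 m h2 h3, fun j => x (-1 - j), ?_, fun N' => ?_⟩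
  · rw [win_length, Nat.add_sub_cancel, wordOf_win]
  · obtain ⟨m', g1, g2, g3⟩ := key N'
    exact ⟨m', g1, by rw [wordOf_win]; exact key2 m' g2 g3⟩

lemma perCount_div_le {X : Set (ℤ → A)} (hX : IsSubshift X) (n : ℕ) :
    Real.log (perCount X n) / n ≤ Real.log (Fintype.card A) := by
  rcases Nat.eq_zero_or_pos n with rfl | hn
  · simp; exact Real.log_natCast_nonneg _
  · exact log_nw_div_le _ n (Nat.cast_nonneg _) ((perCount_le_LL hX hn).trans (nw_le _ n))

lemma limsup_per_le {X : Set (ℤ → A)} (hX : IsSubshift X) :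
    limsup (fun n : ℕ => Real.log (perCount X n) / (n : ℝ)) atTop ≤ hTop X := by
  rw [hTop_eq hX]
  refine limsup_le_limsup ?_ ?_ ?_
  · filter_upwards [eventually_ge_atTop 1] with n hn
    rcases Nat.eq_zero_or_pos (perCount X n) with h | h
    · rw [h]; simp
      rcases (nw_nonneg (LL X) n).eq_or_lt with h' | h'
      · rw [← h']; simp
      · rw [← card_eq_nw]
        exact div_nonneg (Real.log_natCast_nonneg _) (by positivity)
    · have := perCount_le_LL hX hn
      gcongr
  · exact IsBoundedUnder.isCoboundedUnder_le (isBoundedUnder_of ⟨0, fun n => div_nonneg (Real.log_natCast_nonneg _) (by positivity)⟩)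
  · exact isBoundedUnder_of ⟨Real.log (Fintype.card A), fun n => log_nw_div_le _ n (nw_nonneg _ n) (nw_le _ n)⟩

variable [DiscreteTopology A] [MeasurableSpace A] [BorelSpace A]

lemma meas_Est (X : Set (ℤ → A)) (i : ℤ) (S : Set (ℕ → A)) : MeasurableSet {x : ℤ → A | Est X x i S} := by
  have : {x : ℤ → A | Est X x i S} = ⋃ M : ℕ, ⋂ m : ℕ, ⋂ _ : M ≤ m, {x | win x (i - m) m ∈ {w | F X w = S}} := by
    ext x; simp [Est]
  rw [this]
  exact MeasurableSet.iUnion fun M => MeasurableSet.iInter fun m => MeasurableSet.iInter fun _ => meas_win _ _ _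

lemma Est_sh {X : Set (ℤ → A)} {x : ℤ → A} {k i : ℤ} {S : Set (ℕ → A)} : Est X (sh k x) i S ↔ Est X x (i + k) S := by
  simp only [Est, win_sh]
  have : ∀ m : ℕ, i - m + k = i + k - m := fun m => by ring
  simp only [this]

lemma sh_iter (k : ℤ) (n : ℕ) : ∀ x : ℤ → A, (sh k)^[n] x = sh (n * k) x := by
  induction n with
  | zero => intro x; simp [sh_zero]
  | succ n ih =>
    intro x
    rw [Function.iterate_succ_apply, ih, sh_sh]; congr 1; push_cast; ring

lemma est_rec {X : Set (ℤ → A)} {μ : Measure (ℤ → A)} [IsProbabilityMeasure μ] (hμ : MeasurePreserving shift μ μ) (S : Set (ℕ → A)) :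
    ∀ᵐ x ∂μ, Est X x 0 S → ∀ N : ℕ, ∃ l : ℕ, N < l ∧ run S (win x (-l) l) = S := by
  have h1 := (sh_mp hμ (-1)).conservative.ae_mem_imp_frequently_image_mem (meas_Est X 0 S).nullMeasurableSet
  filter_upwards [h1] with x hx hS N
  obtain ⟨n, hn, hn2⟩ := (frequently_atTop.1 (hx hS)) (N+1)
  refine ⟨n, by omega, ?_⟩
  rw [sh_iter] at hn2
  have hn2 : Est X (sh (n * (-1)) x) 0 S := hn2
  rw [Est_sh] at hn2
  have := Est_run hn2 n
  have e : (0 + (n:ℤ) * (-1) + n) = 0 := by ring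
  rw [e] at this
  have := Est_unique this hS
  rw [← this]
  congr 2
  · ring
  
lemma part2a {X : Set (ℤ → A)} (hX : IsSubshift X) (h : hCstar X < hTop X) :
    limsup (fun n : ℕ => Real.log (perCount X n) / (n : ℝ)) atTop = hTop X := by
  refine le_antisymm (limsup_per_le hX) ?_
  by_contra hc
  push Not at hc
  have h0 := hCstar_nonneg X
  have hne := nonempty_of_hTop hX (h0.trans_lt h)
  obtain ⟨t, ht1, ht2⟩ := exists_between (max_lt h hc)
  obtain ⟨lam, hl1, hl2⟩ := exists_between ht2
  rw [max_lt_iff] at ht1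
  obtain ⟨C, hC, hCb⟩ := ELC_bound ht1.1
  obtain ⟨C', hC', hCb'⟩ := exp_bound_of_limsup (fun n => Nat.cast_nonneg (perCount X n)) _ (perCount_div_le hX) (fun n _ _ => le_rfl) ht1.2
  obtain ⟨f, hf⟩ := exists_surjective_nat (List A)
  let P : ℕ → Set (List A) := fun k => {g | g ≠ [] ∧ F X (f k) ≠ ∅ ∧ run (F X (f k)) g = F X (f k)}
  have hP : ∀ k n, nw (P k) n ≤ C' * Real.exp (t * n) := by
    intro k n
    rcases Nat.eq_zero_or_pos n with rfl | hn
    · refine le_trans (le_of_eq ?_) (by positivity : (0:ℝ) ≤ _)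
      rw [nw, words_zero, Finset.sum_singleton, if_neg]
      rintro ⟨h, _⟩; exact h rfl
    · refine le_trans ?_ (hCb' n)
      by_cases hk : F X (f k) = ∅
      · refine le_trans (le_of_eq ?_) (Nat.cast_nonneg _)
        rw [nw]; refine Finset.sum_eq_zero fun w _ => if_neg ?_
        rintro ⟨_, h, _⟩; exact h hk
      · refine le_trans ?_ (nl_le_perCount hX (f k) hk hn)
        rw [nl_eq_nw]
        exact nw_mono (fun g hg => hg.2.2) n
  obtain ⟨N, hN⟩ := weight_tail hCb hl1 (show (0:ℝ) < 1/4 by norm_num)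
  choose M hM using fun k : ℕ => weight_tail (hP k) hl1 (show (0:ℝ) < 1/4 * (1/2)^(k+1) by positivity)
  let P' : ℕ → Set (List A) := fun k => {g | g ∈ P k ∧ max (M k) k < g.length}
  let E : Set (List A) := {w | w ∈ {w | IsExtendable X w} ∧ N < w.length}
  have hfin : hTop X ≤ lam := by
    refine lemA' hX hne (𝓑 := {g | g ∈ E ∨ g ∈ {g | ∃ k, g ∈ P' k}}) (h0.trans (ht1.1.trans hl1).le) ?_ ?_ ?_
    · rintro (h | ⟨k, h⟩)
      · have := h.2; simp at this
      · have := h.2; simp at this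
    · intro K
      have hle : ∀ l ∈ Finset.range K, nw {g | g ∈ E ∨ g ∈ {g | ∃ k, g ∈ P' k}} l * Real.exp (-lam * l) ≤
          nw E l * Real.exp (-lam * l) + ∑ k ∈ Finset.range K, nw (P' k) l * Real.exp (-lam * l) := by
        intro l hl
        rw [Finset.mem_range] at hl
        rw [← Finset.sum_mul, ← add_mul]
        refine mul_le_mul_of_nonneg_right ?_ (Real.exp_pos _).le
        refine (nw_or_le _ _ l).trans (add_le_add le_rfl ?_)
        refine le_trans (nw_mono' l ?_) (nw_iUnion_le (Finset.range K) P' l)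
        rintro g ⟨k, hk⟩ hg
        refine ⟨k, ?_, hk⟩
        have h2 : max (M k) k < g.length := hk.2
        rw [Finset.mem_range]
        have := le_max_right (M k) k
        omega
      refine (Finset.sum_le_sum hle).trans ?_
      rw [Finset.sum_add_distrib, Finset.sum_comm]
      have h1 := hN N le_rfl K
      have h2 : ∑ k ∈ Finset.range K, ∑ l ∈ Finset.range K, nw (P' k) l * Real.exp (-lam * l) ≤ ∑ k ∈ Finset.range K, 1/4 * (1/2 : ℝ)^(k+1) :=
        Finset.sum_le_sum fun k _ => hM k _ (le_max_left _ _) K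
      have h3 : ∀ K : ℕ, ∑ k ∈ Finset.range K, 1/4 * (1/2 : ℝ)^(k+1) ≤ 1/4 - 1/4 * (1/2)^K := by
        intro K
        induction K with
        | zero => simp
        | succ K ih => rw [Finset.sum_range_succ, pow_succ]; linarith
      have h4 := h3 K
      have h5 : (0:ℝ) ≤ 1/4 * (1/2)^K := by positivity
      linarith
    · intro μ _ hμ hμX
      have h1 : ∀ᵐ x ∂μ, x ∈ X := by
        rw [ae_iff]; exact hμX
      have h2 : ∀ᵐ x ∂μ, ∀ k : ℕ, Est X x 0 (F X (f k)) → ∀ N : ℕ, ∃ l : ℕ, N < l ∧ run (F X (f k)) (win x (-l) l) = F X (f k) :=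
        ae_all_iff.2 fun k => est_rec hμ _
      filter_upwards [h1, h2] with x hx hx2
      by_cases hE : ∃ S, Est X x 0 S
      · obtain ⟨S, hS⟩ := hE
        obtain ⟨m, hm⟩ := hS
        obtain ⟨k, hk⟩ := hf (win x (0 - m) m)
        have hS' : F X (f k) = S := by rw [hk]; exact hm m le_rfl
        have hE : Est X x 0 (F X (f k)) := by rw [hS']; exact ⟨m, hm⟩
        obtain ⟨l, hl, hl'⟩ := hx2 k hE (max (M k) k)
        refine ⟨l, by omega, Or.inr ⟨k, ⟨?_, Est_ne hX hx hE, hl'⟩, ?_⟩⟩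
        · intro h
          have := congrArg List.length h
          rw [win_length] at this
          simp at this; omega
        · rw [win_length]; exact hl
      · obtain ⟨l, hl, hl'⟩ := bad_elc hX hx hE N
        refine ⟨l, by omega, Or.inl ⟨hl', ?_⟩⟩
        rw [win_length]; exact hl
  linarith

end part2a
end QFTPaper

namespace QFTPaper

section rho
variable {A : Type} [Fintype A] 

lemma nl_run_le (S u : Set (ℕ → A)) (d : List A) (n : ℕ) : nl (run S d) u n ≤ nl S u (d.length + n) := by
  refine le_trans ?_ (nl_mul_le S (run S d) u d.length n)
  refine le_mul_of_one_le_left (nl_nonneg _ _ _) ?_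
  rw [nl]
  classical
  have := Finset.single_le_sum (f := fun w : List A => if run S w = run S d then (1:ℝ) else 0)
    (fun w _ => by split_ifs <;> norm_num) (show d ∈ words A d.length by simp)
  simp only [if_true] at this
  convert this

lemma nl_succ (v u : Set (ℕ → A)) (n : ℕ) : nl v u (n+1) = ∑ a : A, nl (step v a) u n := by
  rw [nl, sum_words_succ]; rfl

/-- Green function -/
noncomputable def Gr (S : Set (ℕ → A)) (lam : ℝ) (v : Set (ℕ → A)) : ℝ := ∑' n : ℕ, nl v S n * Real.exp (-lam * n)

lemma Gr_summable {S : Set (ℕ → A)} {h lam : ℝ} (hS : ∀ n, nl S S n ≤ Real.exp (h * n)) (hl : h < lam) (d : List A) :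
    Summable (fun n : ℕ => nl (run S d) S n * Real.exp (-lam * n)) := by
  have h1 : Summable (fun n : ℕ => Real.exp (h * d.length) * Real.exp (h - lam) ^ n) :=
    (summable_geometric_of_lt_one (Real.exp_pos _).le (by rw [Real.exp_lt_one_iff]; linarith)).mul_left _
  refine Summable.of_nonneg_of_le (fun n => mul_nonneg (nl_nonneg _ _ _) (Real.exp_pos _).le) (fun n => ?_) h1
  have h2 := (nl_run_le S S d n).trans (hS _)
  calc _ ≤ Real.exp (h * ((d.length + n : ℕ) : ℝ)) * Real.exp (-lam * n) := mul_le_mul_of_nonneg_right h2 (Real.exp_pos _).le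
    _ = _ := by
      rw [← Real.exp_nat_mul, ← Real.exp_add, ← Real.exp_add]; congr 1; push_cast; ring

lemma Gr_nonneg (S : Set (ℕ → A)) (lam : ℝ) (v : Set (ℕ → A)) : 0 ≤ Gr S lam v :=
  tsum_nonneg fun n => mul_nonneg (nl_nonneg _ _ _) (Real.exp_pos _).le

lemma Gr_super {S : Set (ℕ → A)} {h lam : ℝ} (hS : ∀ n, nl S S n ≤ Real.exp (h * n)) (hl : h < lam) (d : List A) :
    ∑ a : A, Gr S lam (run S (d ++ [a])) ≤ Real.exp lam * Gr S lam (run S d) := by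
  have h1 : Gr S lam (run S d) = nl (run S d) S 0 + Real.exp (-lam) * ∑ a : A, Gr S lam (run S (d ++ [a])) := by
    rw [Gr, (Gr_summable hS hl d).tsum_eq_zero_add]
    congr 1
    · simp
    · simp only [Gr]
      rw [← Summable.tsum_finsetSum (fun a _ => Gr_summable hS hl _), ← tsum_mul_left]
      congr 1; funext n
      rw [nl_succ, ← Finset.sum_mul]
      simp only [run_append, run_cons, run_nil]
      rw [mul_left_comm, ← Real.exp_add]; congr 2; push_cast; ring
  have h2 := nl_nonneg (run S d) S 0
  rw [h1, mul_add, ← mul_assoc, ← Real.exp_add]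
  simp
  positivity

lemma Gr_one {S : Set (ℕ → A)} {h lam : ℝ} (hS : ∀ n, nl S S n ≤ Real.exp (h * n)) (hl : h < lam) : 1 ≤ Gr S lam S := by
  have h1 := (Gr_summable hS hl ([] : List A)).le_tsum 0 (fun n _ => mul_nonneg (nl_nonneg _ _ _) (Real.exp_pos _).le)
  refine le_trans (le_of_eq ?_) h1
  simp [nl, words_zero]

lemma Gr_le {S : Set (ℕ → A)} {h lam : ℝ} (hS : ∀ n, nl S S n ≤ Real.exp (h * n)) (hl : h < lam) (d : List A) :
    Gr S lam (run S d) ≤ Real.exp lam ^ d.length * Gr S lam S := by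
  induction d using List.reverseRecOn with
  | nil => simp
  | append_singleton d a ih =>
    have h1 := Finset.single_le_sum (f := fun a => Gr S lam (run S (d ++ [a]))) (fun a _ => Gr_nonneg _ _ _) (Finset.mem_univ a)
    have h2 := Gr_super hS hl d
    have h3 : Real.exp lam * Gr S lam (run S d) ≤ Real.exp lam * (Real.exp lam ^ d.length * Gr S lam S) := by gcongr
    simp only [List.length_append, List.length_singleton, pow_succ']
    rw [mul_assoc]
    exact h1.trans (h2.trans h3)

lemma rho_exists {S : Set (ℕ → A)} {h : ℝ} (hS : ∀ n, nl S S n ≤ Real.exp (h * n)) :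
    ∃ ρ : Set (ℕ → A) → ℝ, ρ S = 1 ∧ (∀ d, 0 ≤ ρ (run S d)) ∧ ∀ d : List A, ∑ a : A, ρ (run S (d ++ [a])) ≤ Real.exp h * ρ (run S d) := by
  let U : Ultrafilter ℕ := Ultrafilter.of atTop
  have hU : (U : Filter ℕ) ≤ atTop := Ultrafilter.of_le _
  let lam : ℕ → ℝ := fun k => h + 1/((k:ℝ)+1)
  have hlam : ∀ k, h < lam k := fun k => by
    have : (0:ℝ) < 1/((k:ℝ)+1) := by positivity
    simp only [lam]; linarith
  have hlam1 : ∀ k, lam k ≤ h + 1 := fun k => by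
    have : 1/((k:ℝ)+1) ≤ 1 := by rw [div_le_one (by positivity)]; have : (0:ℝ) ≤ k := by positivity
                                 linarith
    simp only [lam]; linarith
  have hlamt : Tendsto lam U (nhds h) := by
    have := (tendsto_one_div_add_atTop_nhds_zero_nat (𝕜 := ℝ)).const_add h
    rw [add_zero] at this
    exact this.mono_left hU
  have hex : ∀ v, ∃ l, (∃ d, v = run S d) → Tendsto (fun k => Gr S (lam k) v / Gr S (lam k) S) U (nhds l) := by
    intro v
    by_cases hv : ∃ d, v = run S d
    · obtain ⟨d, rfl⟩ := hv
      have hmem : ∀ k, Gr S (lam k) (run S d) / Gr S (lam k) S ∈ Icc 0 (Real.exp (h+1) ^ d.length) := by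
        intro k
        have h1 := Gr_one hS (hlam k)
        refine ⟨div_nonneg (Gr_nonneg _ _ _) (Gr_nonneg _ _ _), ?_⟩
        rw [div_le_iff₀ (by linarith)]
        refine (Gr_le hS (hlam k) d).trans ?_
        have := hlam1 k
        gcongr
      obtain ⟨l, _, hl⟩ := (isCompact_Icc (a := (0:ℝ)) (b := Real.exp (h+1) ^ d.length)).ultrafilter_le_nhds'
        (U.map fun k => Gr S (lam k) (run S d) / Gr S (lam k) S) (by
          rw [Ultrafilter.mem_map]; exact Filter.univ_mem' hmem)
      exact ⟨l, fun _ => hl⟩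
    · exact ⟨0, fun h => absurd h hv⟩
  choose ρ hρ using hex
  refine ⟨ρ, ?_, fun d => ?_, fun d => ?_⟩
  · refine tendsto_nhds_unique (hρ S ⟨[], rfl⟩) ?_
    refine tendsto_const_nhds.congr fun k => ?_
    have h1 := Gr_one hS (hlam k)
    rw [div_self]; linarith
  · exact ge_of_tendsto' (hρ _ ⟨d, rfl⟩) fun k => div_nonneg (Gr_nonneg _ _ _) (Gr_nonneg _ _ _)
  · refine le_of_tendsto_of_tendsto' (tendsto_finset_sum _ fun a _ => hρ _ ⟨d ++ [a], rfl⟩)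
      (((Real.continuous_exp.tendsto h).comp hlamt).mul (hρ _ ⟨d, rfl⟩)) fun k => ?_
    have h1 := Gr_super hS (hlam k) d
    rw [← Finset.sum_div, Function.comp, ← mul_div_assoc]
    have h2 := Gr_nonneg S (lam k) S
    gcongr

/-- sequential product weights -/
def Wt (p : List A → A → ℝ) : List A → List A → ℝ
  | _, [] => 1
  | u, a :: w => p u a * Wt p (u ++ [a]) w

lemma Wt_nonneg {p : List A → A → ℝ} (hp : ∀ u a, 0 ≤ p u a) : ∀ w u, 0 ≤ Wt p u w := by
  intro w
  induction w with
  | nil => intro u; simp [Wt]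
  | cons a w ih => intro u; exact mul_nonneg (hp u a) (ih _)

lemma Wt_sum {p : List A → A → ℝ} (hp : ∀ u a, 0 ≤ p u a) (hp1 : ∀ u, ∑ a, p u a ≤ 1) (n : ℕ) :
    ∀ u, ∑ w ∈ words A n, Wt p u w ≤ 1 := by
  induction n with
  | zero => intro u; rw [words_zero, Finset.sum_singleton]; simp [Wt]
  | succ n ih =>
    intro u
    rw [sum_words_succ]
    simp only [Wt]
    simp_rw [← Finset.mul_sum]
    refine le_trans (Finset.sum_le_sum fun a _ => mul_le_of_le_one_right (hp u a) (ih _)) (hp1 u)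

lemma Wt_eq {S : Set (ℕ → A)} {h : ℝ} {ρ : Set (ℕ → A) → ℝ} (h0 : ∀ d, 0 ≤ ρ (run S d))
    (h1 : ∀ d : List A, ∑ a : A, ρ (run S (d ++ [a])) ≤ Real.exp h * ρ (run S d)) (τ : List A → A → ℝ) :
    ∀ w u, 0 < ρ (run S (u ++ w)) →
    0 < ρ (run S u) ∧ Wt (fun u a => Real.exp (-h) * ρ (run S (u ++ [a])) / ρ (run S u) * τ u a) u w =
      Real.exp (-h * w.length) * (ρ (run S (u ++ w)) / ρ (run S u)) * Wt τ u w := by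
  intro w
  induction w with
  | nil => intro u hu; rw [List.append_nil] at hu ⊢; refine ⟨hu, ?_⟩; simp [Wt]; rw [div_self hu.ne']
  | cons a w ih =>
    intro u hu
    have e : u ++ a :: w = (u ++ [a]) ++ w := by simp
    rw [e] at hu ⊢
    obtain ⟨g1, g2⟩ := ih _ hu
    have hpos : 0 < ρ (run S u) := by
      have h3 := Finset.single_le_sum (f := fun a => ρ (run S (u ++ [a]))) (fun a _ => h0 _) (Finset.mem_univ a)
      have h4 := g1.trans_le (h3.trans (h1 u))
      exact (pos_iff_pos_of_mul_pos h4).1 (Real.exp_pos _)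
    refine ⟨hpos, ?_⟩
    rw [Wt, g2, Wt]
    have : Real.exp (-h * (a :: w).length) = Real.exp (-h) * Real.exp (-h * w.length) := by
      rw [← Real.exp_add]; congr 1; push_cast [List.length_cons]; ring
    rw [this]
    field_simp

end rho
end QFTPaper

namespace QFTPaper

section code
variable {A : Type} 

lemma Wt_win (τ : List A → A → ℝ) (x : ℤ → A) (i : ℤ) (n : ℕ) : ∀ m : ℕ,
    Wt τ (win x i m) (win x (i+m) n) = ∏ k ∈ Finset.range n, τ (win x i (m+k)) (x (i+m+k)) := by
  induction n with
  | zero => intro m; simp [Wt]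
  | succ n ih =>
    intro m
    rw [win_succ, Wt, ← win_succ', Finset.prod_range_succ']
    have := ih (m+1)
    rw [show i + ((m+1:ℕ):ℤ) = i + m + 1 by push_cast; ring] at this
    rw [this, mul_comm]
    congr 1
    · refine Finset.prod_congr rfl fun k _ => ?_
      rw [show m + 1 + k = m + (k+1) by ring]
      congr 2; push_cast; ring
    · simp

variable [Fintype A]

lemma sum_mid (g : List A → ℝ) (hg : ∀ n, ∑ w ∈ words A n, g w ≤ 1) (i m i' : ℕ) :
    ∑ w ∈ words A (i + (m + i')), g ((w.drop i).take m) ≤ (Fintype.card A : ℝ)^i * (Fintype.card A : ℝ)^i' := by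
  rw [sum_words_add]
  have h1 : ∀ u ∈ words A i, ∑ v ∈ words A (m+i'), g (((u ++ v).drop i).take m) ≤ (Fintype.card A : ℝ)^i' := by
    intro u hu
    rw [mem_words] at hu
    rw [sum_words_add, Finset.sum_comm]
    have h2 : ∀ z ∈ words A i', ∑ v ∈ words A m, g (((u ++ (v ++ z)).drop i).take m) ≤ 1 := by
      intro z _
      refine le_trans (le_of_eq (Finset.sum_congr rfl fun v hv => ?_)) (hg m)
      rw [mem_words] at hv
      rw [List.drop_left' hu, List.take_left' hv]
    refine (Finset.sum_le_sum h2).trans ?_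
    simp [card_words]
  refine (Finset.sum_le_sum h1).trans ?_
  simp [card_words]

variable [TopologicalSpace A]

lemma code_bound {X : Set (ℤ → A)} {S : Set (ℕ → A)} {h : ℝ} (hh : 0 ≤ h) {ρ : Set (ℕ → A) → ℝ} (hρ : ρ S = 1) (h0 : ∀ d, 0 ≤ ρ (run S d))
    (h1 : ∀ d : List A, ∑ a : A, ρ (run S (d ++ [a])) ≤ Real.exp h * ρ (run S d)) (τ : List A → A → ℝ)
    (hτ0 : ∀ u a, 0 < τ u a)
    (hp1 : ∀ u, ∑ a, Real.exp (-h) * ρ (run S (u ++ [a])) / ρ (run S u) * τ u a ≤ 1)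
    (ψ : (ℤ → A) → ℝ) (Ψ : ℝ) (hΨ : ∀ y, |ψ y| ≤ Ψ) (hτΨ : ∀ u a, |Real.log (τ u a)| ≤ Ψ) (D : ℕ)
    (hψ : ∀ (x : ℤ → A) (i : ℤ) (k : ℕ), D ≤ k → Est X x i S → Real.log (τ (win x i k) (x (i+k))) = ψ (sh (i+k) x))
    (K n : ℕ) (hn : 2 * K ≤ n) : ∃ Q : List A → ℝ, (∀ w, 0 ≤ Q w) ∧ ∑ w ∈ words A n, Q w ≤ 1 ∧
      (∀ x : ℤ → A, Real.exp (-(Real.log ((K+1)^2+1) + n * Real.log (Fintype.card A))) ≤ Q (win x 0 n)) ∧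
      ∀ (x : ℤ → A) (i i' : ℕ), i ≤ K → i' ≤ K → Est X x i S → Est X x (n - i') S →
        Real.exp (-(Real.log ((K+1)^2+1) + 2 * K * Real.log (Fintype.card A) + (2*K+2*D)*Ψ + h * n - ∑ m ∈ Finset.range n, ψ (sh m x)))
          ≤ Q (win x 0 n) := by
  set c : ℝ := (Fintype.card A : ℝ) with hc
  set p : List A → A → ℝ := fun u a => Real.exp (-h) * ρ (run S (u ++ [a])) / ρ (run S u) * τ u a with hp
  have hp0 : ∀ u a, 0 ≤ p u a := fun u a => by
    have := h0 u
    have := h0 (u ++ [a])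
    have := (hτ0 u a).le
    simp only [hp]; positivity
  set M : ℝ := ((K:ℝ)+1)^2+1 with hM
  have hMpos : 0 < M := by positivity
  have hexpM : Real.exp (-Real.log M) = M⁻¹ := by rw [Real.exp_neg, Real.exp_log hMpos]
  let q : ℕ → ℕ → List A → ℝ := fun i i' w => (c^i * c^i')⁻¹ * Wt p [] ((w.drop i).take (n - i - i'))
  have hc0 : 0 ≤ c := by positivity
  have hq0 : ∀ i i' w, 0 ≤ q i i' w := fun i i' w => mul_nonneg (by positivity) (Wt_nonneg hp0 _ _)
  have hW := fun m => Wt_sum hp0 hp1 m []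
  refine ⟨fun w => M⁻¹ * ((c^n)⁻¹ + ∑ i ∈ Finset.range (K+1), ∑ i' ∈ Finset.range (K+1), q i i' w), ?_, ?_, ?_, ?_⟩
  · intro w
    have := Finset.sum_nonneg fun i (_ : i ∈ Finset.range (K+1)) => Finset.sum_nonneg fun i' (_ : i' ∈ Finset.range (K+1)) => hq0 i i' w
    positivity
  · rw [← Finset.mul_sum, Finset.sum_add_distrib, Finset.sum_comm]
    have e1 : ∑ w ∈ words A n, (c^n)⁻¹ ≤ 1 := by
      rw [Finset.sum_const, card_words, nsmul_eq_mul, mul_comm]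
      push_cast; exact inv_mul_le_one
    have e2 : ∀ i ∈ Finset.range (K+1), ∑ w ∈ words A n, ∑ i' ∈ Finset.range (K+1), q i i' w ≤ (K+1:ℝ) := by
      intro i hi
      rw [Finset.sum_comm]
      have e3 : ∀ i' ∈ Finset.range (K+1), ∑ w ∈ words A n, q i i' w ≤ (1:ℝ) := by
        intro i' hi'
        rw [Finset.mem_range] at hi hi'
        simp only [q]
        rw [← Finset.mul_sum]
        have := sum_mid _ hW i (n - i - i') i'
        rw [show i + (n - i - i' + i') = n by omega] at this
        refine (mul_le_mul_of_nonneg_left this (by positivity)).trans inv_mul_le_one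
      refine (Finset.sum_le_sum e3).trans ?_
      simp
    have e4 := Finset.sum_le_sum e2
    simp only [Finset.sum_const, Finset.card_range, nsmul_eq_mul] at e4
    rw [inv_mul_le_iff₀ hMpos, hM]
    push_cast at e4
    nlinarith
  · intro x
    haveI : Nonempty A := ⟨x 0⟩
    have hcp : 0 < c := by rw [hc]; exact_mod_cast Fintype.card_pos
    rw [neg_add, Real.exp_add, hexpM]
    refine mul_le_mul_of_nonneg_left ?_ (by positivity)
    have : Real.exp (-(n * Real.log c)) = (c^n)⁻¹ := by
      rw [Real.exp_neg, Real.exp_nat_mul, Real.exp_log hcp]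
    rw [this]
    have := Finset.sum_nonneg fun i (_ : i ∈ Finset.range (K+1)) => Finset.sum_nonneg fun i' (_ : i' ∈ Finset.range (K+1)) => hq0 i i' (win x 0 n)
    linarith
  · intro x i i' hi hi' hEi hEi'
    haveI : Nonempty A := ⟨x 0⟩
    have hcp : 0 < c := by rw [hc]; exact_mod_cast Fintype.card_pos
    have hL : 0 ≤ Real.log c := by rw [hc]; exact Real.log_natCast_nonneg _
    obtain ⟨m, hm⟩ : ∃ m, n = i + (m + i') := ⟨n - i - i', by omega⟩
    have hΨ0 : 0 ≤ Ψ := (abs_nonneg _).trans (hΨ x)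
    have hrun : run S (win x i m) = S := by
      have g := Est_run hEi m
      have e : ((i:ℤ) + m) = n - i' := by rw [hm]; push_cast; ring
      rw [e] at g
      exact Est_unique g hEi'
    have hwin : ((win x 0 n).drop i).take (n - i - i') = win x i m := by
      rw [hm, show i + (m + i') - i - i' = m by omega, win_add, List.drop_left' (by simp), zero_add, win_add, List.take_left' (by simp)]
    have hWt : Wt p [] (win x i m) = Real.exp (-h * m) * Wt τ [] (win x i m) := by
      have g := (Wt_eq (h := h) h0 h1 τ (win x i m) [] (by rw [List.nil_append, hrun, hρ]; norm_num)).2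
      rw [List.nil_append, hrun, run_nil, hρ, win_length] at g
      rw [g]; simp
    have hprod : Wt τ [] (win x i m) = Real.exp (∑ k ∈ Finset.range m, Real.log (τ (win x i k) (x (i+k)))) := by
      have g := Wt_win τ x i m 0
      simp only [win_zero, Nat.cast_zero, add_zero, zero_add] at g
      rw [g, Real.exp_sum]
      exact Finset.prod_congr rfl fun k _ => (Real.exp_log (hτ0 _ _)).symm
    have hsum : ∑ k ∈ Finset.range n, ψ (sh k x) ≤ ∑ k ∈ Finset.range m, Real.log (τ (win x i k) (x (i+k))) + (2*K+2*D)*Ψ := by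
      have hb : ∀ y, ψ y ≤ Ψ := fun y => (le_abs_self _).trans (hΨ y)
      have hb2 : ∀ u a, -Ψ ≤ Real.log (τ u a) := fun u a => (abs_le.1 (hτΨ u a)).1
      rw [hm, Finset.sum_range_add, Finset.sum_range_add]
      have s1 : ∑ k ∈ Finset.range i, ψ (sh k x) ≤ K * Ψ := by
        refine (Finset.sum_le_sum fun k _ => hb _).trans ?_
        rw [Finset.sum_const, Finset.card_range, nsmul_eq_mul]
        gcongr
      have s3 : ∑ k ∈ Finset.range i', ψ (sh ((i + (m + k) : ℕ):ℤ) x) ≤ K * Ψ := by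
        refine (Finset.sum_le_sum fun k _ => hb _).trans ?_
        rw [Finset.sum_const, Finset.card_range, nsmul_eq_mul]
        gcongr
      have s2 : ∑ k ∈ Finset.range m, ψ (sh ((i + k : ℕ):ℤ) x) ≤ ∑ k ∈ Finset.range m, Real.log (τ (win x i k) (x (i+k))) + 2*D*Ψ := by
        have s4 : ∀ k ∈ Finset.range m, ψ (sh ((i + k : ℕ):ℤ) x) ≤ Real.log (τ (win x i k) (x (i+k))) + if k < D then 2 * Ψ else 0 := by
          intro k _
          split_ifs with hk
          · have := hb (sh ((i + k : ℕ):ℤ) x)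
            have := hb2 (win x i k) (x (i+k))
            linarith
          · rw [hψ x i k (by omega) hEi]; push_cast; linarith
        refine (Finset.sum_le_sum s4).trans ?_
        rw [Finset.sum_add_distrib]
        gcongr
        rw [← Finset.sum_filter, Finset.sum_const, nsmul_eq_mul]
        have : (Finset.filter (fun k => k < D) (Finset.range m)).card ≤ D := by
          calc _ ≤ (Finset.range D).card := Finset.card_le_card fun k hk => by
                    simp at hk ⊢; exact hk.2
            _ = D := Finset.card_range D
        have : ((Finset.filter (fun k => k < D) (Finset.range m)).card : ℝ) ≤ D := by exact_mod_cast this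
        nlinarith
      linarith
    have hq : Real.exp (-((i + i' : ℕ) * Real.log c)) * (Real.exp (-h * m) * Real.exp (∑ k ∈ Finset.range m, Real.log (τ (win x i k) (x (i+k))))) = q i i' (win x 0 n) := by
      simp only [q]
      rw [hwin, hWt, hprod]
      congr 1
      rw [Real.exp_neg, Real.exp_nat_mul, Real.exp_log hcp, pow_add]
    have hle : q i i' (win x 0 n) ≤ (c^n)⁻¹ + ∑ i ∈ Finset.range (K+1), ∑ i' ∈ Finset.range (K+1), q i i' (win x 0 n) := by
      have t1 := Finset.single_le_sum (f := fun i => ∑ i' ∈ Finset.range (K+1), q i i' (win x 0 n))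
        (fun i _ => Finset.sum_nonneg fun i' _ => hq0 i i' _) (Finset.mem_range.2 (show i < K+1 by omega))
      have t2 := Finset.single_le_sum (f := fun i' => q i i' (win x 0 n))
        (fun i' _ => hq0 i i' _) (Finset.mem_range.2 (show i' < K+1 by omega))
      have t3 : 0 ≤ (c^n)⁻¹ := by positivity
      linarith
    refine le_trans ?_ (mul_le_mul_of_nonneg_left hle (by positivity : 0 ≤ M⁻¹))
    rw [← hq, ← hexpM, ← Real.exp_add, ← Real.exp_add, ← Real.exp_add]
    apply Real.exp_le_exp.2
    have r1 : ((i + i' : ℕ):ℝ) * Real.log c ≤ 2 * K * Real.log c := by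
      gcongr
      have : i + i' ≤ 2 * K := by omega
      exact_mod_cast this
    have r2 : h * m ≤ h * n := by
      gcongr; omega
    linarith

end code
end QFTPaper

namespace QFTPaper

section lemK
variable {A : Type} [Fintype A] [TopologicalSpace A] [DiscreteTopology A] [MeasurableSpace A] [BorelSpace A]

lemma tail_small {Ω : Type*} [MeasurableSpace Ω] {μ : Measure Ω} [IsProbabilityMeasure μ] {P : ℕ → Set Ω} (hP : ∀ i, MeasurableSet (P i))
    (h : ∀ᵐ x ∂μ, ∃ i, x ∈ P i) {ε : ℝ} (hε : 0 < ε) : ∃ K₀ : ℕ, ∀ K, K₀ ≤ K → μ.real {x | ∀ i, i ≤ K → x ∉ P i} ≤ ε := by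
  have hm : ∀ K : ℕ, MeasurableSet {x | ∀ i, i ≤ K → x ∉ P i} := by
    intro K
    have : {x | ∀ i, i ≤ K → x ∉ P i} = ⋂ i, ⋂ _ : i ≤ K, (P i)ᶜ := by ext x; simp
    rw [this]
    exact MeasurableSet.iInter fun i => MeasurableSet.iInter fun _ => (hP i).compl
  have h1 := tendsto_measure_iInter_atTop (μ := μ) (s := fun K : ℕ => {x | ∀ i, i ≤ K → x ∉ P i})
    (fun K => (hm K).nullMeasurableSet) (fun K K' hK x hx i hi => hx i (hi.trans hK)) ⟨0, measure_ne_top _ _⟩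
  have h2 : μ (⋂ K : ℕ, {x | ∀ i, i ≤ K → x ∉ P i}) = 0 := by
    rw [ae_iff] at h
    refine measure_mono_null ?_ h
    intro x hx
    simp only [mem_iInter, mem_ofPred_eq] at hx
    simp only [mem_ofPred_eq, not_exists]
    exact fun i => hx i i le_rfl
  rw [h2] at h1
  have h3 := (ENNReal.tendsto_toReal (by simp)).comp h1
  have h4 := h3.eventually (gt_mem_nhds (show (0 : ENNReal).toReal < ε by simpa using hε))
  obtain ⟨K₀, hK⟩ := eventually_atTop.1 h4
  exact ⟨K₀, fun K h => (hK K h).le⟩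

lemma ae_visit {X : Set (ℤ → A)} {S : Set (ℕ → A)} {μ : Measure (ℤ → A)} [IsProbabilityMeasure μ] (he : Ergodic shift μ)
    (hE : μ {x | Est X x 0 S} ≠ 0) : (∀ᵐ x ∂μ, ∃ i : ℕ, Est X x i S) ∧ ∀ᵐ x ∂μ, ∃ i : ℕ, Est X x (-i) S := by
  have hs : ∀ (x : ℤ → A) (i : ℤ), Est X (shift x) i S ↔ Est X x (i+1) S := fun x i => Est_sh (k := 1)
  constructor
  · have hm : MeasurableSet {x | ∃ i : ℕ, Est X x i S} := by
      rw [ofPred_exists]; exact MeasurableSet.iUnion fun i => meas_Est X _ S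
    rcases he.ae_empty_or_univ_of_preimage_ae_le hm.nullMeasurableSet (LE.le.eventuallyLE (by
      rintro x ⟨i, hi⟩
      have hi : Est X (shift x) i S := hi
      rw [hs] at hi
      exact ⟨i+1, by push_cast; exact hi⟩)) with h | h
    · exfalso; apply hE
      refine measure_mono_null ?_ (ae_eq_empty.1 h)
      intro x hx; exact ⟨0, hx⟩
    · exact ae_eq_univ.1 h
  · have hm : MeasurableSet {x | ∃ i : ℕ, Est X x (-i) S} := by
      rw [ofPred_exists]; exact MeasurableSet.iUnion fun i => meas_Est X _ S
    rcases he.ae_empty_or_univ_of_ae_le_preimage hm.nullMeasurableSet (LE.le.eventuallyLE (by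
      rintro x ⟨i, hi⟩
      refine ⟨i+1, ?_⟩
      rw [hs]
      convert hi using 1
      push_cast; ring)) with h | h
    · exfalso; apply hE
      refine measure_mono_null ?_ (ae_eq_empty.1 h)
      intro x hx; exact ⟨0, by simpa using hx⟩
    · exact ae_eq_univ.1 h

/-- entropy estimate for tilted codes -/
lemma tilt_bound {X : Set (ℤ → A)} {S : Set (ℕ → A)} {μ : Measure (ℤ → A)} [IsProbabilityMeasure μ] (he : Ergodic shift μ)
    (hE : μ {x | Est X x 0 S} ≠ 0)
    {h : ℝ} (hh : 0 ≤ h) (hKS : h ≤ KSEntropy μ) {ρ : Set (ℕ → A) → ℝ} (hρ : ρ S = 1) (h0 : ∀ d, 0 ≤ ρ (run S d))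
    (h1 : ∀ d : List A, ∑ a : A, ρ (run S (d ++ [a])) ≤ Real.exp h * ρ (run S d)) (τ : List A → A → ℝ)
    (hτ0 : ∀ u a, 0 < τ u a)
    (hp1 : ∀ u, ∑ a, Real.exp (-h) * ρ (run S (u ++ [a])) / ρ (run S u) * τ u a ≤ 1)
    (ψ : (ℤ → A) → ℝ) (Ψ : ℝ) (hΨ : ∀ y, |ψ y| ≤ Ψ) (hτΨ : ∀ u a, |Real.log (τ u a)| ≤ Ψ) (D : ℕ)
    (hψ : ∀ (x : ℤ → A) (i : ℤ) (k : ℕ), D ≤ k → Est X x i S → Real.log (τ (win x i k) (x (i+k))) = ψ (sh (i+k) x))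
    {I : ℝ} (h_integ : ∀ k : ℤ, Integrable (fun x => ψ (sh k x)) μ ∧ ∫ x, ψ (sh k x) ∂μ = I) : I ≤ 0 := by
  classical
  have hμ := he.toMeasurePreserving
  obtain ⟨hv1, hv2⟩ := ae_visit he hE
  set L := Real.log (Fintype.card A) with hL
  have hL0 : 0 ≤ L := Real.log_natCast_nonneg _
  obtain ⟨x0⟩ : Nonempty (ℤ → A) := by
    by_contra hne
    rw [not_nonempty_iff] at hne
    exact hE (by rw [Set.eq_empty_of_isEmpty {x : ℤ → A | Est X x 0 S}]; simp)
  have hΨ0 : 0 ≤ Ψ := (abs_nonneg _).trans (hΨ x0)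
  have key : ∀ ε : ℝ, 0 < ε → I ≤ 2 * (L + Ψ) * ε := by
    intro ε hε
    obtain ⟨K1, hK1⟩ := tail_small (fun i : ℕ => meas_Est X i S) hv1 hε
    obtain ⟨K2, hK2⟩ := tail_small (fun i : ℕ => meas_Est X (-i) S) hv2 hε
    let K := max K1 K2
    have g1 := hK1 K (le_max_left _ _)
    have g2 := hK2 K (le_max_right _ _)
    set V1 : Set (ℤ → A) := {x | ∀ i : ℕ, i ≤ K → x ∉ {x | Est X x i S}} with hV1
    set V2 : Set (ℤ → A) := {x | ∀ i : ℕ, i ≤ K → x ∉ {x | Est X x (-i) S}} with hV2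
    have hm1 : MeasurableSet V1 := by
      have : V1 = ⋂ i : ℕ, ⋂ _ : i ≤ K, ({x | Est X x i S})ᶜ := by ext x; simp [hV1]
      rw [this]
      exact MeasurableSet.iInter fun i => MeasurableSet.iInter fun _ => (meas_Est X _ S).compl
    have hm2 : MeasurableSet V2 := by
      have : V2 = ⋂ i : ℕ, ⋂ _ : i ≤ K, ({x | Est X x (-i) S})ᶜ := by ext x; simp [hV2]
      rw [this]
      exact MeasurableSet.iInter fun i => MeasurableSet.iInter fun _ => (meas_Est X _ S).compl
    suffices h : I - 2 * (L + Ψ) * ε ≤ 0 by linarith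
    refine lin_bound (b := Real.log ((K+1)^2+1) + 2 * K * L + (2*K+2*D)*Ψ) (2*K+1) fun n hn => ?_
    obtain ⟨Q, hQ0, hQ1, hQa, hQb⟩ := code_bound (X := X) hh hρ h0 h1 τ hτ0 hp1 ψ Ψ hΨ hτΨ D hψ K n (by omega)
    set c : ℝ := Real.log ((K+1)^2+1) + 2 * K * L + (2*K+2*D)*Ψ + h * n with hc
    have i1 := int_sh hμ 0 hm1
    have i2 := int_sh hμ n hm2
    have h_integψ : Integrable (fun x => ∑ m ∈ Finset.range n, ψ (sh m x)) μ := integrable_finset_sum _ fun m _ => (h_integ m).1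
    have hsi : ∫ x, ∑ m ∈ Finset.range n, ψ (sh (m:ℤ) x) ∂μ = n * I := by
      rw [integral_finset_sum _ (fun (m : ℕ) _ => (h_integ (m:ℤ)).1), Finset.sum_congr rfl (fun (m : ℕ) _ => (h_integ (m:ℤ)).2)]
      simp
    have hintV : Integrable (fun x => (n * (L + Ψ)) * ((if sh 0 x ∈ V1 then (1:ℝ) else 0) + (if sh n x ∈ V2 then (1:ℝ) else 0))) μ :=
      (i1.1.add i2.1).const_mul _
    have hintc : Integrable (fun x => c + (n * (L + Ψ)) * ((if sh 0 x ∈ V1 then (1:ℝ) else 0) + (if sh n x ∈ V2 then (1:ℝ) else 0))) μ :=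
      (integrable_const _).add hintV
    have hgibbs := gibbs_int μ n Q hQ0 hQ1 (fun x => (c + (n * (L + Ψ)) * ((if sh 0 x ∈ V1 then (1:ℝ) else 0) + (if sh n x ∈ V2 then (1:ℝ) else 0)))
      - ∑ m ∈ Finset.range n, ψ (sh m x)) (hintc.sub h_integψ) (ae_of_all _ fun x => ?_)
    · rw [integral_sub hintc h_integψ, integral_add (integrable_const _) hintV, integral_const_mul, integral_add i1.1 i2.1, i1.2, i2.2,
        hsi] at hgibbs
      simp only [integral_const, probReal_univ, one_smul, Finset.sum_const, Finset.card_range, nsmul_eq_mul] at hgibbs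
      have hk := KS_le μ n (by omega)
      have hk2 : h * n ≤ KSEntropy μ * n := by gcongr
      have hb : (n * (L + Ψ)) * (μ.real V1 + μ.real V2) ≤ (n * (L + Ψ)) * (ε + ε) := by gcongr
      linarith
    · have hsumle : ∑ m ∈ Finset.range n, ψ (sh m x) ≤ n * Ψ := by
        refine (Finset.sum_le_sum fun m _ => (le_abs_self _).trans (hΨ _)).trans ?_
        rw [Finset.sum_const, Finset.card_range, nsmul_eq_mul]
      by_cases hB : sh 0 x ∈ V1 ∨ sh n x ∈ V2
      · refine le_trans (Real.exp_le_exp.2 ?_) (hQa x)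
        have hge : (1:ℝ) ≤ (if sh 0 x ∈ V1 then (1:ℝ) else 0) + (if sh n x ∈ V2 then (1:ℝ) else 0) := by
          rcases hB with h | h
          · rw [if_pos h]; split_ifs <;> norm_num
          · rw [if_pos h]; split_ifs <;> norm_num
        have : n * (L + Ψ) * 1 ≤ n * (L + Ψ) * ((if sh 0 x ∈ V1 then (1:ℝ) else 0) + (if sh n x ∈ V2 then (1:ℝ) else 0)) := by gcongr
        have c0 : Real.log ((K+1)^2+1) ≤ c := by
          have : 0 ≤ 2 * K * L + (2*K+2*D)*Ψ + h * n := by positivity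
          linarith
        linarith
      · rw [not_or] at hB
        rw [if_neg hB.1, if_neg hB.2]
        simp only [hV1, hV2, mem_ofPred_eq, not_forall, not_not] at hB
        obtain ⟨⟨i, hi, hi2⟩, ⟨i', hi', hi2'⟩⟩ := hB
        rw [Est_sh, add_zero] at hi2
        rw [Est_sh, show -(i':ℤ) + n = n - i' by ring] at hi2'
        refine le_trans (le_of_eq ?_) (hQb x i i' hi hi' hi2 hi2')
        congr 1; rw [hc]; ring
  by_contra hI
  push Not at hI
  have hpos : 0 < 2 * (L + Ψ) + 1 := by linarith
  have := key (I / (2 * (2 * (L + Ψ) + 1))) (by positivity)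
  rw [mul_div_assoc'] at this
  rw [le_div_iff₀ (by linarith)] at this
  nlinarith

end lemK
end QFTPaper

namespace QFTPaper

section lemK2
variable {A : Type} [Fintype A] [TopologicalSpace A] [DiscreteTopology A] [MeasurableSpace A] [BorelSpace A]

lemma log_quad {y : ℝ} (h1 : -(1/2) ≤ y) : y - 2 * y^2 ≤ Real.log (1 + y) := by
  have hp : 0 < 1 + y := by linarith
  refine le_trans ?_ (Real.one_sub_inv_le_log_of_pos hp)
  have : 1 - (1+y)⁻¹ = y - y^2 * (1+y)⁻¹ := by field_simp; ring
  rw [this]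
  have h2 : (1+y)⁻¹ ≤ 2 := by
    rw [inv_le_comm₀ hp (by norm_num)]; linarith
  nlinarith [sq_nonneg y]

lemma lemK {X : Set (ℤ → A)} {S : Set (ℕ → A)} {μ : Measure (ℤ → A)} [IsProbabilityMeasure μ] (he : Ergodic shift μ)
    (hE : μ {x | Est X x 0 S} ≠ 0)
    {h : ℝ} (hh : 0 ≤ h) (hKS : h ≤ KSEntropy μ) {ρ : Set (ℕ → A) → ℝ} (hρ : ρ S = 1) (h0 : ∀ d, 0 ≤ ρ (run S d))
    (h1 : ∀ d : List A, ∑ a : A, ρ (run S (d ++ [a])) ≤ Real.exp h * ρ (run S d)) (d : List A) (a0 : A) :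
    μ.real {y | (Est X y (-d.length) S ∧ win y (-d.length) d.length = d) ∧ y 0 = a0} ≤
      Real.exp (-h) * ρ (run S (d ++ [a0])) / ρ (run S d) * μ.real {y | Est X y (-d.length) S ∧ win y (-d.length) d.length = d} := by
  classical
  have hμ := he.toMeasurePreserving
  set P : Set (ℤ → A) := {y | Est X y (-d.length) S ∧ win y (-d.length) d.length = d} with hP
  set P1 : Set (ℤ → A) := {y | (Est X y (-d.length) S ∧ win y (-d.length) d.length = d) ∧ y 0 = a0} with hP1
  have hmP : MeasurableSet P := (meas_Est X _ S).inter (meas_win_eq _ _ _)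
  have hmP1 : MeasurableSet P1 := by
    have hm : MeasurableSet {y : ℤ → A | y 0 = a0} := by
      have : {y : ℤ → A | y 0 = a0} = {y | win y 0 1 = [a0]} := by ext x; simp [win_succ]
      rw [this]; exact meas_win_eq _ _ _
    exact hmP.inter hm
  set e0 := Real.exp (-h) * ρ (run S (d ++ [a0])) / ρ (run S d) with he0
  have hpi : ∀ u a, 0 ≤ Real.exp (-h) * ρ (run S (u ++ [a])) / ρ (run S u) := fun u a =>
    div_nonneg (mul_nonneg (Real.exp_nonneg _) (h0 _)) (h0 _)
  have hpis : ∀ u, ∑ a, Real.exp (-h) * ρ (run S (u ++ [a])) / ρ (run S u) ≤ 1 := by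
    intro u
    rw [← Finset.sum_div, ← Finset.mul_sum]
    refine div_le_one_of_le₀ ?_ (h0 _)
    calc Real.exp (-h) * ∑ a, ρ (run S (u ++ [a])) ≤ Real.exp (-h) * (Real.exp h * ρ (run S u)) :=
          mul_le_mul_of_nonneg_left (h1 u) (Real.exp_nonneg _)
      _ = ρ (run S u) := by rw [← mul_assoc, ← Real.exp_add]; simp
  have he00 : 0 ≤ e0 := hpi d a0
  have he01 : e0 ≤ 1 := (Finset.single_le_sum (f := fun a => Real.exp (-h) * ρ (run S (d ++ [a])) / ρ (run S d)) (fun a _ => hpi d a) (Finset.mem_univ a0)).trans (hpis d)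
  have main : ∀ s : ℝ, 0 < s → s ≤ 1/2 →
      μ.real P1 * Real.log (1 + s * (1 - e0)) + (μ.real P - μ.real P1) * Real.log (1 + s * (0 - e0)) ≤ 0 := by
    intro s hs hs2
    have q : ∀ b : ℝ, 0 ≤ b → b ≤ 1 → 1/2 ≤ 1 + s * (b - e0) ∧ 1 + s * (b - e0) ≤ 3/2 := by
      intro b hb0 hb1
      constructor <;> nlinarith
    have ql : ∀ b : ℝ, 0 ≤ b → b ≤ 1 → |Real.log (1 + s * (b - e0))| ≤ 1 := by
      intro b hb0 hb1
      obtain ⟨qa, qb⟩ := q b hb0 hb1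
      have hp : 0 < 1 + s * (b - e0) := by linarith
      rw [abs_le]
      constructor
      · refine le_trans ?_ (Real.one_sub_inv_le_log_of_pos hp)
        have : (1 + s * (b - e0))⁻¹ ≤ 2 := by
          rw [inv_le_comm₀ hp (by norm_num)]; linarith
        linarith
      · refine (Real.log_le_sub_one_of_pos hp).trans ?_
        linarith
    let χ : A → ℝ := fun a => if a = a0 then 1 else 0
    have hχ0 : ∀ a, 0 ≤ χ a := fun a => by simp only [χ]; split_ifs <;> norm_num
    have hχ1 : ∀ a, χ a ≤ 1 := fun a => by simp only [χ]; split_ifs <;> norm_num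
    let cond : List A → Prop := fun u => ∃ u', u = u' ++ d ∧ run S u' = S
    let τ : List A → A → ℝ := fun u a => if cond u then 1 + s * (χ a - e0) else 1
    let ψ : (ℤ → A) → ℝ := fun y => if y ∈ P then Real.log (1 + s * (χ (y 0) - e0)) else 0
    refine tilt_bound (ρ := ρ) he hE hh hKS hρ h0 h1 τ ?_ ?_ ψ 1 ?_ ?_ d.length ?_ ?_
    · intro u a
      simp only [τ]
      split_ifs
      · linarith [(q (χ a) (hχ0 a) (hχ1 a)).1]
      · norm_num
    · intro u
      simp only [τ]
      by_cases hc : cond u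
      · simp only [if_pos hc]
        obtain ⟨u', rfl, hu'⟩ := hc
        have hr : ∀ v, run S (u' ++ d ++ v) = run S (d ++ v) := by
          intro v; rw [List.append_assoc, run_append, hu']
        have hr' : run S (u' ++ d) = run S d := by rw [run_append, hu']
        simp only [hr, hr']
        have hsum := hpis d
        set σ := ∑ a, Real.exp (-h) * ρ (run S (d ++ [a])) / ρ (run S d) with hσ
        have : ∑ a, Real.exp (-h) * ρ (run S (d ++ [a])) / ρ (run S d) * (1 + s * (χ a - e0)) = σ * (1 - s * e0) + s * e0 := by
          have e1 : ∀ a, Real.exp (-h) * ρ (run S (d ++ [a])) / ρ (run S d) * (1 + s * (χ a - e0)) =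
            Real.exp (-h) * ρ (run S (d ++ [a])) / ρ (run S d) * (1 - s * e0) + (if a = a0 then s * (Real.exp (-h) * ρ (run S (d ++ [a])) / ρ (run S d)) else 0) := by
            intro a
            simp only [χ]
            split_ifs <;> ring
          rw [Finset.sum_congr rfl fun a _ => e1 a, Finset.sum_add_distrib, ← Finset.sum_mul, Finset.sum_ite_eq' Finset.univ a0]
          simp [← he0, ← hσ]
        rw [this]
        have g : 0 ≤ 1 - s * e0 := by nlinarith
        have := mul_le_mul_of_nonneg_right hsum g
        linarith
      · simp only [if_neg hc, mul_one]; exact hpis u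
    · intro y
      simp only [ψ]
      split_ifs
      · exact ql _ (hχ0 _) (hχ1 _)
      · simp
    · intro u a
      simp only [τ]
      split_ifs
      · exact ql _ (hχ0 _) (hχ1 _)
      · simp
    · intro x i k hk hx
      obtain ⟨j, rfl⟩ : ∃ j, k = j + d.length := ⟨k - d.length, by omega⟩
      have hiff : cond (win x i (j + d.length)) ↔ sh (i + (j + d.length : ℕ)) x ∈ P := by
        simp only [cond, hP, mem_ofPred_eq, Est_sh, win_sh]
        rw [show -(d.length:ℤ) + (i + (j + d.length : ℕ)) = i + j by push_cast; ring]
        rw [win_add]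
        constructor
        · rintro ⟨u', h2, h3⟩
          obtain ⟨h4, h5⟩ := List.append_inj' h2 (by simp)
          refine ⟨?_, h5⟩
          have := Est_run hx j
          rwa [h4, h3] at this
        · rintro ⟨h2, h3⟩
          exact ⟨win x i j, by rw [h3], Est_unique (Est_run hx j) h2⟩
      simp only [τ, ψ]
      by_cases hc : cond (win x i (j + d.length))
      · rw [if_pos hc, if_pos (hiff.1 hc)]
        congr 5
        simp [sh]
      · rw [if_neg hc, if_neg (fun h' => hc (hiff.2 h'))]; simp
    · intro k
      have hψ : (fun x => ψ (sh k x)) = fun x => (Real.log (1 + s * (1 - e0)) - Real.log (1 + s * (0 - e0))) * (if sh k x ∈ P1 then (1:ℝ) else 0)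
          + Real.log (1 + s * (0 - e0)) * (if sh k x ∈ P then (1:ℝ) else 0) := by
        funext x
        simp only [ψ]
        by_cases hp : sh k x ∈ P
        · by_cases ha : sh k x 0 = a0
          · have hp1 : sh k x ∈ P1 := ⟨hp, ha⟩
            rw [if_pos hp, if_pos hp, if_pos hp1]; simp [χ, ha]
          · have hp1 : sh k x ∉ P1 := fun h' => ha h'.2
            rw [if_pos hp, if_pos hp, if_neg hp1]; simp [χ, ha]
        · have hp1 : sh k x ∉ P1 := fun h' => hp h'.1
          rw [if_neg hp, if_neg hp, if_neg hp1]; simp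
      have i1 := int_sh hμ k hmP1
      have i2 := int_sh hμ k hmP
      rw [hψ]
      refine ⟨(i1.1.const_mul _).add (i2.1.const_mul _), ?_⟩
      rw [integral_add (i1.1.const_mul _) (i2.1.const_mul _), integral_const_mul, integral_const_mul, i1.2, i2.2]
      ring
  have hPle : μ.real P1 ≤ μ.real P := measureReal_mono (fun y hy => hy.1)
  have hP1le : μ.real P ≤ 1 := measureReal_le_one
  have hP10 : 0 ≤ μ.real P1 := measureReal_nonneg
  by_contra hcon
  push Not at hcon
  set δ := μ.real P1 - e0 * μ.real P with hδ
  have hδ0 : 0 < δ := by linarith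
  have hδ1 : δ ≤ 1 := by nlinarith [mul_nonneg he00 (hP10.trans hPle)]
  have hm := main (δ/4) (by linarith) (by linarith)
  have l1 := log_quad (y := δ/4 * (1 - e0)) (by nlinarith)
  have l2 := log_quad (y := δ/4 * (0 - e0)) (by nlinarith)
  have b1 : (1 - e0)^2 ≤ 1 := by nlinarith
  have b2 : (0 - e0)^2 ≤ 1 := by nlinarith
  have k1 : δ/4 * (1 - e0) - 2 * (δ/4)^2 ≤ Real.log (1 + δ/4 * (1 - e0)) := by
    refine le_trans ?_ l1
    rw [mul_pow]; nlinarith [sq_nonneg (δ/4)]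
  have k2 : δ/4 * (0 - e0) - 2 * (δ/4)^2 ≤ Real.log (1 + δ/4 * (0 - e0)) := by
    refine le_trans ?_ l2
    rw [mul_pow]; nlinarith [sq_nonneg (δ/4)]
  have m1 := mul_le_mul_of_nonneg_left k1 hP10
  have m2 := mul_le_mul_of_nonneg_left k2 (sub_nonneg.2 hPle)
  have : δ/4 * δ - 2 * (δ/4)^2 * μ.real P ≤ 0 := by
    have : δ/4 * δ - 2 * (δ/4)^2 * μ.real P = μ.real P1 * (δ / 4 * (1 - e0) - 2 * (δ / 4) ^ 2) + (μ.real P - μ.real P1) * (δ / 4 * (0 - e0) - 2 * (δ / 4) ^ 2) := by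
      rw [hδ]; ring
    linarith
  nlinarith [sq_pos_of_pos hδ0]

end lemK2
end QFTPaper

namespace QFTPaper

section uniq
variable {A : Type} [Fintype A] [TopologicalSpace A] [DiscreteTopology A] [MeasurableSpace A] [BorelSpace A]

lemma m_le {X : Set (ℤ → A)} {S : Set (ℕ → A)} {μ : Measure (ℤ → A)} [IsProbabilityMeasure μ] (he : Ergodic shift μ)
    (hE : μ {x | Est X x 0 S} ≠ 0)
    {h : ℝ} (hh : 0 ≤ h) (hKS : h ≤ KSEntropy μ) {ρ : Set (ℕ → A) → ℝ} (hρ : ρ S = 1) (h0 : ∀ d, 0 ≤ ρ (run S d))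
    (h1 : ∀ d : List A, ∑ a : A, ρ (run S (d ++ [a])) ≤ Real.exp h * ρ (run S d)) (d : List A) :
    μ.real ({x | win x 0 d.length = d} ∩ {x | Est X x 0 S}) ≤ μ.real {x | Est X x 0 S} * (Real.exp (-h * d.length) * ρ (run S d)) := by
  have hμ := he.toMeasurePreserving
  induction d using List.reverseRecOn with
  | nil => simp [hρ]
  | append_singleton d a ih =>
    have hk := lemK he hE hh hKS hρ h0 h1 d a
    have e1 : {x | win x 0 d.length = d} ∩ {x | Est X x 0 S} = sh (d.length) ⁻¹' {y | Est X y (-d.length) S ∧ win y (-d.length) d.length = d} := by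
      ext x
      simp only [mem_inter_iff, mem_ofPred_eq, mem_preimage, Est_sh, win_sh, neg_add_cancel]
      tauto
    have e2 : {x | win x 0 (d ++ [a]).length = d ++ [a]} ∩ {x | Est X x 0 S} = sh (d.length) ⁻¹' {y | (Est X y (-d.length) S ∧ win y (-d.length) d.length = d) ∧ y 0 = a} := by
      ext x
      simp only [mem_inter_iff, mem_ofPred_eq, mem_preimage, Est_sh, win_sh, neg_add_cancel, List.length_append, List.length_singleton, win_succ']
      have : win x 0 d.length ++ [x (0 + d.length)] = d ++ [a] ↔ win x 0 d.length = d ∧ x (0 + d.length) = a := by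
        constructor
        · intro h
          obtain ⟨h2, h3⟩ := List.append_inj' h rfl
          exact ⟨h2, by simpa using h3⟩
        · rintro ⟨h2, h3⟩; rw [h2, h3]
      rw [this]
      simp only [sh]
      tauto
    have hmP : MeasurableSet {y : ℤ → A | Est X y (-d.length) S ∧ win y (-d.length) d.length = d} := (meas_Est X _ S).inter (meas_win_eq _ _ _)
    have hmP1 : MeasurableSet {y : ℤ → A | (Est X y (-d.length) S ∧ win y (-d.length) d.length = d) ∧ y 0 = a} := by
      have hm : MeasurableSet {y : ℤ → A | y 0 = a} := by
        have : {y : ℤ → A | y 0 = a} = {y | win y 0 1 = [a]} := by ext x; simp [win_succ]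
        rw [this]; exact meas_win_eq _ _ _
      exact hmP.inter hm
    rw [e1, (sh_mp hμ _).measureReal_preimage hmP.nullMeasurableSet] at ih
    rw [e2, (sh_mp hμ _).measureReal_preimage hmP1.nullMeasurableSet]
    refine hk.trans ?_
    have hc : 0 ≤ Real.exp (-h) * ρ (run S (d ++ [a])) / ρ (run S d) := div_nonneg (mul_nonneg (Real.exp_nonneg _) (h0 _)) (h0 _)
    refine (mul_le_mul_of_nonneg_left ih hc).trans ?_
    have hm0 : 0 ≤ μ.real {x | Est X x 0 S} := measureReal_nonneg
    have hexp : Real.exp (-h * (d ++ [a]).length) = Real.exp (-h) * Real.exp (-h * d.length) := by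
      rw [← Real.exp_add]; congr 1; simp; ring
    rw [hexp]
    rcases eq_or_ne (ρ (run S d)) 0 with hz | hz
    · rw [hz]; simp
      exact mul_nonneg hm0 (mul_nonneg (by positivity) (h0 _))
    · apply le_of_eq; field_simp

lemma rho_sum {S : Set (ℕ → A)} {h : ℝ} {ρ : Set (ℕ → A) → ℝ} (hρ : ρ S = 1)
    (h1 : ∀ d : List A, ∑ a : A, ρ (run S (d ++ [a])) ≤ Real.exp h * ρ (run S d)) (n : ℕ) :
    ∑ d ∈ words A n, Real.exp (-h * n) * ρ (run S d) ≤ 1 := by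
  induction n with
  | zero => simp [words_zero, hρ]
  | succ n ih =>
    rw [sum_words_add]
    refine le_trans (Finset.sum_le_sum fun u _ => ?_) ih
    rw [sum_words_one, ← Finset.mul_sum]
    refine (mul_le_mul_of_nonneg_left (h1 u) (Real.exp_nonneg _)).trans (le_of_eq ?_)
    rw [← mul_assoc, ← Real.exp_add]; congr 2; push_cast; ring

lemma m_eq {X : Set (ℤ → A)} {S : Set (ℕ → A)} {μ : Measure (ℤ → A)} [IsProbabilityMeasure μ] (he : Ergodic shift μ)
    (hE : μ {x | Est X x 0 S} ≠ 0)
    {h : ℝ} (hh : 0 ≤ h) (hKS : h ≤ KSEntropy μ) {ρ : Set (ℕ → A) → ℝ} (hρ : ρ S = 1) (h0 : ∀ d, 0 ≤ ρ (run S d))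
    (h1 : ∀ d : List A, ∑ a : A, ρ (run S (d ++ [a])) ≤ Real.exp h * ρ (run S d)) (n : ℕ) (d : List A) (hd : d ∈ words A n) :
    μ.real ({x | win x 0 n = d} ∩ {x | Est X x 0 S}) = μ.real {x | Est X x 0 S} * (Real.exp (-h * n) * ρ (run S d)) := by
  have hle : ∀ d ∈ words A n, μ.real ({x | win x 0 n = d} ∩ {x | Est X x 0 S}) ≤ μ.real {x | Est X x 0 S} * (Real.exp (-h * n) * ρ (run S d)) := by
    intro d hd
    rw [mem_words] at hd
    subst hd
    exact m_le he hE hh hKS hρ h0 h1 d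
  refine (Finset.sum_eq_sum_iff_of_le hle).1 (le_antisymm (Finset.sum_le_sum hle) ?_) d hd
  rw [sum_cyl, ← Finset.mul_sum]
  exact mul_le_of_le_one_right measureReal_nonneg (rho_sum hρ h1 n)

/-- forget the past -/
def rr (x : ℤ → A) : ℤ → A := fun n => x n.natAbs

/-- one sided shift in disguise -/
def fsh (x : ℤ → A) : ℤ → A := fun n => x (n.natAbs + 1)

lemma rr_meas : Measurable (rr : (ℤ → A) → (ℤ → A)) := measurable_pi_lambda _ fun _ => measurable_pi_apply _
lemma fsh_meas : Measurable (fsh : (ℤ → A) → (ℤ → A)) := measurable_pi_lambda _ fun _ => measurable_pi_apply _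

lemma rr_semi : Function.Semiconj (rr : (ℤ → A) → (ℤ → A)) shift fsh := by
  intro x
  funext n
  simp only [rr, fsh, shift]
  congr 1

lemma map_rr_eq {μ ν : Measure (ℤ → A)} [IsProbabilityMeasure μ] [IsProbabilityMeasure ν]
    (h : ∀ (n : ℕ) (w : List A), μ {x | win x 0 n = w} = ν {x | win x 0 n = w}) : μ.map rr = ν.map rr := by
  have hP : ∀ (n : ℕ) (P : Set (List A)), μ {x | win x 0 n ∈ P} = ν {x | win x 0 n ∈ P} := by
    classical
    intro n P
    have h1 := sum_cyl μ n 0 {x | win x 0 n ∈ P}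
    have h2 := sum_cyl ν n 0 {x | win x 0 n ∈ P}
    rw [← ENNReal.toReal_eq_toReal_iff' (measure_ne_top _ _) (measure_ne_top _ _)]
    change μ.real _ = ν.real _
    rw [← h1, ← h2]
    refine Finset.sum_congr rfl fun w _ => ?_
    by_cases hw : w ∈ P
    · have : {x : ℤ → A | win x 0 n = w} ∩ {x | win x 0 n ∈ P} = {x | win x 0 n = w} := by
        ext x; constructor
        · exact fun h => h.1
        · intro h; exact ⟨h, by rw [mem_ofPred_eq] at h ⊢; rwa [h]⟩
      rw [this]; simp only [Measure.real, h n w]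
    · have : {x : ℤ → A | win x 0 n = w} ∩ {x | win x 0 n ∈ P} = ∅ := by
        ext x; constructor
        · rintro ⟨h, h'⟩; rw [mem_ofPred_eq] at h h'; rw [h] at h'; exact hw h'
        · intro h; exact absurd h (notMem_empty _)
      rw [this]; simp
  haveI := Measure.isProbabilityMeasure_map (μ := μ) rr_meas.aemeasurable
  haveI := Measure.isProbabilityMeasure_map (μ := ν) rr_meas.aemeasurable
  refine ext_cyl fun k n w => ?_
  rw [Measure.map_apply rr_meas (meas_win_eq _ _ _), Measure.map_apply rr_meas (meas_win_eq _ _ _)]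
  let N := k.natAbs + n
  have : (rr ⁻¹' {x : ℤ → A | win x k n = w}) = {x | win x 0 N ∈ {u | ∃ y : ℤ → A, win y 0 N = u ∧ win (rr y) k n = w}} := by
    ext x
    simp only [mem_preimage, mem_ofPred_eq]
    constructor
    · intro h; exact ⟨x, rfl, h⟩
    · rintro ⟨y, hy, h⟩
      rw [← h]
      apply win_congr
      intro i hi
      simp only [rr]
      have := (win_eq_iff y x N 0 0).1 hy ((k+i).natAbs) (by simp only [N]; omega)
      simpa using this.symm
  rw [this]
  exact hP N _

lemma of_map_rr {μ ν : Measure (ℤ → A)} [IsProbabilityMeasure μ] [IsProbabilityMeasure ν]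
    (hμ : MeasurePreserving shift μ μ) (hν : MeasurePreserving shift ν ν) (h : μ.map rr = ν.map rr) : μ = ν := by
  have key : ∀ (μ : Measure (ℤ → A)), MeasurePreserving shift μ μ → ∀ (k : ℤ) (n : ℕ) (w : List A),
      μ {x | win x k n = w} = μ.map rr {x | win x 0 n = w} := by
    intro μ hμ k n w
    rw [Measure.map_apply rr_meas (meas_win_eq _ _ _), ← (sh_mp hμ k).measure_preimage (((meas_win_eq n 0 w).preimage rr_meas).nullMeasurableSet)]
    congr 1
    ext x
    simp only [mem_preimage, mem_ofPred_eq]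
    rw [show win (rr (sh k x)) 0 n = win x k n from ?_]
    apply win_congr
    intro i hi
    simp only [rr, sh]
    congr 1
    omega
  refine ext_cyl fun k n w => ?_
  rw [key μ hμ, key ν hν, h]

lemma erg_eq {Ω : Type*} [MeasurableSpace Ω] {f : Ω → Ω} {μ ν κ : Measure Ω} [IsProbabilityMeasure μ] [IsProbabilityMeasure ν]
    (hμ : Ergodic f μ) (hν : Ergodic f ν) (h1 : κ ≪ μ) (h2 : κ ≪ ν) (h0 : κ ≠ 0) : μ = ν := by
  have hw := hμ.toMeasurePreserving.withDensity_rnDeriv hν.toMeasurePreserving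
  have hac := withDensity_absolutelyContinuous ν (μ.rnDeriv ν)
  obtain ⟨c, hc⟩ := hν.eq_smul_of_absolutelyContinuous hw hac
  have hdec := Measure.rnDeriv_add_singularPart μ ν
  rcases eq_or_ne c 0 with rfl | hc0
  · exfalso
    rw [hc, zero_smul, zero_add] at hdec
    have hs := Measure.mutuallySingular_singularPart μ ν
    rw [hdec] at hs
    exact h0 ((Measure.MutuallySingular.self_iff κ).1 (hs.mono_ac h1 h2))
  · have hle : ν.withDensity (μ.rnDeriv ν) ≤ μ := Measure.withDensity_rnDeriv_le μ ν
    have : ν ≪ μ := by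
      refine Measure.AbsolutelyContinuous.trans ?_ (Measure.absolutelyContinuous_of_le hle)
      rw [hc]
      exact Measure.absolutelyContinuous_smul hc0
    exact (hμ.eq_of_absolutelyContinuous hν.toMeasurePreserving this).symm

lemma max_unique {X : Set (ℤ → A)} {S : Set (ℕ → A)} {h : ℝ} (hh : 0 ≤ h) (hS : ∀ n, nl S S n ≤ Real.exp (h * n))
    {μ ν : Measure (ℤ → A)} [IsProbabilityMeasure μ] [IsProbabilityMeasure ν] (hμ : Ergodic shift μ) (hν : Ergodic shift ν)
    (hμK : h ≤ KSEntropy μ) (hνK : h ≤ KSEntropy ν)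
    (hEμ : μ {x | Est X x 0 S} ≠ 0) (hEν : ν {x | Est X x 0 S} ≠ 0) : μ = ν := by
  obtain ⟨ρ, hρ, h0, h1⟩ := rho_exists hS
  haveI := ProbabilityTheory.cond_isProbabilityMeasure hEμ
  haveI := ProbabilityTheory.cond_isProbabilityMeasure hEν
  have hmE := meas_Est X 0 S
  have key : ∀ (μ : Measure (ℤ → A)) [IsProbabilityMeasure μ], Ergodic shift μ → h ≤ KSEntropy μ → μ {x | Est X x 0 S} ≠ 0 →
      ∀ (n : ℕ) (w : List A), w ∈ words A n → ((ProbabilityTheory.cond μ {x | Est X x 0 S}) {x | win x 0 n = w}).toReal = Real.exp (-h * n) * ρ (run S w) := by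
    intro μ _ hμ hμK hEμ n w hw
    rw [ProbabilityTheory.cond_apply hmE, ENNReal.toReal_mul, ENNReal.toReal_inv, inter_comm]
    have := m_eq hμ hEμ hh hμK hρ h0 h1 n w hw
    simp only [Measure.real] at this
    rw [this, ← mul_assoc, inv_mul_cancel₀, one_mul]
    exact ENNReal.toReal_ne_zero.2 ⟨hEμ, measure_ne_top _ _⟩
  have hκ : (ProbabilityTheory.cond μ {x | Est X x 0 S}).map rr = (ProbabilityTheory.cond ν {x | Est X x 0 S}).map rr := by
    refine map_rr_eq fun n w => ?_
    by_cases hw : w ∈ words A n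
    · rw [← ENNReal.toReal_eq_toReal_iff' (measure_ne_top _ _) (measure_ne_top _ _), key μ hμ hμK hEμ n w hw, key ν hν hνK hEν n w hw]
    · have : {x : ℤ → A | win x 0 n = w} = ∅ := by
        ext x; constructor
        · intro h; rw [mem_ofPred_eq] at h; exact (hw (by rw [← h]; simp)).elim
        · intro h; exact absurd h (notMem_empty _)
      rw [this]; simp
  haveI := Measure.isProbabilityMeasure_map (μ := μ) rr_meas.aemeasurable
  haveI := Measure.isProbabilityMeasure_map (μ := ν) rr_meas.aemeasurable
  have e1 : Ergodic fsh (μ.map rr) := (rr_meas.measurePreserving μ).ergodic_of_ergodic_semiconj hμ fsh_meas rr_semi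
  have e2 : Ergodic fsh (ν.map rr) := (rr_meas.measurePreserving ν).ergodic_of_ergodic_semiconj hν fsh_meas rr_semi
  have a1 : (ProbabilityTheory.cond μ {x | Est X x 0 S}).map rr ≪ μ.map rr := ProbabilityTheory.cond_absolutelyContinuous.map rr_meas
  have a2 : (ProbabilityTheory.cond μ {x | Est X x 0 S}).map rr ≪ ν.map rr := by
    rw [hκ]; exact ProbabilityTheory.cond_absolutelyContinuous.map rr_meas
  haveI := Measure.isProbabilityMeasure_map (μ := ProbabilityTheory.cond μ {x | Est X x 0 S}) rr_meas.aemeasurable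
  exact of_map_rr hμ.toMeasurePreserving hν.toMeasurePreserving (erg_eq e1 e2 a1 a2 (IsProbabilityMeasure.ne_zero _))

lemma part2b {X : Set (ℤ → A)} (hX : IsSubshift X) (h : hCstar X < hTop X) :
    {μ : Measure (ℤ → A) | IsMaxMeasure X μ}.Countable := by
  have h0 := hCstar_nonneg X
  have hh : 0 ≤ hTop X := h0.trans h.le
  have hne := nonempty_of_hTop hX (h0.trans_lt h)
  obtain ⟨f, hf⟩ : ∃ f : ℕ → List A, Function.Surjective f := exists_surjective_nat (List A)
  have charge : ∀ μ : Measure (ℤ → A), IsMaxMeasure X μ → ∃ k : ℕ, μ {x | Est X x 0 (F X (f k))} ≠ 0 := by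
    rintro μ ⟨hp, hμX, he, hK⟩
    by_contra hcon
    push Not at hcon
    obtain ⟨t, ht1, ht2⟩ := exists_between h
    obtain ⟨lam, hl1, hl2⟩ := exists_between ht2
    obtain ⟨C, hC, hCb⟩ := ELC_bound ht1
    obtain ⟨N, hN⟩ := weight_tail hCb hl1 (show (0:ℝ) < 1/2 by norm_num)
    have hfin : KSEntropy μ ≤ lam := by
      refine lemA he.toMeasurePreserving (𝓑 := {w | w ∈ {w | IsExtendable X w} ∧ N < w.length}) (h0.trans (ht1.trans hl1).le) ?_ (hN N le_rfl) ?_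
      · intro h; have := h.2; simp at this
      · have a1 : ∀ᵐ x ∂μ, x ∈ X := by rw [ae_iff]; exact hμX
        have a2 : ∀ᵐ x ∂μ, ∀ k, ¬ Est X x 0 (F X (f k)) := by
          rw [ae_all_iff]; intro k; rw [ae_iff]; simpa using hcon k
        filter_upwards [a1, a2] with x hx hx2
        obtain ⟨l, hl, hl'⟩ := bad_elc hX hx (by
          rintro ⟨S, hS⟩
          obtain ⟨M, hM⟩ := id hS
          obtain ⟨k, hk⟩ := hf (win x (0 - M) M)
          refine hx2 k ?_
          rw [hk, hM M le_rfl]; exact hS) N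
        exact ⟨l, by omega, hl', by simpa using hl⟩
    linarith
  choose! g hg using charge
  refine Set.MapsTo.countable_of_injOn (f := g) (t := Set.univ) (mapsTo_univ _ _) ?_ (Set.to_countable _)
  intro μ hμ ν hν hgk
  have h1 := hg μ hμ
  have h2 := hg ν hν
  rw [← hgk] at h2
  obtain ⟨hp, hμX, he, hK⟩ := hμ
  obtain ⟨hp', hνX, he', hK'⟩ := hν
  have hF : F X (f (g μ)) ≠ ∅ := by
    have a1 : ∀ᵐ x ∂μ, x ∈ X := by rw [ae_iff]; exact hμX
    have a2 : ∃ᵐ x ∂μ, Est X x 0 (F X (f (g μ))) := by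
      rw [frequently_ae_iff]; exact h1
    obtain ⟨x, hx, hx2⟩ := (a2.and_eventually a1).exists
    exact Est_ne hX hx2 hx
  exact max_unique hh (nl_le_exp hX _ hF) he he' hK.ge hK'.ge h1 h2

end uniq
end QFTPaper

namespace QFTPaper

section revsec
variable {A : Type}

/-- time reversal -/
def rv (x : ℤ → A) : ℤ → A := fun n => x (-n)

lemma rv_rv (x : ℤ → A) : rv (rv x) = x := by funext n; simp [rv]
lemma rev_eq (X : Set (ℤ → A)) : rev X = rv '' X := rfl
lemma mem_rev (X : Set (ℤ → A)) (x : ℤ → A) : x ∈ rev X ↔ rv x ∈ X := by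
  rw [rev_eq]; constructor
  · rintro ⟨y, hy, rfl⟩; rwa [rv_rv]
  · intro h; exact ⟨_, h, rv_rv x⟩
lemma rev_rev (X : Set (ℤ → A)) : rev (rev X) = X := by
  ext x; rw [mem_rev, mem_rev, rv_rv]

lemma rv_sh (k : ℤ) (x : ℤ → A) : rv (sh k x) = sh (-k) (rv x) := by
  funext n; simp only [rv, sh]; congr 1; ring

lemma shift_eq_sh (x : ℤ → A) : shift x = sh 1 x := rfl

lemma sh_sh' (k l : ℤ) (x : ℤ → A) : sh k (sh l x) = sh (k + l) x := by
  ext n; simp only [sh]; congr 1; ring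
lemma sh_zero' (x : ℤ → A) : sh 0 x = x := by ext n; simp [sh]

lemma rev_subshift [TopologicalSpace A] {X : Set (ℤ → A)} (hX : IsSubshift X) : IsSubshift (rev X) := by
  constructor
  · have : rev X = rv ⁻¹' X := by ext x; exact mem_rev X x
    rw [this]
    exact hX.1.preimage (continuous_pi fun n => continuous_apply _)
  · ext x
    rw [mem_rev]
    constructor
    · rintro ⟨y, hy, rfl⟩
      rw [shift_eq_sh, rv_sh, sh_mem_iff hX]
      exact (mem_rev X y).1 hy
    · intro h
      refine ⟨sh (-1) x, ?_, ?_⟩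
      · rw [mem_rev, rv_sh, sh_mem_iff hX]; exact h
      · rw [shift_eq_sh, sh_sh', show (1:ℤ) + -1 = 0 by ring, sh_zero']

lemma win_rv (x : ℤ → A) (n : ℕ) (k : ℤ) : win (rv x) k n = (win x (1 - k - n) n).reverse := by
  apply List.ext_getElem
  · simp
  · intro i h1 h2
    simp only [win_length, List.length_reverse] at h1 h2
    rw [win_getElem, List.getElem_reverse, win_getElem]
    simp only [rv, win_length]
    congr 1
    omega

lemma lang_rev [TopologicalSpace A] {X : Set (ℤ → A)} (hX : IsSubshift X) (n : ℕ) (w : List A) :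
    w ∈ Lang (rev X) n → w.reverse ∈ Lang X n := by
  have hocc : ∀ (x : ℤ → A) (w : List A), OccursAt w x 0 ↔ win x 0 w.length = w := by
    intro x w
    constructor
    · intro h
      apply List.ext_getElem
      · simp
      · intro i h1 h2
        rw [win_getElem]
        exact h ⟨i, h2⟩
    · intro h i
      have := win_getElem x w.length 0 i (by simp)
      rw [← this]
      simp [h]
  rintro ⟨hl, x, hx, ho⟩
  refine ⟨by simpa using hl, sh (1 - (n:ℤ)) (rv x), ?_, ?_⟩
  · rw [sh_mem_iff hX]; exact (mem_rev X x).1 hx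
  · rw [hocc] at ho ⊢
    rw [win_sh, win_rv, List.length_reverse, hl]
    rw [hl] at ho
    rw [← ho]
    congr 2
    ring

lemma card_lang_rev [TopologicalSpace A] {X : Set (ℤ → A)} (hX : IsSubshift X) (n : ℕ) :
    Nat.card ↥(Lang (rev X) n) = Nat.card ↥(Lang X n) := by
  refine Nat.card_congr ⟨fun w => ⟨w.1.reverse, lang_rev hX n _ w.2⟩, fun w => ⟨w.1.reverse, ?_⟩, ?_, ?_⟩
  · apply lang_rev (rev_subshift hX); rw [rev_rev]; exact w.2
  · intro w; simp
  · intro w; simp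

lemma hTop_rev [TopologicalSpace A] {X : Set (ℤ → A)} (hX : IsSubshift X) : hTop (rev X) = hTop X := by
  simp only [hTop, card_lang_rev hX]

lemma shift_iter' (n : ℕ) : ∀ x : ℤ → A, shift^[n] x = sh n x := by
  induction n with
  | zero => intro x; simp [sh_zero']
  | succ n ih =>
    intro x
    rw [Function.iterate_succ_apply, ih, shift_eq_sh, sh_sh']; congr 1

lemma per_rev (X : Set (ℤ → A)) (n : ℕ) {x : ℤ → A} (h : x ∈ rev X ∧ shift^[n] x = x) :
    rv x ∈ X ∧ shift^[n] (rv x) = rv x := by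
  refine ⟨(mem_rev X x).1 h.1, ?_⟩
  have h2 := h.2
  rw [shift_iter'] at h2 ⊢
  have : sh (-(n:ℤ)) (sh n x) = sh (-(n:ℤ)) x := by rw [h2]
  rw [sh_sh', neg_add_cancel, sh_zero'] at this
  have h3 := rv_sh (-(n:ℤ)) x
  rw [neg_neg] at h3
  rw [← h3, ← this]

lemma perCount_rev (X : Set (ℤ → A)) (n : ℕ) : perCount (rev X) n = perCount X n := by
  refine Nat.card_congr ⟨fun x => ⟨rv x.1, per_rev X n x.2⟩, fun x => ⟨rv x.1, per_rev (rev X) n ?_⟩, ?_, ?_⟩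
  · rw [rev_rev]; exact x.2
  · intro x; simp [rv_rv]
  · intro x; simp [rv_rv]

variable [Fintype A] [TopologicalSpace A] [DiscreteTopology A] [MeasurableSpace A] [BorelSpace A]

lemma rv_meas : Measurable (rv : (ℤ → A) → (ℤ → A)) := measurable_pi_lambda _ fun _ => measurable_pi_apply _

lemma ergodic_inv {μ : Measure (ℤ → A)} [IsProbabilityMeasure μ] (he : Ergodic shift μ) : Ergodic (sh (-1)) μ := by
  refine ⟨sh_mp he.toMeasurePreserving (-1), ⟨fun s hs hs' => he.toPreErgodic.aeconst_set hs ?_⟩⟩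
  rw [← hs', ← preimage_comp]
  conv_rhs => rw [hs']
  have : (sh (-1) ∘ shift : (ℤ → A) → (ℤ → A)) = id := by
    funext x
    simp [shift_eq_sh, sh_sh', sh_zero']
  rw [this]; rfl

lemma blockEntropy_rev {μ : Measure (ℤ → A)} [IsProbabilityMeasure μ] (hμ : MeasurePreserving shift μ μ) (n : ℕ) :
    blockEntropy (μ.map rv) n = blockEntropy μ n := by
  have hm : ∀ w : Fin n → A, MeasurableSet (cylSet n w) := by
    intro w
    have : cylSet n w = {x : ℤ → A | win x 0 n = List.ofFn w} := by
      ext x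
      simp only [cylSet, mem_ofPred_eq, win_ofFn, List.ofFn_inj, funext_iff, zero_add]
    rw [this]; exact meas_win_eq _ _ _
  refine Fintype.sum_equiv (Equiv.arrowCongr Fin.revPerm (Equiv.refl A)) _ _ fun w => ?_
  congr 2
  rw [Measure.map_apply rv_meas (hm w), ← (sh_mp hμ (1 - (n:ℤ))).measure_preimage ((hm _).nullMeasurableSet)]
  congr 1
  ext x
  simp only [cylSet, mem_preimage, mem_ofPred_eq, rv, sh, Equiv.arrowCongr_apply, Function.comp, Equiv.refl_apply]
  constructor
  · intro h i
    rw [← h]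
    congr 1
    simp [Fin.val_rev]
    omega
  · intro h i
    have := h (Fin.rev i)
    simp at this
    rw [← this]

lemma max_rev {X : Set (ℤ → A)} (hX : IsSubshift X) {μ : Measure (ℤ → A)} (h : IsMaxMeasure X μ) :
    IsMaxMeasure (rev X) (μ.map rv) := by
  obtain ⟨hp, hμX, he, hK⟩ := h
  refine ⟨Measure.isProbabilityMeasure_map rv_meas.aemeasurable, ?_, ?_, ?_⟩
  · rw [Measure.map_apply rv_meas (rev_subshift hX).1.measurableSet.compl]
    convert hμX using 2
    ext x
    simp only [mem_preimage, mem_compl_iff, mem_rev, rv_rv]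
  · refine (rv_meas.measurePreserving μ).ergodic_of_ergodic_semiconj (ergodic_inv he) shift_meas ?_
    intro x
    rw [rv_sh, neg_neg]; rfl
  · rw [hTop_rev hX, ← hK]
    simp only [KSEntropy, blockEntropy_rev he.toMeasurePreserving]

lemma map_rv_inj {μ ν : Measure (ℤ → A)} (h : μ.map rv = ν.map rv) : μ = ν := by
  have : ∀ μ : Measure (ℤ → A), (μ.map rv).map rv = μ := by
    intro μ
    rw [Measure.map_map rv_meas rv_meas, show (rv ∘ rv : (ℤ → A) → (ℤ → A)) = id from funext rv_rv, Measure.map_id]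
  rw [← this μ, h, this]

end revsec

/-- For a QFT, `0 < limsup #Fix(σⁿ)·e^{−n·h_top} < ∞`; for a
weak-QFT, `limsup (1/n) log #Fix(σⁿ) = h_top(X)` and there are at most
countably many maximum measures. -/
theorem qft_periodic_points_and_weakQFT_max_measures :
    (∀ (A : Type) [Fintype A] [TopologicalSpace A] [DiscreteTopology A]
        (X : Set (ℤ → A)), IsQFT X →
      0 < limsup (fun n : ℕ =>
            (perCount X n : ENNReal) *
              ENNReal.ofReal (Real.exp (-(n : ℝ) * hTop X))) atTop ∧
      limsup (fun n : ℕ =>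
            (perCount X n : ENNReal) *
              ENNReal.ofReal (Real.exp (-(n : ℝ) * hTop X))) atTop < ⊤) ∧
    (∀ (A : Type) [Fintype A] [TopologicalSpace A] [DiscreteTopology A]
        [MeasurableSpace A] [BorelSpace A]
        (X : Set (ℤ → A)), IsWeakQFT X →
      limsup (fun n : ℕ => Real.log (perCount X n) / (n : ℝ)) atTop = hTop X ∧
      {μ : Measure (ℤ → A) | IsMaxMeasure X μ}.Countable) := by
  constructor
  · rintro A _ _ _ X ⟨hX, h⟩
    rcases min_lt_iff.1 h with h | h
    · exact ⟨part1_lower hX h, part1_upper hX h⟩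
    · have hX' := rev_subshift hX
      rw [← hTop_rev hX] at h
      have h1 := part1_lower hX' h
      have h2 := part1_upper hX' h
      simp only [perCount_rev, hTop_rev hX] at h1 h2
      exact ⟨h1, h2⟩
  · rintro A _ _ _ _ _ X ⟨hX, h⟩
    rcases min_lt_iff.1 h with h | h
    · exact ⟨part2a hX h, part2b hX h⟩
    · have hX' := rev_subshift hX
      rw [← hTop_rev hX] at h
      have h1 := part2a hX' h
      simp only [perCount_rev, hTop_rev hX] at h1
      refine ⟨h1, ?_⟩
      exact Set.MapsTo.countable_of_injOn (f := fun μ : Measure (ℤ → A) => μ.map rv) (fun μ hμ => max_rev hX hμ)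
        (fun μ _ ν _ hμν => map_rv_inj hμν) (part2b hX' h)

end QFTPaper
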